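/- Let F ∈ S^♯♭(σ0,σ1), and let τ ≥ σ1 be a real number such that 0 ∉ Z(F) and τ ∉ Z(F). Then for every positive integer n, the n-th τ-Li coefficient of F is well defined: the symmetric limit λ_F(n,τ) = lim_{T→∞} ∑_{ρ∈Z(F), |Im ρ|≤T} ord(ρ)·(1 − (ρ/(ρ−τ))^n) exists. -/

import Mathlib

open Complex Filter MeasureTheory Finset

noncomputable section

/-- The order of vanishing of `f` at `ρ`. -/
noncomputable def zeroOrder (f : ℂ → ℂ) (ρ : ℂ) : ℕ :=
  sInf {k : ℕ | iteratedDeriv k f ρ ≠ 0}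

/-- The class `S^♯♭(σ₀,σ₁)` of `L`-functions. -/
structure SSF (σ0 σ1 : ℝ) : Type where
  hσ1pos : 0 < σ1
  hσ : σ1 ≤ σ0
  /-- The `L`-function itself (as a function, analytic away from the poles). -/
  F : ℂ → ℂ
  /-- Dirichlet series coefficients. -/
  a : ℕ → ℂ
  hDir : ∀ s : ℂ, σ0 < s.re →
    HasSum (fun n : ℕ => a (n + 1) * ((n + 1 : ℕ) : ℂ) ^ (-s)) (F s)
  hDirAbs : ∀ s : ℂ, σ0 < s.re →
    Summable (fun n : ℕ => ‖a (n + 1) * ((n + 1 : ℕ) : ℂ) ^ (-s)‖)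
  /-- The number of poles. -/
  N : ℕ
  /-- The poles `s₁, …, s_N`. -/
  pole : Fin N → ℂ
  /-- Their orders `m₁, …, m_N`. -/
  m : Fin N → ℕ
  hm : ∀ i, 0 < m i
  /-- Entire continuation of `∏ (s - sᵢ)^{mᵢ} · F s`, of finite order. -/
  G : ℂ → ℂ
  hGdiff : Differentiable ℂ G
  hGord : ∃ c B : ℝ, ∀ s : ℂ, ‖G s‖ ≤ c * Real.exp (‖s‖ ^ B)
  hGF : ∀ s : ℂ, (∀ i, s ≠ pole i) → G s = (∏ i, (s - pole i) ^ m i) * F s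
  Q : ℝ
  hQ : 0 < Q
  r : ℕ
  lam : Fin r → ℝ
  hlam : ∀ j, 0 < lam j
  mu : Fin r → ℂ
  ω : ℂ
  hω : ‖ω‖ = 1
  M : ℕ
  /-- `δ(σ₁) ∈ {0,1}`. -/
  dlt : ℕ
  hdlt : dlt ≤ 1
  hMN : 2 * M + dlt ≤ N
  hpair : ∀ (j : ℕ) (h1 : 2 * j < N) (h2 : 2 * j + 1 < N), j < M →
    pole ⟨2 * j, h1⟩ + (starRingEnd ℂ) (pole ⟨2 * j + 1, h2⟩) = (σ1 : ℂ)
  hdelta : dlt = 1 ↔ ∃ i, pole i = (σ1 / 2 : ℂ)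
  hdeltaPos : dlt = 1 → ∀ h2 : 2 * M < N, pole ⟨2 * M, h2⟩ = (σ1 / 2 : ℂ)
  /-- The completed function `ξ_F` (the analytic continuation of the completed product). -/
  xi : ℂ → ℂ
  hxiDiff : Differentiable ℂ xi
  hxiEq : ∀ s : ℂ, (∀ i, s ≠ pole i) →
    (∀ (j : Fin r) (k : ℕ), (lam j : ℂ) * s + mu j ≠ -(k : ℂ)) →
    xi s = F s * (Q : ℂ) ^ s * (∏ j, Complex.Gamma ((lam j : ℂ) * s + mu j)) *
      (∏ i, (s - pole i) ^ m i) *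
      ∏ i : Fin N, (if 2 * M + dlt ≤ (i : ℕ) then ((σ1 : ℂ) - s - (starRingEnd ℂ) (pole i)) ^ m i else 1)
  hFE : ∀ s : ℂ, xi s = ω * (starRingEnd ℂ) (xi ((σ1 : ℂ) - (starRingEnd ℂ) s))
  /-- The coefficients of the Dirichlet series of `-F'/F`. -/
  c : ℕ → ℂ
  hEuler : ∀ s : ℂ, σ0 < s.re →
    HasSum (fun n : ℕ => c (n + 2) * ((n + 2 : ℕ) : ℂ) ^ (-s)) (-(deriv F s / F s))
  hEulerAbs : ∀ s : ℂ, σ0 < s.re →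
    Summable (fun n : ℕ => ‖c (n + 2) * ((n + 2 : ℕ) : ℂ) ^ (-s)‖)

namespace SSF

variable {σ0 σ1 : ℝ}

/-- Truncated sum over the nontrivial zeros (zeros of `ξ_F`) with `|Im ρ| ≤ T`,
counted with multiplicity. -/
noncomputable def zsum (S : SSF σ0 σ1) (w : ℂ → ℂ) (T : ℝ) : ℂ :=
  ∑' ρ : {ρ : ℂ // S.xi ρ = 0 ∧ |ρ.im| ≤ T}, (zeroOrder S.xi ρ : ℂ) * w ρ

end SSF

/-- The Poisson kernel of the half-plane at height `c`, up to the factor `π`. -/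
def stripKernel (c u : ℝ) : ℝ := c / (c ^ 2 + u ^ 2)

/-- The odd weight `y / (1 + y²)`. -/
def oddWeight (y : ℝ) : ℝ := y / (1 + y ^ 2)

/-- The weight `y / (1 + y²)` truncated to `|y| ≤ T`. -/
def truncWeight (T y : ℝ) : ℝ := if |y| ≤ T then oddWeight y else 0

/-- The integrable majorant `(1 + |u|) ^ (-3/2)`. -/
def decay (u : ℝ) : ℝ := (1 + |u|) ^ (-(3 / 2) : ℝ)

lemma decay_nonneg (u : ℝ) : 0 ≤ decay u := by unfold decay; positivity

lemma integrable_decay : Integrable decay := by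
  have := integrable_one_add_norm (E := ℝ) (μ := volume) (r := 3 / 2) (by norm_num)
  unfold decay
  simpa [Real.norm_eq_abs] using this

lemma stripKernel_nonneg {c : ℝ} (hc : 0 ≤ c) (u : ℝ) : 0 ≤ stripKernel c u := by
  unfold stripKernel; positivity

lemma continuous_stripKernel {c : ℝ} (hc : 1 ≤ c) : Continuous (stripKernel c) := by
  unfold stripKernel
  refine continuous_const.div (by fun_prop) fun u => ?_
  positivity

lemma continuous_oddWeight : Continuous oddWeight := by
  unfold oddWeight
  refine continuous_id.div (by fun_prop) fun u => ?_
  positivity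

lemma measurable_truncWeight (T : ℝ) : Measurable (truncWeight T) :=
  Measurable.ite (measurableSet_le (by fun_prop) measurable_const)
    continuous_oddWeight.measurable measurable_const

lemma stripKernel_le {c C u : ℝ} (hc : 1 ≤ c) (hC : c ≤ C) : stripKernel c u ≤ C / (1 + u ^ 2) := by
  unfold stripKernel
  rw [div_le_div_iff₀ (by positivity) (by positivity)]
  have : 1 ≤ c ^ 2 := by nlinarith
  have h2 : 0 ≤ u ^ 2 := sq_nonneg u
  nlinarith [mul_nonneg (sub_nonneg.2 hC) h2]

lemma le_stripKernel {c C u : ℝ} (hc : 1 ≤ c) (hC : c ≤ C) :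
    1 / (C ^ 2 * (1 + u ^ 2)) ≤ stripKernel c u := by
  unfold stripKernel
  have hC0 : 0 < C := by linarith
  rw [div_le_div_iff₀ (by positivity) (by positivity)]
  have : c ^ 2 ≤ C ^ 2 := by nlinarith
  have h2 : 0 ≤ u ^ 2 := sq_nonneg u
  have h1 : 1 ≤ C ^ 2 := by nlinarith
  nlinarith [mul_nonneg (sub_nonneg.2 h1) h2, mul_nonneg (sub_nonneg.2 hc)
    (by positivity : 0 ≤ C ^ 2 * (1 + u ^ 2))]

lemma stripKernel_le_abs {c C u : ℝ} (hc : 1 ≤ c) (hC : c ≤ C) :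
    stripKernel c u ≤ 2 * C / (1 + |u|) ^ 2 := by
  refine (stripKernel_le hc hC).trans ?_
  rw [div_le_div_iff₀ (by positivity) (by positivity)]
  have h3 := sq_abs u
  have : (1 + |u|) ^ 2 ≤ 2 * (1 + u ^ 2) := by nlinarith [sq_nonneg (1 - |u|)]
  nlinarith

lemma inv_sq_le_decay (u : ℝ) : 1 / (1 + |u|) ^ 2 ≤ decay u := by
  unfold decay
  rw [one_div, ← Real.rpow_natCast, ← Real.rpow_neg (by positivity)]
  exact Real.rpow_le_rpow_of_exponent_le (by linarith [abs_nonneg u]) (by norm_num)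

lemma stripKernel_le_decay {c C : ℝ} (hc : 1 ≤ c) (hC : c ≤ C) (u : ℝ) :
    stripKernel c u ≤ 2 * C * decay u := by
  refine (stripKernel_le_abs hc hC).trans ?_
  rw [div_eq_mul_one_div]
  exact mul_le_mul_of_nonneg_left (inv_sq_le_decay u) (by linarith)

lemma integrable_stripKernel {c : ℝ} (hc : 1 ≤ c) : Integrable (stripKernel c) := by
  refine (integrable_decay.const_mul (2 * c)).mono' (continuous_stripKernel hc).aestronglyMeasurable
    (ae_of_all _ fun u => ?_)
  rw [Real.norm_of_nonneg (stripKernel_nonneg (by linarith) u)]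
  exact stripKernel_le_decay hc le_rfl u

lemma integral_stripKernel {c : ℝ} (hc : 1 ≤ c) : ∫ u, stripKernel c u = Real.pi := by
  have h := Measure.integral_comp_mul_left (fun x : ℝ => (1 + x ^ 2)⁻¹) c⁻¹
  rw [integral_univ_inv_one_add_sq] at h
  have hc0 : c ≠ 0 := by positivity
  have : ∀ u, stripKernel c u = c⁻¹ * (1 + (c⁻¹ * u) ^ 2)⁻¹ := fun u => by
    unfold stripKernel
    have : c ^ 2 + u ^ 2 ≠ 0 := by positivity
    field_simp
  simp_rw [this]
  rw [integral_const_mul, h, inv_inv, abs_of_pos (by linarith), smul_eq_mul]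
  field_simp

lemma abs_oddWeight_le (y : ℝ) : |oddWeight y| ≤ 2 / (1 + |y|) := by
  unfold oddWeight
  rw [abs_div, abs_of_pos (by positivity : (0 : ℝ) < 1 + y ^ 2),
    div_le_div_iff₀ (by positivity) (by positivity)]
  nlinarith [sq_abs y, sq_nonneg (1 - |y|), abs_nonneg y]

lemma abs_oddWeight_sub_le (x y : ℝ) :
    |oddWeight y - oddWeight x| ≤ 2 * |y - x| / ((1 + |y|) * (1 + |x|)) := by
  have e : oddWeight y - oddWeight x = (y - x) * (1 - y * x) / ((1 + y ^ 2) * (1 + x ^ 2)) := by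
    unfold oddWeight
    have : 1 + y ^ 2 ≠ 0 := by positivity
    have : 1 + x ^ 2 ≠ 0 := by positivity
    field_simp
    ring
  rw [e, abs_div, abs_mul, abs_of_pos (by positivity : (0 : ℝ) < (1 + y ^ 2) * (1 + x ^ 2)),
    div_le_div_iff₀ (by positivity) (by positivity)]
  have key : |1 - y * x| * ((1 + |y|) * (1 + |x|)) ≤ 2 * ((1 + y ^ 2) * (1 + x ^ 2)) := by
    refine abs_le_of_sq_le_sq' ?_ (by positivity) |>.2
    have h1 : (1 - y * x) ^ 2 ≤ (1 + y ^ 2) * (1 + x ^ 2) := by nlinarith [sq_nonneg (y + x)]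
    have h2 : (1 + |y|) ^ 2 ≤ 2 * (1 + y ^ 2) := by nlinarith [sq_abs y, sq_nonneg (1 - |y|)]
    have h3 : (1 + |x|) ^ 2 ≤ 2 * (1 + x ^ 2) := by nlinarith [sq_abs x, sq_nonneg (1 - |x|)]
    calc (|1 - y * x| * ((1 + |y|) * (1 + |x|))) ^ 2
        = (1 - y * x) ^ 2 * ((1 + |y|) ^ 2 * (1 + |x|) ^ 2) := by
          rw [mul_pow, mul_pow, sq_abs]
      _ ≤ ((1 + y ^ 2) * (1 + x ^ 2)) * ((2 * (1 + y ^ 2)) * (2 * (1 + x ^ 2))) := by gcongr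
      _ = _ := by ring
  calc |y - x| * |1 - y * x| * ((1 + |y|) * (1 + |x|))
      = |y - x| * (|1 - y * x| * ((1 + |y|) * (1 + |x|))) := by ring
    _ ≤ |y - x| * (2 * ((1 + y ^ 2) * (1 + x ^ 2))) := by gcongr
    _ = _ := by ring

lemma abs_truncWeight_sub_le (T x y : ℝ) :
    |truncWeight T y - truncWeight T x| ≤ 2 * |y - x| / ((1 + |y|) * (1 + |x|)) +
      if abs (T - |x|) ≤ |y - x| then 2 / (1 + |x|) else 0 := by
  have h1 := abs_oddWeight_sub_le x y
  have h2 := abs_oddWeight_le x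
  have h0 : 0 ≤ 2 * |y - x| / ((1 + |y|) * (1 + |x|)) := by positivity
  have h3 : 0 ≤ 2 / (1 + |x|) := by positivity
  have tri := abs_abs_sub_abs_le y x
  unfold truncWeight
  by_cases hy : |y| ≤ T <;> by_cases hx : |x| ≤ T
  · rw [if_pos hy, if_pos hx]; split_ifs <;> linarith
  · rw [if_pos hy, if_neg hx, if_pos]
    · have := abs_sub_abs_le_abs_sub (oddWeight y) (oddWeight x)
      rw [sub_zero]; linarith
    · rw [abs_of_nonpos (by linarith)]; linarith [neg_abs_le (|y| - |x|)]
  · rw [if_neg hy, if_pos hx, if_pos]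
    · rw [zero_sub, abs_neg]; linarith
    · rw [abs_of_nonneg (by linarith)]; linarith [le_abs_self (|y| - |x|)]
  · rw [if_neg hy, if_neg hx, sub_zero, abs_zero]; split_ifs <;> linarith

/-- The splitting `1 / (A B) ≤ g ^ (-1/16) (A ^ (-3/2) + B ^ (-3/2))` for `g ≤ A + B`. -/
lemma inv_mul_le_decay {u y g : ℝ} (hg : 1 ≤ g) (h : g ≤ (1 + |u|) + (1 + |y|)) :
    1 / ((1 + |u|) * (1 + |y|)) ≤ g ^ (-(1 / 16) : ℝ) * (decay u + decay y) := by
  unfold decay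
  set A := 1 + |u| with hA
  set B := 1 + |y| with hB
  have hA1 : 1 ≤ A := by simp [hA]
  have hB1 : 1 ≤ B := by simp [hB]
  have hA0 : 0 < A := by linarith
  have hB0 : 0 < B := by linarith
  have hS0 : 0 < A + B := by linarith
  have e : 1 / (A * B) = (A + B)⁻¹ * (A⁻¹ + B⁻¹) := by field_simp; ring
  have hS : (A + B)⁻¹ ≤ g ^ (-(1 / 16) : ℝ) * (A + B) ^ (-(1 / 2) : ℝ) := by
    have h1 : (A + B) ^ (-(1 / 16) : ℝ) ≤ g ^ (-(1 / 16) : ℝ) :=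
      Real.rpow_le_rpow_of_nonpos (by linarith) h (by norm_num)
    calc (A + B)⁻¹ = (A + B) ^ (-1 : ℝ) := (Real.rpow_neg_one _).symm
      _ ≤ (A + B) ^ (-(1 / 16) + -(1 / 2) : ℝ) :=
        Real.rpow_le_rpow_of_exponent_le (by linarith) (by norm_num)
      _ = (A + B) ^ (-(1 / 16) : ℝ) * (A + B) ^ (-(1 / 2) : ℝ) := Real.rpow_add hS0 _ _
      _ ≤ _ := by gcongr
  have hAe : (A + B) ^ (-(1 / 2) : ℝ) * A⁻¹ ≤ A ^ (-(3 / 2) : ℝ) := by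
    calc (A + B) ^ (-(1 / 2) : ℝ) * A⁻¹ ≤ A ^ (-(1 / 2) : ℝ) * A ^ (-1 : ℝ) := by
          rw [Real.rpow_neg_one]
          gcongr ?_ * _
          exact Real.rpow_le_rpow_of_nonpos hA0 (by linarith) (by norm_num)
      _ = _ := by rw [← Real.rpow_add hA0]; norm_num
  have hBe : (A + B) ^ (-(1 / 2) : ℝ) * B⁻¹ ≤ B ^ (-(3 / 2) : ℝ) := by
    calc (A + B) ^ (-(1 / 2) : ℝ) * B⁻¹ ≤ B ^ (-(1 / 2) : ℝ) * B ^ (-1 : ℝ) := by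
          rw [Real.rpow_neg_one]
          gcongr ?_ * _
          exact Real.rpow_le_rpow_of_nonpos hB0 (by linarith) (by norm_num)
      _ = _ := by rw [← Real.rpow_add hB0]; norm_num
  rw [e]
  calc (A + B)⁻¹ * (A⁻¹ + B⁻¹)
      ≤ (g ^ (-(1 / 16) : ℝ) * (A + B) ^ (-(1 / 2) : ℝ)) * (A⁻¹ + B⁻¹) := by gcongr
    _ = g ^ (-(1 / 16) : ℝ) * ((A + B) ^ (-(1 / 2) : ℝ) * A⁻¹ + (A + B) ^ (-(1 / 2) : ℝ) *
        B⁻¹) := by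
      ring
    _ ≤ _ := by gcongr

/-- The error made when the truncated weight is replaced by its Poisson average. -/
def kernelError (c x T : ℝ) : ℝ :=
  ∫ y, stripKernel c (y - x) * (truncWeight T y - truncWeight T x)

lemma abs_kernelError_le {c C x T : ℝ} (hc : 1 ≤ c) (hC : c ≤ C) :
    |kernelError c x T| ≤ (8 * C * ∫ u, decay u) *
      ((1 + |x|) ^ (-(17 / 16) : ℝ) +
        (1 + |x|)⁻¹ * (1 + abs (T - |x|)) ^ (-(1 / 2) : ℝ)) := by
  set g := 1 + |x| with hg
  have hg1 : 1 ≤ g := by simp [hg]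
  have hg0 : 0 < g := by linarith
  set d := abs (T - |x|) with hd
  have hd0 : 0 ≤ d := abs_nonneg _
  have hC0 : 0 < C := by linarith
  have hD1 : Integrable (fun y => decay (y - x)) := integrable_decay.comp_sub_right x
  have hI1 : ∫ y, decay (y - x) = ∫ u, decay u := integral_sub_right_eq_self decay x
  have hpt : ∀ y, ‖stripKernel c (y - x) * (truncWeight T y - truncWeight T x)‖ ≤
      (4 * C * g ^ (-(17 / 16) : ℝ)) * (decay (y - x) + decay y) +
      (4 * C * (g⁻¹ * (1 + d) ^ (-(1 / 2) : ℝ))) * decay (y - x) := by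
    intro y
    set u := y - x with hu
    have hK := stripKernel_le_abs (u := u) hc hC
    have hK0 := stripKernel_nonneg (by linarith : 0 ≤ c) u
    rw [Real.norm_eq_abs, abs_mul, abs_of_nonneg hK0]
    have hw := abs_truncWeight_sub_le T x y
    refine (mul_le_mul_of_nonneg_left hw hK0).trans ?_
    rw [mul_add]
    refine add_le_add ?_ ?_
    · have h1 := inv_mul_le_decay (u := u) (y := y) hg1 (by
        have : |x| ≤ |u| + |y| := by
          have := abs_sub y u
          rw [show y - u = x by rw [hu]; ring] at this
          linarith
        linarith)
      have e17 : g ^ (-(17 / 16) : ℝ) = g⁻¹ * g ^ (-(1 / 16) : ℝ) := by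
        rw [← Real.rpow_neg_one, ← Real.rpow_add hg0]; norm_num
      calc stripKernel c u * (2 * |u| / ((1 + |y|) * g))
          ≤ (2 * C / (1 + |u|) ^ 2) * (2 * (1 + |u|) / ((1 + |y|) * g)) := by
            gcongr; linarith
        _ = 4 * C * g⁻¹ * (1 / ((1 + |u|) * (1 + |y|))) := by
            field_simp; ring
        _ ≤ 4 * C * g⁻¹ * (g ^ (-(1 / 16) : ℝ) * (decay u + decay y)) := by gcongr
        _ = _ := by rw [e17]; ring
    · split_ifs with h
      · have h2 : 1 / (1 + |u|) ^ 2 ≤ (1 + d) ^ (-(1 / 2) : ℝ) * decay u := by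
          have : 1 / (1 + |u|) ^ 2 = (1 + |u|) ^ (-(1 / 2) : ℝ) * decay u := by
            unfold decay
            rw [← Real.rpow_add (by positivity), one_div, ← Real.rpow_natCast,
              ← Real.rpow_neg (by positivity)]
            norm_num
          rw [this]
          refine mul_le_mul_of_nonneg_right ?_ (decay_nonneg u)
          exact Real.rpow_le_rpow_of_nonpos (by positivity) (by linarith) (by norm_num)
        calc stripKernel c u * (2 / g) ≤ (2 * C / (1 + |u|) ^ 2) * (2 / g) := by gcongr
          _ = 4 * C * g⁻¹ * (1 / (1 + |u|) ^ 2) := by field_simp; ring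
          _ ≤ 4 * C * g⁻¹ * ((1 + d) ^ (-(1 / 2) : ℝ) * decay u) := by gcongr
          _ = _ := by ring
      · rw [mul_zero]
        have := decay_nonneg u
        positivity
  have hS : Integrable (fun y => decay (y - x) + decay y) := hD1.add integrable_decay
  refine (norm_integral_le_of_norm_le ((hS.const_mul _).add (hD1.const_mul _))
    (ae_of_all _ hpt)).trans ?_
  rw [integral_add' (hS.const_mul _) (hD1.const_mul _), integral_const_mul, integral_const_mul,
    integral_add hD1 integrable_decay, hI1]
  have hI0 : 0 ≤ ∫ u, decay u := integral_nonneg decay_nonneg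
  have : 0 ≤ 4 * C * (g⁻¹ * (1 + d) ^ (-(1 / 2) : ℝ)) * ∫ u, decay u := by positivity
  linarith

lemma abs_kernelError_le_of_far {c C x T : ℝ} (hc : 1 ≤ c) (hC : c ≤ C) (hT : 1 ≤ T)
    (hd : T ^ (1 / 8 : ℝ) < abs (T - |x|)) :
    |kernelError c x T| ≤ (24 * C * ∫ u, decay u) * (1 + |x|) ^ (-(17 / 16) : ℝ) := by
  refine (abs_kernelError_le hc hC).trans ?_
  have hI0 : 0 ≤ ∫ u, decay u := integral_nonneg decay_nonneg
  set g := 1 + |x| with hg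
  have hg1 : 1 ≤ g := by simp [hg]
  have hg0 : 0 < g := by linarith
  set d := abs (T - |x|) with hd'
  have hd0 : 0 ≤ d := abs_nonneg _
  have h1 : g ^ (1 / 8 : ℝ) / 4 ≤ 1 + d := by
    by_cases hx : |x| ≤ 2 * T
    · have : g ^ (1 / 8 : ℝ) ≤ 4 * T ^ (1 / 8 : ℝ) := by
        calc g ^ (1 / 8 : ℝ) ≤ (4 * T) ^ (1 / 8 : ℝ) :=
              Real.rpow_le_rpow hg0.le (by linarith) (by norm_num)
          _ = 4 ^ (1 / 8 : ℝ) * T ^ (1 / 8 : ℝ) := Real.mul_rpow (by norm_num) (by linarith)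
          _ ≤ 4 ^ (1 : ℝ) * T ^ (1 / 8 : ℝ) := by
              gcongr ?_ * _
              exact Real.rpow_le_rpow_of_exponent_le (by norm_num) (by norm_num)
          _ = _ := by rw [Real.rpow_one]
      linarith
    · have : g ^ (1 / 8 : ℝ) ≤ g := by
        calc g ^ (1 / 8 : ℝ) ≤ g ^ (1 : ℝ) :=
              Real.rpow_le_rpow_of_exponent_le hg1 (by norm_num)
          _ = g := Real.rpow_one g
      have : |x| - T ≤ d := by rw [hd']; linarith [neg_abs_le (T - |x|)]
      linarith
  have h2 : (1 + d) ^ (-(1 / 2) : ℝ) ≤ 2 * g ^ (-(1 / 16) : ℝ) := by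
    calc (1 + d) ^ (-(1 / 2) : ℝ) ≤ (g ^ (1 / 8 : ℝ) / 4) ^ (-(1 / 2) : ℝ) :=
          Real.rpow_le_rpow_of_nonpos (by positivity) h1 (by norm_num)
      _ = g ^ (-(1 / 16) : ℝ) / 4 ^ (-(1 / 2) : ℝ) := by
          rw [Real.div_rpow (by positivity) (by norm_num), ← Real.rpow_mul hg0.le]
          norm_num
      _ = _ := by
          rw [show (4 : ℝ) = 2 ^ (2 : ℝ) by norm_num, ← Real.rpow_mul (by norm_num)]
          norm_num [Real.rpow_neg_one]
          ring
  have h3 : g⁻¹ * (1 + d) ^ (-(1 / 2) : ℝ) ≤ 2 * g ^ (-(17 / 16) : ℝ) := by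
    have e17 : g ^ (-(17 / 16) : ℝ) = g⁻¹ * g ^ (-(1 / 16) : ℝ) := by
      rw [← Real.rpow_neg_one, ← Real.rpow_add hg0]; norm_num
    rw [e17]
    calc _ ≤ g⁻¹ * (2 * g ^ (-(1 / 16) : ℝ)) := by gcongr
      _ = _ := by ring
  have hC0 : 0 < C := by linarith
  calc _ ≤ (8 * C * ∫ u, decay u) * (g ^ (-(17 / 16) : ℝ) + 2 * g ^ (-(17 / 16) : ℝ)) := by
        gcongr
    _ = _ := by ring

lemma abs_kernelError_le_of_near {c C x T : ℝ} (hc : 1 ≤ c) (hC : c ≤ C) (hT : 4 ≤ T)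
    (hd : abs (T - |x|) ≤ T ^ (1 / 8 : ℝ)) :
    |kernelError c x T| ≤ (64 * C ^ 3 * ∫ u, decay u) * T ^ (-(3 / 4) : ℝ) *
      (stripKernel c (T - x) + stripKernel c (-T - x)) := by
  refine (abs_kernelError_le hc hC).trans ?_
  have hI0 : 0 ≤ ∫ u, decay u := integral_nonneg decay_nonneg
  have hC0 : 0 < C := by linarith
  set g := 1 + |x| with hg
  have hg1 : 1 ≤ g := by simp [hg]
  have hg0 : 0 < g := by linarith
  set d := abs (T - |x|) with hd'
  have hd0 : 0 ≤ d := abs_nonneg _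
  have hT0 : 0 < T := by linarith
  have hT8 : T ^ (1 / 8 : ℝ) ≤ T / 2 := by
    have h : T ^ (1 / 8 : ℝ) ≤ T ^ (1 / 2 : ℝ) :=
      Real.rpow_le_rpow_of_exponent_le (by linarith) (by norm_num)
    rw [← Real.sqrt_eq_rpow] at h
    have h2 : Real.sqrt T * Real.sqrt T = T := Real.mul_self_sqrt hT0.le
    have h3 : 2 ≤ Real.sqrt T := Real.le_sqrt_of_sq_le (by linarith)
    nlinarith
  have hgT : g⁻¹ ≤ 2 / T := by
    rw [inv_eq_one_div, div_le_div_iff₀ hg0 hT0]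
    have : T - |x| ≤ d := le_abs_self _
    linarith
  have h1 : g ^ (-(17 / 16) : ℝ) ≤ 2 / T := by
    refine le_trans ?_ hgT
    rw [← Real.rpow_neg_one]
    exact Real.rpow_le_rpow_of_exponent_le hg1 (by norm_num)
  have h2 : g⁻¹ * (1 + d) ^ (-(1 / 2) : ℝ) ≤ 2 / T := by
    refine le_trans ?_ hgT
    refine mul_le_of_le_one_right (by positivity) ?_
    exact Real.rpow_le_one_of_one_le_of_nonpos (by linarith) (by norm_num)
  have h3 : 1 ≤ 2 * T ^ (1 / 4 : ℝ) * (1 / (1 + d ^ 2)) := by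
    rw [mul_one_div, le_div_iff₀ (by positivity), one_mul]
    have e : T ^ (1 / 4 : ℝ) = (T ^ (1 / 8 : ℝ)) ^ 2 := by
      rw [← Real.rpow_natCast, ← Real.rpow_mul hT0.le]; norm_num
    have h4 : 1 ≤ T ^ (1 / 8 : ℝ) := Real.one_le_rpow (by linarith) (by norm_num)
    rw [e]
    nlinarith
  have h4 : 1 / (1 + d ^ 2) ≤ C ^ 2 * (stripKernel c (T - x) + stripKernel c (-T - x)) := by
    have hK1 := stripKernel_nonneg (by linarith : 0 ≤ c) (T - x)
    have hK2 := stripKernel_nonneg (by linarith : 0 ≤ c) (-T - x)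
    have hL1 := le_stripKernel (u := T - x) hc hC
    have hL2 := le_stripKernel (u := -T - x) hc hC
    have aux : ∀ v : ℝ, 1 / (1 + v) = C ^ 2 * (1 / (C ^ 2 * (1 + v))) := fun v => by
      by_cases hv : 1 + v = 0
      · simp [hv]
      · field_simp
    rw [aux]
    have hd2 : d ^ 2 = (T - |x|) ^ 2 := sq_abs _
    gcongr
    rcases abs_cases x with ⟨h, -⟩ | ⟨h, -⟩
    · rw [hd2, h]; linarith
    · rw [hd2, h, show (T - -x) ^ 2 = (-T - x) ^ 2 by ring]; linarith
  have eT : 2 / T * (2 * T ^ (1 / 4 : ℝ)) = 4 * T ^ (-(3 / 4) : ℝ) := by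
    rw [show (-(3 / 4) : ℝ) = 1 / 4 - 1 by norm_num, Real.rpow_sub hT0, Real.rpow_one]
    field_simp; ring
  calc (8 * C * ∫ u, decay u) * (g ^ (-(17 / 16) : ℝ) + g⁻¹ * (1 + d) ^ (-(1 / 2) : ℝ))
      ≤ (8 * C * ∫ u, decay u) * (2 / T + 2 / T) := by gcongr
    _ = (16 * C * ∫ u, decay u) * (2 / T / 2 * 2 * 1) := by ring
    _ ≤ (16 * C * ∫ u, decay u) * (2 / T / 2 * 2 * (2 * T ^ (1 / 4 : ℝ) * (1 / (1 + d ^ 2)))) := by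
        gcongr
    _ = (16 * C * ∫ u, decay u) * ((2 / T * (2 * T ^ (1 / 4 : ℝ))) * (1 / (1 + d ^ 2))) := by ring
    _ ≤ (16 * C * ∫ u, decay u) * ((2 / T * (2 * T ^ (1 / 4 : ℝ))) *
        (C ^ 2 * (stripKernel c (T - x) + stripKernel c (-T - x)))) := by gcongr
    _ = _ := by rw [eT]; ring

lemma integral_stripKernel_mul_oddWeight {c x T : ℝ} (hc : 1 ≤ c) (hT : 0 ≤ T) :
    ∫ y in (-T)..T, stripKernel c (y - x) * oddWeight y =
      Real.pi * truncWeight T x + kernelError c x T := by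
  have hK : Integrable (fun y => stripKernel c (y - x)) :=
      (integrable_stripKernel hc).comp_sub_right x
  have hKT : Integrable (fun y => stripKernel c (y - x) * truncWeight T y) := by
    refine (hK.mul_const 2).mono' (hK.aestronglyMeasurable.mul
      (measurable_truncWeight T).aestronglyMeasurable) (ae_of_all _ fun y => ?_)
    rw [norm_mul, Real.norm_of_nonneg (stripKernel_nonneg (by linarith) _)]
    refine mul_le_mul_of_nonneg_left ?_ (stripKernel_nonneg (by linarith) _)
    unfold truncWeight
    split_ifs
    · refine (abs_oddWeight_le y).trans ?_
      rw [div_le_iff₀ (by positivity)]; linarith [abs_nonneg y]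
    · simp
  have e1 : ∫ y in (-T)..T, stripKernel c (y - x) * oddWeight y =
      ∫ y, stripKernel c (y - x) * truncWeight T y := by
    rw [intervalIntegral.integral_of_le (by linarith), ← integral_Icc_eq_integral_Ioc,
      ← integral_indicator measurableSet_Icc]
    congr 1
    ext y
    unfold truncWeight
    by_cases h : |y| ≤ T
    · rw [Set.indicator_of_mem (Set.mem_Icc.2 (abs_le.1 h)), if_pos h]
    · rw [Set.indicator_of_notMem (fun h' => h (abs_le.2 (Set.mem_Icc.1 h'))), if_neg h, mul_zero]
  have e2 : ∫ y, stripKernel c (y - x) = Real.pi := by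
    rw [integral_sub_right_eq_self (stripKernel c) x, integral_stripKernel hc]
  unfold kernelError
  simp_rw [mul_sub]
  rw [integral_sub hKT (hK.mul_const _), integral_mul_const, e2, e1]
  ring

lemma integral_oddWeight_symm (T : ℝ) : ∫ y in (-T)..T, oddWeight y = 0 := by
  have h := intervalIntegral.integral_comp_neg (a := -T) (b := T) oddWeight
  have h2 : ∀ y, oddWeight (-y) = -oddWeight y := fun y => by simp [oddWeight, neg_div]
  simp only [h2, neg_neg, intervalIntegral.integral_neg] at h
  linarith

lemma integrable_stripKernel_mul_oddWeight {c : ℝ} (hc : 1 ≤ c) (x : ℝ) :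
    Integrable fun y => stripKernel c (y - x) * oddWeight y := by
  refine (((integrable_stripKernel hc).comp_sub_right x).mul_const 2).mono'
    (((continuous_stripKernel hc).comp (by fun_prop)).mul
      continuous_oddWeight).aestronglyMeasurable (ae_of_all _ fun y => ?_)
  rw [norm_mul, Real.norm_of_nonneg (stripKernel_nonneg (by linarith) _)]
  refine mul_le_mul_of_nonneg_left ((abs_oddWeight_le y).trans ?_) (stripKernel_nonneg
      (by linarith) _)
  rw [div_le_iff₀ (by positivity)]
  nlinarith [abs_nonneg y]

lemma truncWeight_eventuallyEq (x : ℝ) : ∀ᶠ T in atTop, truncWeight T x = oddWeight x := by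
  filter_upwards [eventually_ge_atTop |x|] with T hT
  simp [truncWeight, hT]

lemma tendsto_kernelError {c : ℝ} (hc : 1 ≤ c) (x : ℝ) :
    Tendsto (kernelError c x) atTop
      (nhds ((∫ y, stripKernel c (y - x) * oddWeight y) - Real.pi * oddWeight x)) := by
  have h1 := intervalIntegral_tendsto_integral (integrable_stripKernel_mul_oddWeight hc x)
    tendsto_neg_atTop_atBot tendsto_id
  refine (h1.sub_const (Real.pi * oddWeight x)).congr' ?_
  filter_upwards [truncWeight_eventuallyEq x, eventually_ge_atTop 0] with T hT hT0
  simp only [id]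
  rw [integral_stripKernel_mul_oddWeight hc hT0, hT]
  ring

lemma eventually_rpow_lt_abs_sub (x : ℝ) :
    ∀ᶠ T in atTop, T ^ (1 / 8 : ℝ) < abs (T - |x|) := by
  filter_upwards [eventually_gt_atTop (2 * |x|), eventually_ge_atTop 4] with T hT h4
  have h1 : T ^ (1 / 8 : ℝ) ≤ T ^ (1 / 2 : ℝ) :=
    Real.rpow_le_rpow_of_exponent_le (by linarith) (by norm_num)
  have h2 : T ^ (1 / 2 : ℝ) ≤ T / 2 := by
    rw [← Real.sqrt_eq_rpow, Real.sqrt_le_left (by linarith)]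
    nlinarith
  rw [abs_of_nonneg (by linarith)]
  linarith

lemma stripKernel_le_rpow {c C : ℝ} (hc : 1 ≤ c) (hC : c ≤ C) (u : ℝ) :
    stripKernel c u ≤ 2 * C * (1 + |u|) ^ (-(17 / 16) : ℝ) := by
  refine (stripKernel_le_decay hc hC u).trans (mul_le_mul_of_nonneg_left ?_ (by linarith))
  unfold decay
  exact Real.rpow_le_rpow_of_exponent_le (by linarith [abs_nonneg u]) (by norm_num)

lemma hasSum_stripKernel {ι : Type*} {m c γ : ι → ℝ} {C : ℝ} (hm : ∀ i, 0 ≤ m i)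
    (hc : ∀ i, 1 ≤ c i) (hC : ∀ i, c i ≤ C)
    (hs : Summable fun i => m i * (1 + |γ i|) ^ (-(17 / 16) : ℝ)) {R : ℝ → ℝ}
    (hR : ∀ y, HasSum (fun i => m i * (stripKernel (c i) (y - γ i) - stripKernel (c i) (γ i)))
      (R y - R 0)) :
    ∃ P : ℝ, ∀ y, HasSum (fun i => m i * stripKernel (c i) (y - γ i)) (R y + P) := by
  have h0 : Summable fun i => m i * stripKernel (c i) (γ i) := by
    refine Summable.of_nonneg_of_le
      (fun i => mul_nonneg (hm i) (stripKernel_nonneg (by linarith [hc i]) _)) (fun i => ?_)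
      (hs.mul_left (2 * C))
    calc _ ≤ m i * (2 * C * (1 + |γ i|) ^ (-(17 / 16) : ℝ)) :=
          mul_le_mul_of_nonneg_left (stripKernel_le_rpow (hc i) (hC i) _) (hm i)
      _ = _ := by ring
  refine ⟨(∑' i, m i * stripKernel (c i) (γ i)) - R 0, fun y => ?_⟩
  have := (hR y).add h0.hasSum
  convert this using 1
  · funext i; ring
  · ring

/-- A Tauberian transfer: convergence of the integral of a Poisson-type sum against the odd weight
yields convergence of the symmetric sums of the weight over the sequence `γ`. -/
theorem exists_tendsto_tsum_truncWeight {ι : Type*} [Countable ι] {m c γ : ι → ℝ} {C B : ℝ}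
    (hm : ∀ i, 0 ≤ m i) (hc : ∀ i, 1 ≤ c i) (hC : ∀ i, c i ≤ C)
    (hs : Summable fun i => m i * (1 + |γ i|) ^ (-(17 / 16) : ℝ)) {R : ℝ → ℝ}
    (hRc : Continuous R)
    (hR : ∀ y, HasSum (fun i => m i * (stripKernel (c i) (y - γ i) - stripKernel (c i) (γ i)))
      (R y - R 0))
    (hB : ∀ y, |R y| ≤ B * (1 + |y|) ^ (1 / 2 : ℝ))
    (hJ : ∃ L, Tendsto (fun T => ∫ y in (-T)..T, R y * oddWeight y) atTop (nhds L)) :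
    ∃ L, Tendsto (fun T => ∑' i, m i * truncWeight T (γ i)) atTop (nhds L) := by
  obtain ⟨J, hJ⟩ := hJ
  obtain ⟨P, hP⟩ := hasSum_stripKernel hm hc hC hs hR
  have hK : ∀ i u, 0 ≤ stripKernel (c i) u := fun i u => stripKernel_nonneg (by linarith [hc i]) _
  set D := ∫ u, decay u with hD
  have hD0 : 0 ≤ D := integral_nonneg decay_nonneg
  have hInt : ∀ T : ℝ, 0 ≤ T → HasSum (fun i => m i * (Real.pi * truncWeight T (γ i) +
      kernelError (c i) (γ i) T)) (∫ y in (-T)..T, R y * oddWeight y) := by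
    intro T hT
    have h1 : HasSum (fun i => ∫ y in (-T)..T, m i * stripKernel (c i) (y - γ i) * oddWeight y)
        (∫ y in (-T)..T, (R y + P) * oddWeight y) := by
      refine intervalIntegral.hasSum_integral_of_dominated_convergence
        (fun i y => m i * stripKernel (c i) (y - γ i) * 2) (fun i => ?_) (fun i => ?_) ?_ ?_ ?_
      · exact ((continuous_const.mul ((continuous_stripKernel (hc i)).comp
          (by fun_prop : Continuous fun y => y - γ i))).mul
              continuous_oddWeight).aestronglyMeasurable
      · refine ae_of_all _ fun y _ => ?_
        rw [norm_mul, Real.norm_of_nonneg (mul_nonneg (hm i) (hK i _))]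
        refine mul_le_mul_of_nonneg_left ((abs_oddWeight_le y).trans ?_) (mul_nonneg (hm i)
            (hK i _))
        rw [div_le_iff₀ (by positivity)]
        nlinarith [abs_nonneg y]
      · exact ae_of_all _ fun y _ => ((hP y).mul_right 2).summable
      · have : (fun y => ∑' i, m i * stripKernel (c i) (y - γ i) * 2) = fun y => (R y + P) * 2 :=
          funext fun y => ((hP y).mul_right 2).tsum_eq
        rw [this]
        exact Continuous.intervalIntegrable (by fun_prop) _ _
      · exact ae_of_all _ fun y _ => (hP y).mul_right _
    convert h1 using 1
    · funext i
      rw [← integral_stripKernel_mul_oddWeight (hc i) hT, ← intervalIntegral.integral_const_mul]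
      congr 1; funext y; ring
    · have e : ∀ y, (R y + P) * oddWeight y = R y * oddWeight y + P * oddWeight y :=
          fun y => by ring
      have i1 : IntervalIntegrable (fun y => R y * oddWeight y) volume (-T) T :=
        (hRc.mul continuous_oddWeight).intervalIntegrable _ _
      have i2 : IntervalIntegrable (fun y => P * oddWeight y) volume (-T) T :=
        (continuous_const.mul continuous_oddWeight).intervalIntegrable _ _
      simp only [e]
      rw [intervalIntegral.integral_add i1 i2,
        intervalIntegral.integral_const_mul, integral_oddWeight_symm]
      ring
  set far : ℝ → ι → ℝ := fun T i => if T ^ (1 / 8 : ℝ) < abs (T - |γ i|) then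
    m i * kernelError (c i) (γ i) T else 0 with hfar
  set near : ℝ → ι → ℝ := fun T i => if T ^ (1 / 8 : ℝ) < abs (T - |γ i|) then 0 else
    m i * kernelError (c i) (γ i) T with hnear
  have hfn : ∀ T i, m i * kernelError (c i) (γ i) T = far T i + near T i := fun T i => by
    simp only [hfar, hnear]; split_ifs <;> simp
  have hfarb : ∀ T, 1 ≤ T → ∀ i, ‖far T i‖ ≤
      24 * C * D * (m i * (1 + |γ i|) ^ (-(17 / 16) : ℝ)) := by
    intro T hT i
    have hC0 : 0 ≤ C := by linarith [hc i, hC i]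
    simp only [hfar]
    split_ifs with h
    · rw [norm_mul, Real.norm_of_nonneg (hm i)]
      calc _ ≤ m i * (24 * C * D * (1 + |γ i|) ^ (-(17 / 16) : ℝ)) :=
            mul_le_mul_of_nonneg_left (abs_kernelError_le_of_far (hc i) (hC i) hT h) (hm i)
        _ = _ := by ring
    · rw [norm_zero]
      have := hm i
      positivity
  have hfars : ∀ T, 1 ≤ T → Summable (far T) := fun T hT =>
    Summable.of_norm_bounded (hs.mul_left _) (hfarb T hT)
  have hnearb : ∀ T, 4 ≤ T → ∀ i, ‖near T i‖ ≤ 64 * C ^ 3 * D * T ^ (-(3 / 4) : ℝ) *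
      (m i * stripKernel (c i) (T - γ i) + m i * stripKernel (c i) (-T - γ i)) := by
    intro T hT i
    have hC0 : 0 ≤ C := by linarith [hc i, hC i]
    simp only [hnear]
    split_ifs with h
    · rw [norm_zero]
      have := hm i
      have := hK i (T - γ i)
      have := hK i (-T - γ i)
      positivity
    · rw [norm_mul, Real.norm_of_nonneg (hm i)]
      calc _ ≤ m i * (64 * C ^ 3 * D * T ^ (-(3 / 4) : ℝ) *
            (stripKernel (c i) (T - γ i) + stripKernel (c i) (-T - γ i))) :=
            mul_le_mul_of_nonneg_left
              (abs_kernelError_le_of_near (hc i) (hC i) hT (not_lt.1 h)) (hm i)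
        _ = _ := by ring
  have hnearS : ∀ T, HasSum (fun i => 64 * C ^ 3 * D * T ^ (-(3 / 4) : ℝ) *
      (m i * stripKernel (c i) (T - γ i) + m i * stripKernel (c i) (-T - γ i)))
      (64 * C ^ 3 * D * T ^ (-(3 / 4) : ℝ) * ((R T + P) + (R (-T) + P))) := fun T =>
    ((hP T).add (hP (-T))).mul_left _
  have hnears : ∀ T, 4 ≤ T → Summable (near T) := fun T hT =>
    Summable.of_norm_bounded (hnearS T).summable (hnearb T hT)
  have hnear0 : Tendsto (fun T => ∑' i, near T i) atTop (nhds 0) := by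
    rcases isEmpty_or_nonempty ι with hι | ⟨⟨i0⟩⟩
    · simp
    have hC0 : 0 ≤ C := by linarith [hc i0, hC i0]
    have hlim : Tendsto (fun T : ℝ => 64 * C ^ 3 * D * (2 * |B| + 2 * |P|) * 2 *
        T ^ (-(1 / 4) : ℝ)) atTop (nhds 0) := by
      simpa using (tendsto_rpow_neg_atTop (by norm_num : (0 : ℝ) < 1 / 4)).const_mul
        (64 * C ^ 3 * D * (2 * |B| + 2 * |P|) * 2)
    refine squeeze_zero_norm' ?_ hlim
    filter_upwards [eventually_ge_atTop 4] with T hT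
    refine (tsum_of_norm_bounded (hnearS T) (hnearb T hT)).trans ?_
    have hT0 : 0 < T := by linarith
    have hp : (1 + T) ^ (1 / 2 : ℝ) ≤ 2 * T ^ (1 / 2 : ℝ) := by
      rw [← Real.sqrt_eq_rpow, ← Real.sqrt_eq_rpow, Real.sqrt_le_left (by positivity), mul_pow,
        Real.sq_sqrt hT0.le]
      linarith
    have h1 := hB T
    have h2 := hB (-T)
    rw [abs_neg] at h2
    rw [abs_of_pos hT0] at h1 h2
    have hge : 1 ≤ (1 + T) ^ (1 / 2 : ℝ) := Real.one_le_rpow (by linarith) (by norm_num)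
    have h3 : R T + P + (R (-T) + P) ≤ (2 * |B| + 2 * |P|) * (1 + T) ^ (1 / 2 : ℝ) := by
      have a1 := le_abs_self (R T)
      have a2 := le_abs_self (R (-T))
      have a3 := mul_le_mul_of_nonneg_right (le_abs_self B) (by linarith : 0 ≤ (1 + T) ^
          (1 / 2 : ℝ))
      have a4 := mul_le_mul_of_nonneg_left hge (abs_nonneg P)
      nlinarith [le_abs_self P]
    have h4 : T ^ (-(3 / 4) : ℝ) * T ^ (1 / 2 : ℝ) = T ^ (-(1 / 4) : ℝ) := by
      rw [← Real.rpow_add hT0]; norm_num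
    calc _ ≤ 64 * C ^ 3 * D * T ^ (-(3 / 4) : ℝ) * ((2 * |B| + 2 * |P|) * (2 * T ^
        (1 / 2 : ℝ))) := by
          refine mul_le_mul_of_nonneg_left (h3.trans ?_) (by positivity)
          exact mul_le_mul_of_nonneg_left hp (by positivity)
      _ = _ := by rw [← h4]; ring
  have hfarlim := tendsto_tsum_of_dominated_convergence (f := far) (𝓕 := atTop)
    (g := fun i => m i * ((∫ y, stripKernel (c i) (y - γ i) * oddWeight y) -
      Real.pi * oddWeight (γ i))) (hs.mul_left (24 * C * D)) (fun i => by
        refine ((tendsto_kernelError (hc i) (γ i)).const_mul (m i)).congr' ?_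
        filter_upwards [eventually_rpow_lt_abs_sub (γ i)] with T hT
        simp only [hfar, hT, if_true])
      ((eventually_ge_atTop 1).mono hfarb)
  refine ⟨_, (((hJ.sub hfarlim).sub hnear0).const_mul Real.pi⁻¹).congr' ?_⟩
  filter_upwards [eventually_ge_atTop 4] with T hT
  have h := (((hInt T (by linarith)).sub (hfars T (by linarith)).hasSum).sub
    (hnears T hT).hasSum).mul_left Real.pi⁻¹
  rw [← h.tsum_eq]
  congr 1; funext i
  rw [mul_add, hfn]
  field_simp
  ring

lemma hasDerivAt_oddWeight (y : ℝ) :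
    HasDerivAt oddWeight ((1 - y ^ 2) / (1 + y ^ 2) ^ 2) y := by
  have h : 1 + y ^ 2 ≠ 0 := by positivity
  have hd : HasDerivAt (fun y : ℝ => 1 + y ^ 2) (2 * y) y := by
    simpa using (hasDerivAt_pow 2 y).const_add 1
  refine HasDerivAt.congr_deriv ((hasDerivAt_id' y).fun_div hd h) ?_
  ring

lemma integral_symm_mul_oddWeight {R : ℝ → ℝ} (hR : Continuous R) (T : ℝ) :
    ∫ y in (-T)..T, R y * oddWeight y = ∫ y in (0)..T, (R y - R (-y)) * oddWeight y := by
  have hw := continuous_oddWeight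
  have i1 : ∀ a b, IntervalIntegrable (fun y => R y * oddWeight y) volume a b :=
    fun a b => (hR.mul hw).intervalIntegrable _ _
  have i2 : IntervalIntegrable (fun y => R (-y) * oddWeight y) volume 0 T :=
    ((hR.comp continuous_neg).mul hw).intervalIntegrable _ _
  have h := intervalIntegral.integral_comp_neg (a := 0) (b := T) fun y => R y * oddWeight y
  have h2 : ∀ y, oddWeight (-y) = -oddWeight y := fun y => by simp [oddWeight, neg_div]
  simp only [h2, mul_neg, neg_zero, intervalIntegral.integral_neg] at h
  simp only [sub_mul]
  rw [intervalIntegral.integral_sub (i1 _ _) i2,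
    ← intervalIntegral.integral_add_adjacent_intervals (i1 (-T) 0) (i1 0 T)]
  linarith

lemma exists_tendsto_integral_mul_oddWeight {R : ℝ → ℝ} (hR : Continuous R) {C : ℝ}
    (hV : ∀ y, 0 ≤ y → |∫ t in (0)..y, (R t - R (-t))| ≤ C * (1 + y) ^ (1 / 2 : ℝ)) :
    ∃ L, Tendsto (fun T => ∫ y in (-T)..T, R y * oddWeight y) atTop (nhds L) := by
  have hC : 0 ≤ C := by simpa using hV 0 le_rfl
  set W : ℝ → ℝ := fun t => R t - R (-t) with hW
  have hWc : Continuous W := by fun_prop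
  set V : ℝ → ℝ := fun y => ∫ t in (0)..y, W t with hVd
  have hVder : ∀ y, HasDerivAt V (W y) y := fun y =>
    intervalIntegral.integral_hasDerivAt_right (hWc.intervalIntegrable _ _)
      (hWc.stronglyMeasurableAtFilter _ _) hWc.continuousAt
  have hVc : Continuous V := continuous_iff_continuousAt.2 fun y => (hVder y).continuousAt
  have hwc : Continuous fun y : ℝ => (1 - y ^ 2) / (1 + y ^ 2) ^ 2 :=
    (by fun_prop : Continuous fun y : ℝ => 1 - y ^ 2).div (by fun_prop) fun y => by positivity
  have hInt : IntegrableOn (fun y => V y * ((1 - y ^ 2) / (1 + y ^ 2) ^ 2)) (Set.Ioi 0) := by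
    refine Integrable.mono' (integrable_decay.const_mul (2 * C)).integrableOn
      (hVc.mul hwc).aestronglyMeasurable ?_
    refine (ae_restrict_iff' measurableSet_Ioi).2 (ae_of_all _ fun y hy => ?_)
    have hy : 0 < y := hy
    have h1 : |(1 - y ^ 2) / (1 + y ^ 2) ^ 2| ≤ 2 * (1 + y) ^ (-2 : ℝ) := by
      rw [Real.rpow_neg (by positivity), abs_div, abs_of_pos (by positivity : 0 < (1 + y ^ 2) ^ 2),
        div_le_iff₀ (by positivity), Real.rpow_two]
      have : |1 - y ^ 2| ≤ 1 + y ^ 2 := abs_le.2 ⟨by nlinarith, by nlinarith⟩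
      refine this.trans ?_
      rw [mul_assoc, ← div_eq_inv_mul, ← mul_div_assoc, le_div_iff₀ (by positivity)]
      nlinarith [mul_nonneg (sq_nonneg (1 - y)) (by positivity : 0 ≤ 1 + y ^ 2)]
    rw [norm_mul]
    calc _ ≤ (C * (1 + y) ^ (1 / 2 : ℝ)) * (2 * (1 + y) ^ (-2 : ℝ)) :=
          mul_le_mul (hV y hy.le) h1 (abs_nonneg _) (by positivity)
      _ = 2 * C * ((1 + y) ^ (1 / 2 : ℝ) * (1 + y) ^ (-2 : ℝ)) := by ring
      _ = _ := by
        rw [← Real.rpow_add (by positivity), decay, abs_of_pos hy]; norm_num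
  have hlim := intervalIntegral_tendsto_integral_Ioi 0 hInt tendsto_id
  have hb : Tendsto (fun T => V T * oddWeight T) atTop (nhds 0) := by
    have h1 : Tendsto (fun T : ℝ => 2 * C * (1 + T) ^ (-(1 / 2) : ℝ)) atTop (nhds 0) := by
      simpa using ((tendsto_rpow_neg_atTop (by norm_num : (0 : ℝ) < 1 / 2)).comp
        (tendsto_atTop_add_const_left atTop (1 : ℝ) tendsto_id)).const_mul (2 * C)
    refine squeeze_zero_norm' ?_ h1
    filter_upwards [eventually_ge_atTop 0] with T hT
    rw [norm_mul]
    have h2 := abs_oddWeight_le T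
    rw [abs_of_nonneg hT] at h2
    calc _ ≤ (C * (1 + T) ^ (1 / 2 : ℝ)) * (2 / (1 + T)) :=
          mul_le_mul (hV T hT) h2 (abs_nonneg _) (by positivity)
      _ = 2 * C * ((1 + T) ^ (1 / 2 : ℝ) * (1 + T) ^ (-1 : ℝ)) := by
        rw [Real.rpow_neg_one]; ring
      _ = _ := by rw [← Real.rpow_add (by positivity)]; norm_num
  refine ⟨_, (hb.sub hlim).congr fun T => ?_⟩
  rw [integral_symm_mul_oddWeight hR]
  have := intervalIntegral.integral_mul_deriv_eq_deriv_mul (a := 0) (b := T) (u := V) (v :=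
      oddWeight)
    (fun y _ => hVder y) (fun y _ => hasDerivAt_oddWeight y)
    (hWc.intervalIntegrable _ _) (hwc.intervalIntegrable _ _)
  have hV0 : V 0 = 0 := by simp [hVd]
  simp only [id, this, hV0]
  ring

lemma analyticOrderAt_ne_top_of_apply_ne_zero {f : ℂ → ℂ} (hf : Differentiable ℂ f) {w : ℂ}
    (h : f w ≠ 0) (z : ℂ) : analyticOrderAt f z ≠ ⊤ := fun ht => by
  have := (AnalyticOnNhd.analyticOrderAt_eq_top_iff_eq_zero z fun w => hf.analyticAt w).1 ht
  exact h (by simp [this])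

lemma cast_zeroOrder {f : ℂ → ℂ} (hf : Differentiable ℂ f) {w : ℂ} (h : f w ≠ 0) (z : ℂ) :
    (zeroOrder f z : ℕ∞) = analyticOrderAt f z := by
  obtain ⟨n, hn⟩ := ENat.ne_top_iff_exists.1 (analyticOrderAt_ne_top_of_apply_ne_zero hf h z)
  rw [← hn]
  obtain ⟨h1, h2⟩ := (analyticOrderAt_eq_nat_iff_iteratedDeriv_eq_zero (hf.analyticAt z)).1 hn.symm
  have : zeroOrder f z = n := by
    refine le_antisymm (Nat.sInf_le h2) (le_csInf ⟨n, h2⟩ fun k hk => ?_)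
    by_contra hlt
    exact hk (h1 k (not_le.1 hlt))
  rw [this]

lemma zeroOrder_pos {f : ℂ → ℂ} (hf : Differentiable ℂ f) {w z : ℂ} (h : f w ≠ 0)
    (hz : f z = 0) : 1 ≤ zeroOrder f z := by
  have h1 : analyticOrderAt f z ≠ 0 := (hf.analyticAt z).analyticOrderAt_ne_zero.2 hz
  rw [← cast_zeroOrder hf h z] at h1
  exact Nat.one_le_iff_ne_zero.2 (by exact_mod_cast h1)

lemma exists_eq_pow_mul {f : ℂ → ℂ} (hf : Differentiable ℂ f) {w : ℂ} (h : f w ≠ 0) (ρ : ℂ) :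
    ∃ g : ℂ → ℂ, Differentiable ℂ g ∧ g ρ ≠ 0 ∧ ∀ z, f z = (z - ρ) ^ zeroOrder f ρ * g z := by
  set n := zeroOrder f ρ
  obtain ⟨g, hg, hgρ, hfg⟩ := ((hf.analyticAt ρ).analyticOrderAt_eq_natCast (n := n)).1
    (cast_zeroOrder hf h ρ).symm
  classical
  set G : ℂ → ℂ := fun z => if z = ρ then g ρ else f z / (z - ρ) ^ n with hG
  have hGe : ∀ᶠ z in nhds ρ, G z = g z := by
    filter_upwards [hfg] with z hz
    simp only [hG]
    split_ifs with h1
    · rw [h1]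
    · rw [hz, smul_eq_mul, mul_div_cancel_left₀ _ (pow_ne_zero _ (sub_ne_zero.2 h1))]
  refine ⟨G, fun z => ?_, by simpa [hG] using hgρ, fun z => ?_⟩
  · by_cases h1 : z = ρ
    · subst h1
      exact hg.differentiableAt.congr_of_eventuallyEq hGe
    · have : G =ᶠ[nhds z] fun z => f z / (z - ρ) ^ n := by
        filter_upwards [isOpen_ne.mem_nhds h1] with y hy
        simp only [hG, if_neg hy]
      refine DifferentiableAt.congr_of_eventuallyEq ?_ this
      exact hf.differentiableAt.div (by fun_prop) (pow_ne_zero _ (sub_ne_zero.2 h1))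
  · by_cases h1 : z = ρ
    · subst h1
      have := hfg.self_of_nhds
      simpa [hG] using this
    · simp only [hG, if_neg h1]
      rw [mul_div_cancel₀ _ (pow_ne_zero _ (sub_ne_zero.2 h1))]

lemma exists_eq_prod_mul {f : ℂ → ℂ} (hf : Differentiable ℂ f) (h : f 0 ≠ 0) (Z : Finset ℂ)
    (hZ : (0 : ℂ) ∉ Z) :
    ∃ g : ℂ → ℂ, Differentiable ℂ g ∧ g 0 = f 0 ∧ (∀ ρ ∈ Z, g ρ ≠ 0) ∧
      ∀ z, f z = (∏ ρ ∈ Z, (1 - z / ρ) ^ zeroOrder f ρ) * g z := by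
  classical
  induction Z using Finset.induction_on with
  | empty => exact ⟨f, hf, rfl, by simp, by simp⟩
  | insert ρ Z hρ ih =>
    have hρ0 : ρ ≠ 0 := fun h => hZ (by simp [h])
    obtain ⟨g, hg, hg0, hgZ, hfg⟩ := ih fun h => hZ (Finset.mem_insert_of_mem h)
    have hg0' : g 0 ≠ 0 := by rwa [hg0]
    obtain ⟨k, hk, hkρ, hgk⟩ := exists_eq_pow_mul hg hg0' ρ
    have hne : ∀ z ∈ Z, z ≠ 0 := fun z hz h => hZ (Finset.mem_insert_of_mem (h ▸ hz))
    have hord : zeroOrder g ρ = zeroOrder f ρ := by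
      set P : ℂ → ℂ := fun z => ∏ ρ ∈ Z, (1 - z / ρ) ^ zeroOrder f ρ with hP
      have hPd : Differentiable ℂ P := by
        refine Differentiable.fun_finsetProd fun i _ => ?_
        fun_prop
      have hPρ : P ρ ≠ 0 := Finset.prod_ne_zero_iff.2 fun z hz => pow_ne_zero _ fun h0 => by
        have : ρ = z := by
          have := hne z hz
          field_simp at h0
          linear_combination -h0
        exact hρ (this ▸ hz)
      have e : f = P * g := funext hfg
      have := analyticOrderAt_mul (hPd.analyticAt ρ) (hg.analyticAt ρ)
      rw [← e, (hPd.analyticAt ρ).analyticOrderAt_eq_zero.2 hPρ, zero_add,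
        ← cast_zeroOrder hf h, ← cast_zeroOrder hg hg0'] at this
      exact_mod_cast this.symm
    have e1 : ∀ z, z - ρ = -ρ * (1 - z / ρ) := fun z => by field_simp; ring
    have e2 : ∀ z, g z = (1 - z / ρ) ^ zeroOrder f ρ * ((-ρ) ^ zeroOrder f ρ * k z) := fun z => by
      rw [hgk, hord, e1, mul_pow]; ring
    refine ⟨fun z => (-ρ) ^ zeroOrder f ρ * k z, by fun_prop, ?_, ?_, ?_⟩
    · rw [← hg0, e2]; simp
    · intro z hz
      rcases Finset.mem_insert.1 hz with rfl | hz
      · exact mul_ne_zero (pow_ne_zero _ (neg_ne_zero.2 hρ0)) hkρ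
      · have := hgZ z hz
        rw [e2] at this
        exact right_ne_zero_of_mul this
    · intro z
      rw [Finset.prod_insert hρ, hfg, e2]
      ring

/-- Dividing out finitely many zeros in a disc does not increase the bound on a larger circle. -/
lemma norm_quotient_le {f g : ℂ → ℂ} (hg : Differentiable ℂ g) {m : ℂ → ℕ} {Z : Finset ℂ} {r M : ℝ}
    (hr : 0 < r) (hZ0 : (0 : ℂ) ∉ Z) (hZ : ∀ ρ ∈ Z, ‖ρ‖ ≤ r)
    (hfg : ∀ z, f z = (∏ ρ ∈ Z, (1 - z / ρ) ^ m ρ) * g z)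
    (hM : ∀ z, ‖z‖ = 4 * r → ‖f z‖ ≤ M) {z : ℂ} (hz : ‖z‖ ≤ 4 * r) :
    ‖g z‖ ≤ M / 3 ^ (∑ ρ ∈ Z, m ρ) := by
  have h4 : (4 * r : ℝ) ≠ 0 := by positivity
  refine Complex.norm_le_of_forall_mem_frontier_norm_le (U := Metric.ball 0 (4 * r))
    Metric.isBounded_ball hg.diffContOnCl (fun w hw => ?_) ?_
  · rw [frontier_ball _ h4, mem_sphere_zero_iff_norm] at hw
    have h3 : (3 : ℝ) ^ (∑ ρ ∈ Z, m ρ) ≤ ‖∏ ρ ∈ Z, (1 - w / ρ) ^ m ρ‖ := by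
      rw [norm_prod, ← Finset.prod_pow_eq_pow_sum]
      refine Finset.prod_le_prod (fun _ _ => by positivity) fun ρ hρ => ?_
      rw [norm_pow]
      refine pow_le_pow_left₀ (by norm_num) ?_ _
      have hρ0 : ρ ≠ 0 := fun h => hZ0 (h ▸ hρ)
      have h1 : 4 ≤ ‖w / ρ‖ := by
        rw [norm_div, hw, le_div_iff₀ (norm_pos_iff.2 hρ0)]
        have := hZ ρ hρ
        linarith
      have h2 := norm_sub_norm_le (w / ρ) 1
      rw [norm_one, norm_sub_rev] at h2
      linarith
    have := hM w hw
    rw [hfg, norm_mul] at this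
    rw [le_div_iff₀ (by positivity)]
    nlinarith [mul_le_mul_of_nonneg_right h3 (norm_nonneg (g w))]
  · rw [closure_ball _ h4]
    simpa using hz

section growth

variable {f : ℂ → ℂ} {C p : ℝ}

/-- Counting bound for the zeros of an entire function of finite order. -/
lemma exists_sum_zeroOrder_le (hf : Differentiable ℂ f) (h0 : f 0 ≠ 0) (hC : 0 ≤ C) (hp : 0 < p)
    (hgr : ∀ z, ‖f z‖ ≤ Real.exp (C * (1 + ‖z‖) ^ p)) :
    ∃ D, 0 ≤ D ∧ ∀ r, 0 < r → ∀ Z : Finset ℂ, (∀ ρ ∈ Z, f ρ = 0 ∧ ‖ρ‖ ≤ r) →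
      (∑ ρ ∈ Z, zeroOrder f ρ : ℕ) ≤ D * (1 + r) ^ p := by
  refine ⟨C * 4 ^ p + |Real.log ‖f 0‖|, by positivity, fun r hr Z hZ => ?_⟩
  have hZ0 : (0 : ℂ) ∉ Z := fun h => h0 (hZ 0 h).1
  obtain ⟨g, hg, hg0, -, hfg⟩ := exists_eq_prod_mul hf h0 Z hZ0
  set N := ∑ ρ ∈ Z, zeroOrder f ρ
  have h1 := norm_quotient_le hg hr hZ0 (fun ρ hρ => (hZ ρ hρ).2) hfg
    (M := Real.exp (C * (1 + 4 * r) ^ p)) (fun z hz => by rw [← hz]; exact hgr z) (z := 0)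
    (by simpa using hr.le)
  rw [hg0, le_div_iff₀ (by positivity)] at h1
  have hpos : 0 < ‖f 0‖ := norm_pos_iff.2 h0
  have h2 := Real.log_le_log (by positivity) h1
  rw [Real.log_exp, Real.log_mul hpos.ne' (by positivity), Real.log_pow] at h2
  have hl3 : 1 ≤ Real.log 3 := by
    rw [Real.le_log_iff_exp_le (by norm_num)]
    exact Real.exp_one_lt_d9.le.trans (by norm_num)
  have h3 : (1 + 4 * r) ^ p ≤ 4 ^ p * (1 + r) ^ p := by
    rw [← Real.mul_rpow (by norm_num) (by positivity)]
    exact Real.rpow_le_rpow (by positivity) (by linarith) hp.le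
  have h4 : 1 ≤ (1 + r) ^ p := Real.one_le_rpow (by linarith) hp.le
  have h5 : (N : ℝ) ≤ N * Real.log 3 := le_mul_of_one_le_right (by positivity) hl3
  have h6 := neg_abs_le (Real.log ‖f 0‖)
  have h7 := mul_le_mul_of_nonneg_left h4 (abs_nonneg (Real.log ‖f 0‖))
  have h8 := mul_le_mul_of_nonneg_left h3 hC
  nlinarith

lemma finite_zeros (hf : Differentiable ℂ f) (h0 : f 0 ≠ 0) (hC : 0 ≤ C) (hp : 0 < p)
    (hgr : ∀ z, ‖f z‖ ≤ Real.exp (C * (1 + ‖z‖) ^ p)) (r : ℝ) :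
    {ρ : ℂ | f ρ = 0 ∧ ‖ρ‖ ≤ r}.Finite := by
  obtain ⟨D, hD, hDZ⟩ := exists_sum_zeroOrder_le hf h0 hC hp hgr
  by_contra hinf
  set r' := max r 1
  obtain ⟨Z, hZ, hcard⟩ := Set.Infinite.exists_subset_card_eq hinf (⌊D * (1 + r') ^ p⌋₊ + 1)
  have h1 := hDZ r' (by positivity) Z fun ρ hρ =>
    ⟨(hZ hρ).1, (hZ hρ).2.trans (le_max_left _ _)⟩
  have h2 : Z.card ≤ ∑ ρ ∈ Z, zeroOrder f ρ := by
    rw [Finset.card_eq_sum_ones]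
    exact Finset.sum_le_sum fun ρ hρ => zeroOrder_pos hf h0 (hZ hρ).1
  have h3 : ((⌊D * (1 + r') ^ p⌋₊ + 1 : ℕ) : ℝ) ≤ D * (1 + r') ^ p :=
    le_trans (by rw [← hcard]; exact_mod_cast h2) h1
  have := Nat.lt_floor_add_one (D * (1 + r') ^ p)
  push_cast at h3
  linarith

lemma summable_zeroOrder_mul_rpow (hf : Differentiable ℂ f) (h0 : f 0 ≠ 0) (hC : 0 ≤ C)
    (hp : 0 < p) (hgr : ∀ z, ‖f z‖ ≤ Real.exp (C * (1 + ‖z‖) ^ p)) {q : ℝ} (hpq : p < q) :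
    Summable fun ρ : {ρ : ℂ // f ρ = 0} => (zeroOrder f ρ : ℝ) * (1 + ‖(ρ : ℂ)‖) ^ (-q) := by
  classical
  obtain ⟨D, hD, hDZ⟩ := exists_sum_zeroOrder_le hf h0 hC hp hgr
  have hn : ∀ z : ℂ, ∃ n : ℕ, (2 : ℝ) ^ n ≤ 1 + ‖z‖ ∧ 1 + ‖z‖ < 2 ^ (n + 1) := fun z =>
    exists_nat_pow_near (by simp) (by norm_num)
  choose ν hν1 hν2 using hn
  set θ : ℝ := 2 ^ (p - q) with hθ
  have hθ0 : 0 < θ := by positivity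
  have hθ1 : θ < 1 := Real.rpow_lt_one_of_one_lt_of_neg (by norm_num) (by linarith)
  have hgeo : Summable fun k : ℕ => D * 4 ^ p * θ ^ k :=
    (summable_geometric_of_lt_one hθ0.le hθ1).mul_left _
  refine summable_of_sum_le (c := ∑' k : ℕ, D * 4 ^ p * θ ^ k) (fun ρ => by positivity) fun u => ?_
  set Z : Finset ℂ := u.map (Function.Embedding.subtype _) with hZ
  have e : ∑ ρ ∈ u, (zeroOrder f ρ : ℝ) * (1 + ‖(ρ : ℂ)‖) ^ (-q) =
      ∑ ρ ∈ Z, (zeroOrder f ρ : ℝ) * (1 + ‖ρ‖) ^ (-q) := by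
    rw [hZ, Finset.sum_map]; rfl
  have hZf : ∀ ρ ∈ Z, f ρ = 0 := fun ρ hρ => by
    simp only [hZ, Finset.mem_map] at hρ
    obtain ⟨a, -, rfl⟩ := hρ
    exact a.2
  rw [e, ← Finset.sum_fiberwise_of_maps_to (t := Z.image ν) (g := ν)
    (fun ρ hρ => Finset.mem_image_of_mem _ hρ)]
  refine le_trans (Finset.sum_le_sum fun k _ => ?_)
    (hgeo.sum_le_tsum (Z.image ν) fun k _ => by positivity)
  have h1 : ∑ ρ ∈ Z with ν ρ = k, (zeroOrder f ρ : ℝ) * (1 + ‖ρ‖) ^ (-q) ≤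
      ∑ ρ ∈ Z with ν ρ = k, (zeroOrder f ρ : ℝ) * ((2 : ℝ) ^ k) ^ (-q) := by
    refine Finset.sum_le_sum fun ρ hρ => mul_le_mul_of_nonneg_left ?_ (by positivity)
    have := hν1 ρ
    rw [(Finset.mem_filter.1 hρ).2] at this
    exact Real.rpow_le_rpow_of_nonpos (by positivity) this (by linarith)
  refine h1.trans ?_
  rw [← Finset.sum_mul]
  have h2 := hDZ (2 ^ (k + 1)) (by positivity) (Z.filter fun ρ => ν ρ = k) fun ρ hρ => by
    have hh := Finset.mem_filter.1 hρ
    have := hν2 ρ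
    rw [hh.2] at this
    exact ⟨hZf ρ hh.1, by linarith⟩
  push_cast at h2
  have h3 : (1 + (2 : ℝ) ^ (k + 1)) ^ p ≤ 4 ^ p * (2 ^ k) ^ p := by
    rw [← Real.mul_rpow (by norm_num) (by positivity)]
    refine Real.rpow_le_rpow (by positivity) ?_ hp.le
    have : (1 : ℝ) ≤ 2 ^ k := one_le_pow₀ (by norm_num)
    rw [pow_succ]; linarith
  have h4 : ((2 : ℝ) ^ k) ^ p * ((2 : ℝ) ^ k) ^ (-q) = θ ^ k := by
    rw [← Real.rpow_add (by positivity), hθ, ← Real.rpow_natCast, ← Real.rpow_natCast,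
      ← Real.rpow_mul (by norm_num), ← Real.rpow_mul (by norm_num)]
    congr 1; ring
  calc _ ≤ (D * (4 ^ p * (2 ^ k) ^ p)) * ((2 : ℝ) ^ k) ^ (-q) := by
        refine mul_le_mul_of_nonneg_right (h2.trans ?_) (by positivity)
        exact mul_le_mul_of_nonneg_left h3 hD
    _ = _ := by rw [← h4]; ring

end growth

/-- The logarithmic derivative of a zero-free function on a disc varies slowly near the centre. -/
lemma norm_logDeriv_sub_le {g : ℂ → ℂ} (hg : Differentiable ℂ g) {r A : ℝ} (hr : 0 < r) (hA : 0 < A)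
    (hne : ∀ z, ‖z‖ < r → g z ≠ 0) (hgA : ∀ z, ‖z‖ < r → ‖g z‖ ≤ ‖g 0‖ * Real.exp A)
    {z : ℂ} (hz : ‖z‖ < r / 4) :
    ‖logDeriv g z - logDeriv g 0‖ ≤ 64 * A / r ^ 2 * ‖z‖ := by
  have hmem : ∀ w : ℂ, w ∈ Metric.ball (0 : ℂ) r ↔ ‖w‖ < r := fun w => mem_ball_zero_iff
  have hld : DifferentiableOn ℂ (logDeriv g) (Metric.ball 0 r) := fun w hw => by
    refine DifferentiableAt.differentiableWithinAt ?_
    exact ((hg.analyticAt w).deriv.differentiableAt).div hg.differentiableAt (hne w ((hmem w).1 hw))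
  obtain ⟨H, hH0, hH⟩ := hld.isExactOn_ball.with_val_at 0 0
  have hconst : ∀ w, ‖w‖ < r → g w = g 0 * exp (H w) := by
    intro w hw
    have hd : ∀ x ∈ Metric.ball (0 : ℂ) r, HasDerivAt (fun x => g x * exp (-H x)) 0 x :=
        fun x hx => by
      refine HasDerivAt.congr_deriv ((hg.differentiableAt.hasDerivAt).mul (hH x hx).neg.cexp) ?_
      have := hne x ((hmem x).1 hx)
      rw [logDeriv_apply]
      simp only [Pi.neg_apply]
      field_simp
      ring
    have h1 := IsOpen.is_const_of_deriv_eq_zero (𝕜 := ℂ) (s := Metric.ball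
        (0 : ℂ) r) Metric.isOpen_ball
      (convex_ball 0 r).isPreconnected
      (fun x hx => (hd x hx).differentiableAt.differentiableWithinAt)
      (fun x hx => (hd x hx).deriv) ((hmem w).2 hw) ((hmem 0).2 (by simpa using hr))
    simp only [hH0, neg_zero, Complex.exp_zero, mul_one] at h1
    rw [← h1, mul_assoc, ← Complex.exp_add, neg_add_cancel, Complex.exp_zero, mul_one]
  have hg0 : 0 < ‖g 0‖ := norm_pos_iff.2 (hne 0 (by simpa using hr))
  have hRe : ∀ w, ‖w‖ < r → (H w).re ≤ A := fun w hw => by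
    have := hgA w hw
    rw [hconst w hw, norm_mul, Complex.norm_exp] at this
    exact Real.exp_le_exp.1 (le_of_mul_le_mul_left this hg0)
  have hHd : DifferentiableOn ℂ H (Metric.ball 0 r) := fun w hw =>
    (hH w hw).differentiableAt.differentiableWithinAt
  have hBC : ∀ w, ‖w‖ ≤ r / 2 → ‖H w‖ ≤ 2 * A := fun w hw => by
    have := borelCaratheodory_zero hA hHd (fun x hx => hRe x ((hmem x).1 hx)) hr
      ((hmem w).2 (by linarith)) hH0
    refine this.trans ?_
    rw [div_le_iff₀ (by linarith)]
    nlinarith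
  have hC : ∀ w, ‖w‖ < r / 4 → ‖logDeriv g w‖ ≤ 8 * A / r := fun w hw => by
    have hsub : ∀ x, dist x w ≤ r / 4 → ‖x‖ ≤ r / 2 := fun x hx => by
      have := norm_sub_norm_le x w
      rw [dist_eq_norm] at hx
      linarith
    rw [← (hH w ((hmem w).2 (by linarith))).deriv]
    refine (Complex.norm_deriv_le_of_forall_mem_sphere_norm_le (R := r / 4) (C := 2 * A)
      (by positivity) ?_ fun x hx => hBC x (hsub x (Metric.mem_sphere.1 hx).le)).trans
      (le_of_eq (by field_simp; ring))
    refine (hHd.mono fun x hx => ?_).diffContOnCl_ball (U := Metric.closedBall w (r / 4)) subset_rfl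
    exact (hmem x).2 (by linarith [hsub x (Metric.mem_closedBall.1 hx)])
  have h0 : ‖(0 : ℂ)‖ < r / 4 := by simpa using hr
  have := dist_le_div_mul_dist_of_mapsTo_ball (c := 0) (R₁ := r / 4) (R₂ := 16 * A / r) (z := z)
    (hld.mono (Metric.ball_subset_ball (by linarith))) (fun w hw => by
      rw [Metric.mem_closedBall, dist_eq_norm]
      refine (norm_sub_le _ _).trans ?_
      have h1 := hC w (mem_ball_zero_iff.1 hw)
      have h2 := hC 0 h0
      calc _ ≤ 8 * A / r + 8 * A / r := add_le_add h1 h2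
        _ = _ := by ring) (mem_ball_zero_iff.2 hz)
  rw [dist_eq_norm, dist_zero_right] at this
  refine this.trans (le_of_eq ?_)
  field_simp
  ring

section growth

variable {f : ℂ → ℂ} {C p : ℝ}

lemma summable_zeroOrder_mul_inv_add_inv (hf : Differentiable ℂ f) (h0 : f 0 ≠ 0) (hC : 0 ≤ C)
    (hp : 0 < p) (hp2 : p < 2) (hgr : ∀ z, ‖f z‖ ≤ Real.exp (C * (1 + ‖z‖) ^ p)) (z : ℂ) :
    Summable fun ρ : {ρ : ℂ // f ρ = 0} =>
      (zeroOrder f ρ : ℂ) * (1 / (z - (ρ : ℂ)) + 1 / (ρ : ℂ)) := by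
  have hs := (summable_zeroOrder_mul_rpow hf h0 hC hp hgr hp2).mul_left (8 * ‖z‖)
  refine Summable.of_norm_bounded_eventually hs ?_
  rw [Filter.eventually_cofinite]
  have hfin := (finite_zeros hf h0 hC hp hgr (2 * ‖z‖ + 1)).preimage
    (f := ((↑) : {ρ : ℂ // f ρ = 0} → ℂ)) Subtype.val_injective.injOn
  refine hfin.subset fun ρ hρ => ⟨ρ.2, ?_⟩
  by_contra hlt
  rw [not_le] at hlt
  refine hρ ?_
  have hρ0 : (ρ : ℂ) ≠ 0 := fun h => h0 (by simpa [h] using ρ.2)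
  have hnz := norm_nonneg z
  have hzρ : z - ρ ≠ 0 := fun h => by
    rw [sub_eq_zero.1 h] at hlt
    linarith [norm_nonneg (ρ : ℂ)]
  have e : 1 / (z - (ρ : ℂ)) + 1 / (ρ : ℂ) = z / (ρ * (z - ρ)) := by field_simp; ring
  have h1 : ‖(ρ : ℂ)‖ / 2 ≤ ‖z - ρ‖ := by
    have := norm_sub_norm_le (ρ : ℂ) z
    rw [norm_sub_rev] at this
    linarith
  rw [e, norm_mul, norm_div, norm_mul, Complex.norm_natCast, Real.rpow_neg (by positivity),
    Real.rpow_two]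
  have h2 : ‖z‖ / (‖(ρ : ℂ)‖ * ‖z - ρ‖) ≤ 8 * ‖z‖ * ((1 + ‖(ρ : ℂ)‖) ^ 2)⁻¹ := by
    have hpos : 0 < ‖(ρ : ℂ)‖ * ‖z - ρ‖ := mul_pos (norm_pos_iff.2 hρ0) (norm_pos_iff.2 hzρ)
    rw [div_le_iff₀ hpos, mul_assoc, mul_assoc, mul_comm 8, mul_assoc]
    refine le_mul_of_one_le_right hnz ?_
    rw [mul_comm, ← mul_assoc, ← div_eq_mul_inv, div_mul_eq_mul_div, one_le_div (by positivity)]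
    nlinarith [mul_le_mul_of_nonneg_left h1 (norm_nonneg (ρ : ℂ))]
  calc _ ≤ (zeroOrder f ρ : ℝ) * (8 * ‖z‖ * ((1 + ‖(ρ : ℂ)‖) ^ 2)⁻¹) :=
        mul_le_mul_of_nonneg_left h2 (by positivity)
    _ = _ := by ring

/-- The quotient by all zeros in a closed disc has small second order logarithmic variation. -/
lemma exists_norm_logDeriv_sub_sum_le (hf : Differentiable ℂ f) (h0 : f 0 ≠ 0) (hC : 0 ≤ C)
    (hp : 0 < p) (hgr : ∀ z, ‖f z‖ ≤ Real.exp (C * (1 + ‖z‖) ^ p)) :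
    ∃ D, ∀ r, 0 < r → ∀ Z : Finset ℂ, (∀ ρ, ρ ∈ Z ↔ f ρ = 0 ∧ ‖ρ‖ ≤ r) →
      ∀ z, ‖z‖ < r / 4 → f z ≠ 0 →
        ‖logDeriv f z - logDeriv f 0 - ∑ ρ ∈ Z, (zeroOrder f ρ : ℂ) * (1 / (z - ρ) + 1 / ρ)‖ ≤
          D * (1 + r) ^ p / r ^ 2 * ‖z‖ := by
  refine ⟨64 * (C * 4 ^ p + |Real.log ‖f 0‖| + 1), fun r hr Z hZ z hz hfz => ?_⟩
  have hZ0 : (0 : ℂ) ∉ Z := fun h => h0 ((hZ 0).1 h).1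
  obtain ⟨g, hg, hg0, hgZ, hfg⟩ := exists_eq_prod_mul hf h0 Z hZ0
  have hne0 : ∀ ρ ∈ Z, ρ ≠ 0 := fun ρ hρ h => hZ0 (h ▸ hρ)
  set A := C * (1 + 4 * r) ^ p + |Real.log ‖f 0‖| + 1 with hA
  have hApos : 0 < A := by positivity
  have hf0 : 0 < ‖f 0‖ := norm_pos_iff.2 h0
  have hgne : ∀ w, ‖w‖ < r → g w ≠ 0 := fun w hw hgw => by
    have : f w = 0 := by rw [hfg, hgw, mul_zero]
    exact hgZ w ((hZ w).2 ⟨this, hw.le⟩) hgw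
  have hgA : ∀ w, ‖w‖ < r → ‖g w‖ ≤ ‖g 0‖ * Real.exp A := fun w hw => by
    have h1 := norm_quotient_le hg hr hZ0 (fun ρ hρ => ((hZ ρ).1 hρ).2) hfg
      (M := Real.exp (C * (1 + 4 * r) ^ p)) (fun z hz => by rw [← hz]; exact hgr z) (z := w)
      (by linarith)
    refine h1.trans ((div_le_self (Real.exp_pos _).le (one_le_pow₀ (by norm_num))).trans ?_)
    rw [hg0]
    nth_rewrite 1 [← Real.exp_log hf0]
    rw [← Real.exp_add]
    refine Real.exp_le_exp.2 ?_
    have := neg_abs_le (Real.log ‖f 0‖)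
    linarith
  have hkey := norm_logDeriv_sub_le hg hr hApos hgne hgA hz
  have hld : ∀ w, f w ≠ 0 → logDeriv f w =
      ∑ ρ ∈ Z, (zeroOrder f ρ : ℂ) * (1 / (w - ρ)) + logDeriv g w := fun w hw => by
    have hw' := hw
    rw [hfg] at hw'
    have hP := left_ne_zero_of_mul hw'
    have hG := right_ne_zero_of_mul hw'
    have e : f = fun w => (∏ ρ ∈ Z, (1 - w / ρ) ^ zeroOrder f ρ) * g w := funext hfg
    have hd : ∀ ρ ∈ Z, DifferentiableAt ℂ (fun w => (1 - w / ρ) ^ zeroOrder f ρ) w := fun ρ _ => by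
      fun_prop
    have hfac : ∀ ρ ∈ Z, (1 - w / ρ) ^ zeroOrder f ρ ≠ 0 := fun ρ hρ =>
      Finset.prod_ne_zero_iff.1 hP ρ hρ
    conv_lhs => rw [e]
    rw [logDeriv_mul w hP hG (DifferentiableAt.fun_finsetProd hd) hg.differentiableAt,
      logDeriv_prod hfac hd]
    congr 1
    refine Finset.sum_congr rfl fun ρ hρ => ?_
    have hne := hne0 ρ hρ
    have hwρ : w - ρ ≠ 0 := fun h => by
      rw [sub_eq_zero.1 h] at hw
      exact hw ((hZ ρ).1 hρ).1
    rw [logDeriv_fun_pow (f := fun w => 1 - w / ρ) (by fun_prop), logDeriv_apply]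
    have hdv : deriv (fun w => 1 - w / ρ) w = -(1 / ρ) := by
      rw [deriv_const_sub, deriv_div_const, deriv_id'']
    have h1 : 1 - w / ρ = -(w - ρ) / ρ := by field_simp; ring
    rw [hdv, h1]
    field_simp
  have e : logDeriv f z - logDeriv f 0 - ∑ ρ ∈ Z, (zeroOrder f ρ : ℂ) * (1 / (z - ρ) + 1 / ρ) =
      logDeriv g z - logDeriv g 0 := by
    rw [hld z hfz, hld 0 h0]
    have : ∑ ρ ∈ Z, (zeroOrder f ρ : ℂ) * (1 / (z - ρ) + 1 / ρ) =
        ∑ ρ ∈ Z, (zeroOrder f ρ : ℂ) * (1 / (z - ρ)) -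
          ∑ ρ ∈ Z, (zeroOrder f ρ : ℂ) * (1 / (0 - ρ)) := by
      rw [← Finset.sum_sub_distrib]
      refine Finset.sum_congr rfl fun ρ _ => ?_
      rw [zero_sub, one_div_neg_eq_neg_one_div]; ring
    rw [this]; ring
  rw [e]
  refine hkey.trans ?_
  have h3 : (1 + 4 * r) ^ p ≤ 4 ^ p * (1 + r) ^ p := by
    rw [← Real.mul_rpow (by norm_num) (by positivity)]
    exact Real.rpow_le_rpow (by positivity) (by linarith) hp.le
  have h4 : 1 ≤ (1 + r) ^ p := Real.one_le_rpow (by linarith) hp.le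
  have h7 := mul_le_mul_of_nonneg_left h4 (abs_nonneg (Real.log ‖f 0‖))
  have h8 := mul_le_mul_of_nonneg_left h3 hC
  have hA2 : 64 * A ≤ 64 * (C * 4 ^ p + |Real.log ‖f 0‖| + 1) * (1 + r) ^ p := by
    rw [hA]; nlinarith
  gcongr

/-- The partial fraction expansion of the logarithmic derivative of an entire function of order
less than two. -/
theorem hasSum_logDeriv_sub (hf : Differentiable ℂ f) (h0 : f 0 ≠ 0) (hC : 0 ≤ C)
    (hp : 0 < p) (hp2 : p < 2) (hgr : ∀ z, ‖f z‖ ≤ Real.exp (C * (1 + ‖z‖) ^ p)) {z : ℂ}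
    (hz : f z ≠ 0) :
    HasSum (fun ρ : {ρ : ℂ // f ρ = 0} =>
      (zeroOrder f ρ : ℂ) * (1 / (z - (ρ : ℂ)) + 1 / (ρ : ℂ))) (logDeriv f z - logDeriv f 0) := by
  classical
  have hs := summable_zeroOrder_mul_inv_add_inv hf h0 hC hp hp2 hgr z
  obtain ⟨D, hD⟩ := exists_norm_logDeriv_sub_sum_le hf h0 hC hp hgr
  set Z : ℕ → Finset ℂ := fun n => (finite_zeros hf h0 hC hp hgr n).toFinset with hZ
  have hZm : ∀ (n : ℕ) ρ, ρ ∈ Z n ↔ f ρ = 0 ∧ ‖ρ‖ ≤ n := fun n ρ => by simp [hZ]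
  set Y : ℕ → Finset {ρ : ℂ // f ρ = 0} := fun n => (Z n).subtype _ with hY
  have hYt : Tendsto Y atTop atTop := by
    refine tendsto_atTop_finset_of_monotone (fun a b hab ρ => ?_) fun ρ => ?_
    · simp only [hY, Finset.mem_subtype, hZm]
      exact fun h => ⟨h.1, h.2.trans (by exact_mod_cast hab)⟩
    · obtain ⟨n, hn⟩ := exists_nat_ge ‖(ρ : ℂ)‖
      exact ⟨n, by simp only [hY, Finset.mem_subtype, hZm]; exact ⟨ρ.2, hn⟩⟩
  have h1 := hs.hasSum.comp hYt
  have hsum : ∀ n, ∑ ρ ∈ Y n, (zeroOrder f ρ : ℂ) * (1 / (z - (ρ : ℂ)) + 1 / (ρ : ℂ)) =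
      ∑ ρ ∈ Z n, (zeroOrder f ρ : ℂ) * (1 / (z - ρ) + 1 / ρ) := fun n => by
    rw [Finset.sum_subtype_of_mem (f := fun ρ : ℂ => (zeroOrder f ρ : ℂ) * (1 / (z - ρ) + 1 / ρ))]
    exact fun ρ hρ => ((hZm n ρ).1 hρ).1
  have hlim : Tendsto (fun n : ℕ => D * (1 + (n : ℝ)) ^ p / (n : ℝ) ^ 2 * ‖z‖) atTop (nhds 0) := by
    have hb : Tendsto (fun n : ℕ => |D| * 2 ^ p * ‖z‖ * (n : ℝ) ^ (-(2 - p))) atTop (nhds 0) := by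
      simpa using (((tendsto_rpow_neg_atTop (by linarith : 0 < 2 - p)).comp
        tendsto_natCast_atTop_atTop).const_mul (|D| * 2 ^ p * ‖z‖))
    refine squeeze_zero_norm' ?_ hb
    filter_upwards [eventually_ge_atTop 1] with n hn
    have hn1 : (1 : ℝ) ≤ n := by exact_mod_cast hn
    rw [norm_mul, norm_div, norm_mul, norm_norm, Real.norm_eq_abs D,
      Real.norm_of_nonneg (by positivity : 0 ≤ (1 + (n : ℝ)) ^ p),
      Real.norm_of_nonneg (by positivity : 0 ≤ (n : ℝ) ^ 2)]
    have h2 : (1 + (n : ℝ)) ^ p ≤ 2 ^ p * n ^ p := by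
      rw [← Real.mul_rpow (by norm_num) (by positivity)]
      exact Real.rpow_le_rpow (by positivity) (by linarith) hp.le
    have h3 : (n : ℝ) ^ (-(2 - p)) = n ^ p / n ^ 2 := by
      rw [← Real.rpow_two, ← Real.rpow_sub (by linarith)]; congr 1; ring
    rw [h3]
    calc _ ≤ |D| * (2 ^ p * n ^ p) / (n : ℝ) ^ 2 * ‖z‖ := by gcongr
      _ = _ := by ring
  have h2 : Tendsto (fun n => ∑ ρ ∈ Y n,
      (zeroOrder f ρ : ℂ) * (1 / (z - (ρ : ℂ)) + 1 / (ρ : ℂ))) atTop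
      (nhds (logDeriv f z - logDeriv f 0)) := by
    rw [tendsto_iff_norm_sub_tendsto_zero]
    refine squeeze_zero_norm' ?_ hlim
    filter_upwards [eventually_gt_atTop ⌈4 * ‖z‖⌉₊] with n hn
    have hn4 : 4 * ‖z‖ < n := (Nat.le_ceil _).trans_lt (by exact_mod_cast hn)
    rw [norm_norm, norm_sub_rev, hsum]
    exact hD n (by linarith [norm_nonneg z]) (Z n) (hZm n) z (by linarith) hz
  rw [← tendsto_nhds_unique h1 h2]
  exact hs.hasSum

lemma countable_zeros (hf : Differentiable ℂ f) (h0 : f 0 ≠ 0) (hC : 0 ≤ C) (hp : 0 < p)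
    (hgr : ∀ z, ‖f z‖ ≤ Real.exp (C * (1 + ‖z‖) ^ p)) : Countable {ρ : ℂ // f ρ = 0} := by
  have : {ρ : ℂ | f ρ = 0} = ⋃ n : ℕ, {ρ : ℂ | f ρ = 0 ∧ ‖ρ‖ ≤ n} := by
    ext ρ
    simp only [Set.mem_ofPred_eq, Set.mem_iUnion]
    exact ⟨fun h => (exists_nat_ge ‖ρ‖).imp fun n hn => ⟨h, hn⟩, fun ⟨_, h⟩ => h.1⟩
  refine Set.Countable.to_subtype (s := {ρ : ℂ | f ρ = 0}) ?_
  rw [this]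
  exact Set.countable_iUnion fun n => (finite_zeros hf h0 hC hp hgr n).countable

end growth

lemma hasDerivAt_ofReal_mul_I (c : ℂ) (y : ℝ) :
    HasDerivAt (fun y : ℝ => c + y * I) I y := by
  simpa using ((hasDerivAt_id y).ofReal_comp.mul_const I).const_add c

lemma sqrt_mul_abs_le_norm (c u : ℝ) :
    Real.sqrt (c * |u|) ≤ ‖(c : ℂ) + u * I‖ := by
  rw [Complex.norm_def, Complex.normSq_add_mul_I]
  refine Real.sqrt_le_sqrt ?_
  nlinarith [sq_nonneg (c - |u|), sq_abs u, sq_nonneg c, sq_nonneg u]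

lemma ofReal_add_mul_I_ne_zero {c : ℝ} (hc : 0 < c) (u : ℝ) : (c : ℂ) + u * I ≠ 0 := fun h => by
  have := congrArg Complex.re h
  simp at this
  linarith

lemma norm_inv_sub_inv_le {c : ℝ} (hc : 0 < c) (u : ℝ) :
    ‖1 / (c : ℂ) - 1 / ((c : ℂ) + u * I)‖ ≤ Real.sqrt |u| * c ^ (-(3 / 2) : ℝ) := by
  have hne := ofReal_add_mul_I_ne_zero hc u
  have hc' : (c : ℂ) ≠ 0 := by exact_mod_cast hc.ne'
  have e : 1 / (c : ℂ) - 1 / ((c : ℂ) + u * I) = u * I / (c * ((c : ℂ) + u * I)) := by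
    field_simp; ring
  rw [e, norm_div, norm_mul, norm_mul, Complex.norm_I, mul_one, Complex.norm_real,
      Complex.norm_real,
    Real.norm_eq_abs, Real.norm_of_nonneg hc.le]
  have h1 := sqrt_mul_abs_le_norm c u
  have hpos : 0 < ‖(c : ℂ) + u * I‖ := norm_pos_iff.2 hne
  rw [div_le_iff₀ (by positivity)]
  have e2 : c ^ (-(3 / 2) : ℝ) * c * Real.sqrt c = 1 := by
    rw [Real.sqrt_eq_rpow]
    nth_rewrite 2 [← Real.rpow_one c]
    rw [← Real.rpow_add hc, ← Real.rpow_add hc]; norm_num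
  have h0 := Real.mul_self_sqrt (abs_nonneg u)
  rw [Real.sqrt_mul hc.le] at h1
  calc |u| = Real.sqrt |u| * Real.sqrt |u| * (c ^ (-(3 / 2) : ℝ) * c * Real.sqrt c) := by
        rw [e2, mul_one, h0]
    _ = Real.sqrt |u| * c ^ (-(3 / 2) : ℝ) * (c * (Real.sqrt c * Real.sqrt |u|)) := by ring
    _ ≤ _ := by gcongr

lemma summable_add_rpow {x : ℝ} (hx : 1 ≤ x) :
    Summable fun j : ℕ => (x + j) ^ (-(3 / 2) : ℝ) := by
  have h := (Real.summable_nat_rpow (p := -(3 / 2))).2 (by norm_num)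
  refine Summable.of_nonneg_of_le (fun j => by positivity) (fun j => ?_)
    ((summable_nat_add_iff 1).2 h)
  refine Real.rpow_le_rpow_of_nonpos (by positivity) ?_ (by norm_num)
  push_cast; linarith

/-- A primitive of `u ↦ 1 / c - 1 / (c + i u)`. -/
def lineLog (c y : ℝ) : ℂ := y / c + I * (log ((c : ℂ) + y * I) - log c)

lemma hasDerivAt_lineLog {c : ℝ} (hc : 0 < c) (y : ℝ) :
    HasDerivAt (lineLog c) (1 / (c : ℂ) - 1 / ((c : ℂ) + y * I)) y := by
  have hs : (c : ℂ) + y * I ∈ slitPlane := Or.inl (by simpa using hc)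
  have h1 := ((hasDerivAt_ofReal_mul_I (c : ℂ) y).clog_real hs).sub_const (log (c : ℂ))
  have h2 := ((hasDerivAt_id y).ofReal_comp.div_const (c : ℂ)).add (h1.const_mul I)
  refine HasDerivAt.congr_deriv h2 ?_
  rw [← mul_div_assoc, I_mul_I]
  simp
  ring

lemma exp_lineLog {c : ℝ} (hc : 0 < c) (y : ℝ) :
    exp (I * lineLog c y) = exp (I * y / c) * (c / ((c : ℂ) + y * I)) := by
  have hne := ofReal_add_mul_I_ne_zero hc y
  have hc' : (c : ℂ) ≠ 0 := by exact_mod_cast hc.ne'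
  have e : I * lineLog c y = I * y / c + (log c - log ((c : ℂ) + y * I)) := by
    unfold lineLog
    linear_combination (log ((c : ℂ) + y * I) - log c) * I_mul_I
  rw [e, exp_add, exp_sub, exp_log hc', exp_log hne]

lemma GammaSeq_line {x : ℝ} (hx : 1 ≤ x) (y : ℝ) {n : ℕ} (hn : n ≠ 0) :
    GammaSeq ((x : ℂ) + y * I) n = GammaSeq x n *
      exp (I * ((Real.log n - ∑ j ∈ range (n + 1), 1 / (x + j) : ℝ) * y +
        ∑ j ∈ range (n + 1), lineLog (x + j) y)) := by
  have hn' : (n : ℂ) ≠ 0 := by exact_mod_cast hn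
  have hpos : ∀ j : ℕ, 0 < x + j := fun j => by positivity
  have h1 : (n : ℂ) ^ ((x : ℂ) + y * I) = (n : ℂ) ^ (x : ℂ) * exp (I * (Real.log n * y)) := by
    rw [cpow_add _ _ hn', cpow_def_of_ne_zero hn' (y * I), natCast_log]
    congr 2; ring
  have h2 : exp (I * ((Real.log n - ∑ j ∈ range (n + 1), 1 / (x + j) : ℝ) * y +
        ∑ j ∈ range (n + 1), lineLog (x + j) y)) = exp (I * (Real.log n * y)) *
        ∏ j ∈ range (n + 1), (((x : ℂ) + j) / ((x : ℂ) + y * I + j)) := by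
    have : I * ((Real.log n - ∑ j ∈ range (n + 1), 1 / (x + j) : ℝ) * y +
        ∑ j ∈ range (n + 1), lineLog (x + j) y) = I * (Real.log n * y) +
        ∑ j ∈ range (n + 1), (I * lineLog (x + j) y - I * y / (x + j : ℝ)) := by
      push_cast
      rw [Finset.sum_sub_distrib, ← Finset.mul_sum]
      have : ∑ j ∈ range (n + 1), I * (y : ℂ) / ((x : ℂ) + j) =
          I * y * ∑ j ∈ range (n + 1), 1 / ((x : ℂ) + j) := by
        rw [Finset.mul_sum]; exact Finset.sum_congr rfl fun j _ => by ring
      rw [this]; ring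
    rw [this, exp_add, exp_sum]
    congr 1
    refine Finset.prod_congr rfl fun j _ => ?_
    rw [exp_sub, exp_lineLog (hpos j), mul_div_cancel_left₀ _ (exp_ne_zero _)]
    push_cast
    rw [add_right_comm]
  unfold GammaSeq
  rw [h1, h2, Finset.prod_div_distrib]
  have h3 : ∏ j ∈ range (n + 1), ((x : ℂ) + j) ≠ 0 := Finset.prod_ne_zero_iff.2 fun j _ => by
    exact_mod_cast (hpos j).ne'
  have h4 : ∏ j ∈ range (n + 1), ((x : ℂ) + y * I + j) ≠ 0 := Finset.prod_ne_zero_iff.2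
      fun j _ => by
    have := ofReal_add_mul_I_ne_zero (hpos j) y
    push_cast at this
    rwa [add_right_comm]
  field_simp

lemma tendsto_log_sub_sum {x : ℝ} (hx : 1 ≤ x) :
    ∃ a : ℝ, Tendsto (fun n : ℕ => Real.log n - ∑ j ∈ range (n + 1), 1 / (x + j)) atTop
        (nhds a) := by
  have hs : Summable fun j : ℕ => 1 / ((j : ℝ) + 1) - 1 / (x + j) := by
    have h := (summable_nat_add_iff 1).2 (Real.summable_one_div_nat_pow.2 (by norm_num : 1 < 2))
    refine Summable.of_nonneg_of_le (fun j => ?_) (fun j => ?_) (h.mul_left (x - 1))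
    · rw [sub_nonneg]
      exact one_div_le_one_div_of_le (by positivity) (by linarith)
    · have h1 : 0 < x + j := by positivity
      rw [div_sub_div _ _ (by positivity) h1.ne', Nat.cast_add, Nat.cast_one, mul_one_div,
        div_le_div_iff₀ (by positivity) (by positivity)]
      have : (j : ℝ) + 1 ≤ x + j := by linarith
      nlinarith [mul_nonneg (sub_nonneg.2 hx) (by positivity : 0 ≤ (j : ℝ) + 1),
        mul_nonneg (mul_nonneg (sub_nonneg.2 hx) (by positivity : 0 ≤ (j : ℝ) + 1))
            (sub_nonneg.2 this)]
  have h1 := Real.tendsto_harmonic_sub_log.neg.add hs.hasSum.tendsto_sum_nat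
  have h2 : Tendsto (fun n : ℕ => 1 / (x + n)) atTop (nhds 0) := by
    simp only [one_div]
    exact (tendsto_atTop_add_const_left atTop x
      (tendsto_natCast_atTop_atTop (R := ℝ))).inv_tendsto_atTop
  refine ⟨_, (h1.sub h2).congr fun n => ?_⟩
  rw [Finset.sum_range_succ, Finset.sum_sub_distrib, harmonic]
  push_cast
  simp only [one_div]
  ring

lemma Gamma_line {x : ℝ} (hx : 1 ≤ x) : ∃ a : ℝ, ∀ y : ℝ,
    logDeriv Gamma ((x : ℂ) + y * I) =
      a + ∑' j : ℕ, (1 / ((x + j : ℝ) : ℂ) - 1 / (((x + j : ℝ) : ℂ) + y * I)) := by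
  obtain ⟨a, ha⟩ := tendsto_log_sub_sum hx
  refine ⟨a, fun y₀ => ?_⟩
  have hpos : ∀ j : ℕ, 0 < x + j := fun j => by positivity
  set t := Metric.ball (0 : ℝ) (|y₀| + 1) with ht
  have hty : y₀ ∈ t := by simp [ht]
  have ht0 : (0 : ℝ) ∈ t := by simp [ht]; positivity
  have htp : IsPreconnected t := (convex_ball _ _).isPreconnected
  have hu := (summable_add_rpow hx).mul_left (Real.sqrt (|y₀| + 1))
  have hb : ∀ (j : ℕ), ∀ y ∈ t, ‖1 / ((x + j : ℝ) : ℂ) - 1 / (((x + j : ℝ) : ℂ) + y * I)‖ ≤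
      Real.sqrt (|y₀| + 1) * (x + j) ^ (-(3 / 2) : ℝ) := fun j y hy => by
    refine (norm_inv_sub_inv_le (hpos j) y).trans ?_
    have : |y| ≤ |y₀| + 1 := by simpa [ht] using (mem_ball_zero_iff.1 hy).le
    gcongr
  have h0 : Summable fun j : ℕ => lineLog (x + j) 0 := by
    simp [lineLog]
  have hd : ∀ (j : ℕ), ∀ y ∈ t, HasDerivAt (lineLog (x + j)) _ y :=
    fun j y _ => hasDerivAt_lineLog (hpos j) y
  have hS : ∀ y ∈ t, Summable fun j : ℕ => lineLog (x + j) y := fun y hy =>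
    summable_of_summable_hasDerivAt_of_isPreconnected hu Metric.isOpen_ball htp hd hb ht0 h0 hy
  have hD := hasDerivAt_tsum_of_isPreconnected hu Metric.isOpen_ball htp hd hb ht0 h0 hty
  have hG : ∀ y ∈ t, Gamma ((x : ℂ) + y * I) =
      Gamma x * exp (I * (a * y + ∑' j : ℕ, lineLog (x + j) y)) := fun y hy => by
    have e1 := (hS y hy).hasSum.tendsto_sum_nat.comp (tendsto_add_atTop_nat 1)
    have e2 := (Complex.continuous_ofReal.tendsto a).comp ha
    have e3 := ((e2.mul_const (y : ℂ)).add e1).const_mul I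
    have e4 := (GammaSeq_tendsto_Gamma (x : ℂ)).mul ((Complex.continuous_exp.tendsto _).comp e3)
    refine tendsto_nhds_unique (GammaSeq_tendsto_Gamma _) (e4.congr' ?_)
    filter_upwards [eventually_ne_atTop 0] with n hn
    rw [GammaSeq_line hx y hn]
    rfl
  have hGe : (fun y : ℝ => Gamma ((x : ℂ) + y * I)) =ᶠ[nhds y₀] fun y =>
      Gamma x * exp (I * (a * y + ∑' j : ℕ, lineLog (x + j) y)) := by
    filter_upwards [Metric.isOpen_ball.mem_nhds hty] with y hy using hG y hy
  have hre : 0 < ((x : ℂ) + y₀ * I).re := by simp; linarith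
  have hΓne : Gamma ((x : ℂ) + y₀ * I) ≠ 0 := Gamma_ne_zero_of_re_pos hre
  have hΓd : DifferentiableAt ℂ Gamma ((x : ℂ) + y₀ * I) := differentiableAt_Gamma _ fun m h => by
    rw [h] at hre
    simp at hre
    linarith [(Nat.cast_nonneg m : (0 : ℝ) ≤ m)]
  have d1 := (hΓd.hasDerivAt.comp_of_eq y₀ (hasDerivAt_ofReal_mul_I (x : ℂ) y₀) rfl)
  have d2 := ((((hasDerivAt_id y₀).ofReal_comp.const_mul
      (a : ℂ)).add hD).const_mul I).cexp.const_mul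
    (Gamma x)
  have d3 := (d2.congr_of_eventuallyEq hGe).unique d1
  rw [logDeriv_apply, div_eq_iff hΓne, hG y₀ hty]
  refine mul_right_cancel₀ I_ne_zero ?_
  rw [← d3]
  simp only [Pi.add_apply, id]
  push_cast
  ring

lemma continuous_logDeriv_Gamma_line {x : ℝ} (hx : 1 ≤ x) :
    Continuous fun y : ℝ => logDeriv Gamma ((x : ℂ) + y * I) := by
  have ho : IsOpen {s : ℂ | 0 < s.re} := isOpen_lt continuous_const continuous_re
  have hd : DifferentiableOn ℂ Gamma {s : ℂ | 0 < s.re} := fun s hs =>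
    (differentiableAt_Gamma s fun m h => by
      have hs' : 0 < s.re := hs
      rw [h] at hs'
      simp at hs'
      linarith [(Nat.cast_nonneg m : (0 : ℝ) ≤ m)]).differentiableWithinAt
  have hc : ContinuousOn (logDeriv Gamma) {s : ℂ | 0 < s.re} :=
    ((hd.deriv ho).div hd fun s hs => Gamma_ne_zero_of_re_pos hs).continuousOn
  refine hc.comp_continuous (by fun_prop) fun y => ?_
  simp
  linarith

lemma norm_logDeriv_Gamma_line_le {x : ℝ} (hx : 1 ≤ x) : ∃ C, 0 ≤ C ∧ ∀ y : ℝ,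
    ‖logDeriv Gamma ((x : ℂ) + y * I)‖ ≤ C * Real.sqrt (1 + |y|) := by
  obtain ⟨a, ha⟩ := Gamma_line hx
  have hs := summable_add_rpow hx
  have hpos : ∀ j : ℕ, 0 < x + j := fun j => by positivity
  have hS : 0 ≤ ∑' j : ℕ, (x + j) ^ (-(3 / 2) : ℝ) := tsum_nonneg fun j => by
    have := hpos j
    positivity
  refine ⟨|a| + ∑' j : ℕ, (x + j) ^ (-(3 / 2) : ℝ), by positivity, fun y => ?_⟩
  rw [ha y]
  have h1 : 1 ≤ Real.sqrt (1 + |y|) := by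
    rw [Real.one_le_sqrt]; linarith [abs_nonneg y]
  have h2 : Real.sqrt |y| ≤ Real.sqrt (1 + |y|) := Real.sqrt_le_sqrt (by linarith)
  have h3 := tsum_of_norm_bounded (hs.mul_left (Real.sqrt |y|)).hasSum
    fun j => norm_inv_sub_inv_le (hpos j) y
  rw [tsum_mul_left] at h3
  calc _ ≤ ‖(a : ℂ)‖ + _ := norm_add_le _ _
    _ ≤ |a| + Real.sqrt |y| * ∑' j : ℕ, (x + j) ^ (-(3 / 2) : ℝ) := by
        rw [Complex.norm_real, Real.norm_eq_abs]; gcongr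
    _ ≤ |a| * Real.sqrt (1 + |y|) + Real.sqrt (1 + |y|) * ∑' j : ℕ, (x + j) ^ (-(3 / 2) : ℝ) := by
        gcongr; exact le_mul_of_one_le_right (abs_nonneg a) h1
    _ = _ := by ring

lemma re_logDeriv_Gamma_line_neg {x : ℝ} (hx : 1 ≤ x) (y : ℝ) :
    (logDeriv Gamma ((x : ℂ) + (-y : ℝ) * I)).re = (logDeriv Gamma ((x : ℂ) + y * I)).re := by
  obtain ⟨a, ha⟩ := Gamma_line hx
  have hpos : ∀ j : ℕ, 0 < x + j := fun j => by positivity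
  have hs : ∀ y : ℝ, Summable fun j : ℕ =>
      (1 / ((x + j : ℝ) : ℂ) - 1 / (((x + j : ℝ) : ℂ) + y * I)) := fun y =>
    Summable.of_norm_bounded ((summable_add_rpow hx).mul_left (Real.sqrt |y|))
      fun j => norm_inv_sub_inv_le (hpos j) y
  rw [ha, ha, add_re, add_re, re_tsum (hs _), re_tsum (hs _)]
  congr 1
  refine tsum_congr fun j => ?_
  simp [Complex.normSq_apply, -ofReal_add]

/-- The odd part of a shifted even function of moderate growth has a primitive of moderate
growth. -/
lemma abs_integral_shift_sub_le {q : ℝ → ℝ} (hq : Continuous q) (he : ∀ t, q (-t) = q t) {C : ℝ}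
    (hC : 0 ≤ C) (hb : ∀ t, |q t| ≤ C * Real.sqrt (1 + |t|)) {l : ℝ} (hl : 0 < l) (v : ℝ) :
    ∃ C', ∀ y, 0 ≤ y →
      |∫ t in (0)..y, (q (l * t + v) - q (l * (-t) + v))| ≤ C' * (1 + y) ^ (1 / 2 : ℝ) := by
  have hi : ∀ a b : ℝ, IntervalIntegrable q volume a b := fun a b => hq.intervalIntegrable a b
  have key : ∀ y, ∫ t in (0)..y, (q (l * t + v) - q (l * (-t) + v)) =
      l⁻¹ * ((∫ t in (l * y - v)..(l * y + v), q t) - ∫ t in (-v)..v, q t) := fun y => by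
    rw [intervalIntegral.integral_sub (Continuous.intervalIntegrable (by fun_prop) _ _)
      (Continuous.intervalIntegrable (by fun_prop) _ _),
      intervalIntegral.integral_comp_mul_add q hl.ne' v]
    have e : ∀ t, q (l * (-t) + v) = q (l * t + (-v)) := fun t => by
      rw [← he]; congr 1; ring
    simp only [e]
    rw [intervalIntegral.integral_comp_mul_add q hl.ne' (-v)]
    simp only [smul_eq_mul, mul_zero, zero_add, ← sub_eq_add_neg]
    rw [← mul_sub]
    congr 1
    rw [zero_sub]
    linarith [intervalIntegral.integral_add_adjacent_intervals (hi (-v) v) (hi v (l * y - v)),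
      intervalIntegral.integral_add_adjacent_intervals (hi v (l * y - v)) (hi _ (l * y + v))]
  refine ⟨l⁻¹ * (C * Real.sqrt (1 + l + |v|) * |2 * v| + |∫ t in (-v)..v, q t|), fun y hy => ?_⟩
  rw [key y, abs_mul, abs_of_pos (inv_pos.2 hl), mul_assoc]
  refine mul_le_mul_of_nonneg_left ?_ (inv_pos.2 hl).le
  rw [add_mul]
  refine (abs_sub _ _).trans (add_le_add ?_ ?_)
  · have hbd : ∀ t ∈ Set.uIoc (l * y - v) (l * y + v),
        ‖q t‖ ≤ C * Real.sqrt (1 + l + |v|) * (1 + y) ^ (1 / 2 : ℝ) := fun t ht => by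
      have ht' : |t| ≤ l * y + |v| := by
        have h1 := Set.uIoc_subset_uIcc ht
        have hly : 0 ≤ l * y := by positivity
        rcases Set.mem_uIcc.1 h1 with ⟨h2, h3⟩ | ⟨h2, h3⟩ <;>
        · rw [abs_le]; constructor <;> linarith [le_abs_self v, neg_abs_le v]
      rw [← Real.sqrt_eq_rpow, mul_assoc, ← Real.sqrt_mul (by positivity)]
      refine (hb t).trans ?_
      gcongr
      nlinarith [abs_nonneg v, mul_nonneg (abs_nonneg v) hy, abs_nonneg t]
    have := intervalIntegral.norm_integral_le_of_norm_le_const hbd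
    rw [Real.norm_eq_abs] at this
    refine this.trans (le_of_eq ?_)
    rw [show l * y + v - (l * y - v) = 2 * v by ring]
    ring
  · exact le_mul_of_one_le_right (abs_nonneg _) (Real.one_le_rpow (by linarith) (by norm_num))

lemma norm_Gamma_le_Gamma_re {z : ℂ} (hz : 0 < z.re) : ‖Gamma z‖ ≤ Real.Gamma z.re := by
  rw [Gamma_eq_integral hz, Real.Gamma_eq_integral hz, GammaIntegral]
  refine (norm_integral_le_integral_norm _).trans (le_of_eq ?_)
  refine setIntegral_congr_fun measurableSet_Ioi fun x hx => ?_
  have hx' : 0 < x := hx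
  simp only [norm_mul, Complex.norm_cpow_eq_rpow_re_of_pos hx', sub_re, one_re]
  rw [Complex.norm_real, Real.norm_of_nonneg (Real.exp_pos _).le]

lemma Real_Gamma_le_exp {x : ℝ} (hx : 1 ≤ x) :
    Real.Gamma x ≤ Real.exp (32 * (1 + x) ^ (33 / 32 : ℝ)) := by
  have hx0 : 0 < x := by linarith
  have h1 : Real.Gamma x ≤ Real.Gamma (x + 1) := by
    rw [Real.Gamma_add_one hx0.ne']
    exact le_mul_of_one_le_left (Real.Gamma_pos_of_pos hx0).le hx
  have h2 : Real.Gamma (x + 1) ≤ Real.Gamma (⌈x⌉₊ + 1) := by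
    refine Real.Gamma_strictMonoOn_Ici.monotoneOn ?_ ?_ ?_
    · simp; linarith
    · have := Nat.le_ceil x
      simp only [Set.mem_Ici]; linarith
    · linarith [Nat.le_ceil x]
  have hn : 0 < ⌈x⌉₊ := Nat.ceil_pos.2 hx0
  have hn' : (0 : ℝ) < ⌈x⌉₊ := by exact_mod_cast hn
  have h3 : ((⌈x⌉₊).factorial : ℝ) ≤ (⌈x⌉₊ : ℝ) ^ ⌈x⌉₊ := by exact_mod_cast Nat.factorial_le_pow _
  have h4 : (⌈x⌉₊ : ℝ) ^ ⌈x⌉₊ = Real.exp (⌈x⌉₊ * Real.log ⌈x⌉₊) := by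
    rw [Real.exp_nat_mul, Real.exp_log hn']
  have h5 : (⌈x⌉₊ : ℝ) ≤ 1 + x := by linarith [Nat.ceil_lt_add_one hx0.le]
  rw [Real.Gamma_nat_eq_factorial] at h2
  refine (h1.trans (h2.trans h3)).trans ?_
  rw [h4]
  refine Real.exp_le_exp.2 ?_
  have h6 := Real.log_le_rpow_div hn'.le (by norm_num : (0 : ℝ) < 1 / 32)
  calc (⌈x⌉₊ : ℝ) * Real.log ⌈x⌉₊ ≤ ⌈x⌉₊ * ((⌈x⌉₊ : ℝ) ^ (1 / 32 : ℝ) / (1 / 32)) := by gcongr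
    _ = 32 * ((⌈x⌉₊ : ℝ) ^ (1 : ℝ) * (⌈x⌉₊ : ℝ) ^ (1 / 32 : ℝ)) := by rw [Real.rpow_one]; ring
    _ = 32 * (⌈x⌉₊ : ℝ) ^ (33 / 32 : ℝ) := by rw [← Real.rpow_add hn']; norm_num
    _ ≤ _ := by gcongr

lemma norm_Gamma_le_norm_Gamma_add {z : ℂ} (hz : 1 ≤ |z.im|) (n : ℕ) :
    ‖Gamma z‖ ≤ ‖Gamma (z + n)‖ := by
  induction n with
  | zero => simp
  | succ n ih =>
    refine ih.trans ?_
    have him : (z + n).im = z.im := by simp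
    have h1 : 1 ≤ ‖z + n‖ := by
      rw [← him] at hz
      exact hz.trans (abs_im_le_norm _)
    have hne : z + n ≠ 0 := norm_pos_iff.1 (by linarith)
    rw [Nat.cast_succ, ← add_assoc, Gamma_add_one _ hne, norm_mul]
    exact le_mul_of_one_le_left (norm_nonneg _) h1

lemma exists_norm_Gamma_le (x₀ x₁ : ℝ) : ∃ C, ∀ z : ℂ, x₀ ≤ z.re → z.re ≤ x₁ → 1 ≤ |z.im| →
    ‖Gamma z‖ ≤ C := by
  obtain ⟨n, hn⟩ := exists_nat_ge (1 - x₀)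
  refine ⟨Real.exp (32 * (1 + (x₁ + n)) ^ (33 / 32 : ℝ)), fun z h0 h1 h2 => ?_⟩
  have hre : (z + n).re = z.re + n := by simp
  have h3 : 1 ≤ (z + n).re := by rw [hre]; linarith
  refine (norm_Gamma_le_norm_Gamma_add h2 n).trans
    ((norm_Gamma_le_Gamma_re (by linarith)).trans ((Real_Gamma_le_exp h3).trans ?_))
  rw [hre] at h3 ⊢
  gcongr

/-- `f` is bounded on `U` by `exp (C * W)` for some constant `C`. -/
def GrowthOn (W : ℂ → ℝ) (U : Set ℂ) (f : ℂ → ℂ) : Prop :=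
  ∃ C, 0 ≤ C ∧ ∀ s ∈ U, ‖f s‖ ≤ Real.exp (C * W s)

namespace GrowthOn

variable {W W' : ℂ → ℝ} {U V : Set ℂ} {f g : ℂ → ℂ}

lemma mul (hf : GrowthOn W U f) (hg : GrowthOn W U g) : GrowthOn W U fun s => f s * g s := by
  obtain ⟨C, hC, hf⟩ := hf
  obtain ⟨D, hD, hg⟩ := hg
  refine ⟨C + D, by positivity, fun s hs => ?_⟩
  rw [norm_mul, add_mul, Real.exp_add]
  exact mul_le_mul (hf s hs) (hg s hs) (norm_nonneg _) (Real.exp_pos _).le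

lemma one : GrowthOn W U fun _ => 1 := ⟨0, le_rfl, fun s _ => by simp⟩

lemma pow (hf : GrowthOn W U f) (n : ℕ) : GrowthOn W U fun s => f s ^ n := by
  induction n with
  | zero => simpa using one
  | succ n ih => simpa [pow_succ] using ih.mul hf

lemma prod {ι : Type*} {f : ι → ℂ → ℂ} (t : Finset ι) (hf : ∀ i, GrowthOn W U (f i)) :
    GrowthOn W U fun s => ∏ i ∈ t, f i s := by
  classical
  induction t using Finset.induction_on with
  | empty => simpa using one
  | insert i t hi ih => simpa [Finset.prod_insert hi] using (hf i).mul ih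

lemma congr (hf : GrowthOn W U f) (h : ∀ s ∈ U, g s = f s) : GrowthOn W U g := by
  obtain ⟨C, hC, hf⟩ := hf
  exact ⟨C, hC, fun s hs => by rw [h s hs]; exact hf s hs⟩

lemma mono_set (hf : GrowthOn W U f) (h : V ⊆ U) : GrowthOn W V f := by
  obtain ⟨C, hC, hf⟩ := hf
  exact ⟨C, hC, fun s hs => hf s (h hs)⟩

lemma union (hf : GrowthOn W U f) (hg : GrowthOn W V f) (hW : ∀ s, 0 ≤ W s) :
    GrowthOn W (U ∪ V) f := by
  obtain ⟨C, hC, hf⟩ := hf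
  obtain ⟨D, hD, hg⟩ := hg
  refine ⟨C + D, by positivity, fun s hs => ?_⟩
  rcases hs with hs | hs
  · refine (hf s hs).trans (Real.exp_le_exp.2 ?_)
    nlinarith [hW s, mul_nonneg hD (hW s)]
  · refine (hg s hs).trans (Real.exp_le_exp.2 ?_)
    nlinarith [hW s, mul_nonneg hC (hW s)]

lemma mono_weight (hf : GrowthOn W U f) {K : ℝ} (hK : 0 ≤ K) (h : ∀ s, W s ≤ K * W' s) :
    GrowthOn W' U f := by
  obtain ⟨C, hC, hf⟩ := hf
  refine ⟨C * K, by positivity, fun s hs => (hf s hs).trans (Real.exp_le_exp.2 ?_)⟩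
  rw [mul_assoc]
  exact mul_le_mul_of_nonneg_left (h s) hC

end GrowthOn

/-- The weight describing polynomial growth. -/
def logWeight (s : ℂ) : ℝ := Real.log (2 + ‖s‖)

/-- The weight describing exponential growth of order `33 / 32`. -/
def powWeight (s : ℂ) : ℝ := (1 + ‖s‖) ^ (33 / 32 : ℝ)

lemma one_add_norm_le_powWeight (s : ℂ) : 1 + ‖s‖ ≤ powWeight s := by
  conv_lhs => rw [← Real.rpow_one (1 + ‖s‖)]
  exact Real.rpow_le_rpow_of_exponent_le (by linarith [norm_nonneg s]) (by norm_num)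

lemma log_two_le_logWeight (s : ℂ) : Real.log 2 ≤ logWeight s :=
  Real.log_le_log (by norm_num) (by linarith [norm_nonneg s])

lemma logWeight_nonneg (s : ℂ) : 0 ≤ logWeight s :=
  (Real.log_pos one_lt_two).le.trans (log_two_le_logWeight s)

lemma logWeight_le_powWeight (s : ℂ) : logWeight s ≤ powWeight s := by
  refine le_trans ?_ (one_add_norm_le_powWeight s)
  have := Real.log_le_sub_one_of_pos (by positivity : 0 < 2 + ‖s‖)
  unfold logWeight
  linarith

lemma exp_logWeight (s : ℂ) : Real.exp (logWeight s) = 2 + ‖s‖ :=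
  Real.exp_log (by positivity)

lemma growthOn_logWeight_of_bdd {U : Set ℂ} {f : ℂ → ℂ} (h : ∃ C, ∀ s ∈ U, ‖f s‖ ≤ C) :
    GrowthOn logWeight U f := by
  obtain ⟨C, hC⟩ := h
  have h2 := Real.log_pos one_lt_two
  refine ⟨|C| / Real.log 2, by positivity, fun s hs => (hC s hs).trans ?_⟩
  calc C ≤ |C| := le_abs_self C
    _ ≤ Real.exp (|C| / Real.log 2 * Real.log 2) := by
        rw [div_mul_cancel₀ _ h2.ne']
        linarith [Real.add_one_le_exp |C|]
    _ ≤ _ := by gcongr; exact log_two_le_logWeight s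

lemma growthOn_logWeight_affine (U : Set ℂ) {g : ℂ → ℂ} {K : ℝ} (hK : ∀ s, ‖g s‖ ≤ K + ‖s‖) :
    GrowthOn logWeight U g := by
  obtain ⟨C, hC, h⟩ := growthOn_logWeight_of_bdd (U := U) (f := fun _ => ((1 + |K| : ℝ) : ℂ))
    ⟨_, fun _ _ => le_rfl⟩
  refine ⟨C + 1, by positivity, fun s hs => ?_⟩
  have h1 := h s hs
  rw [Complex.norm_real, Real.norm_of_nonneg (by positivity)] at h1
  rw [add_mul, Real.exp_add, one_mul, exp_logWeight]
  calc ‖g s‖ ≤ K + ‖s‖ := hK s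
    _ ≤ (1 + |K|) * (2 + ‖s‖) := by
      nlinarith [le_abs_self K, abs_nonneg K, norm_nonneg s, mul_nonneg (abs_nonneg K)
          (norm_nonneg s)]
    _ ≤ _ := by gcongr

lemma norm_le_exp_exp_of_strip {f : ℂ → ℂ} {α β Y K : ℝ} {B : ℕ} (hK : 0 ≤ K)
    (hf : ∀ s : ℂ, α ≤ s.re → s.re ≤ β → Y ≤ |s.im| → ‖f s‖ ≤ Real.exp (K * (1 + ‖s‖) ^ B))
    {c : ℝ} (hc : 0 < c) : ∃ D, f =O[comap (abs ∘ im) atTop ⊓ 𝓟 (re ⁻¹' Set.Ioo α β)]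
      fun z => Real.exp (D * Real.exp (c * |z.im|)) := by
  set K₁ := 1 + (|α| + |β|) with hK₁
  refine ⟨K * Real.exp (c * K₁), Asymptotics.IsBigO.of_bound 1 ?_⟩
  have h1 := (isLittleO_pow_exp_pos_mul_atTop B hc).bound one_pos
  have h2 : ∀ᶠ y : ℝ in atTop, (K₁ + y) ^ B ≤ Real.exp (c * (K₁ + y)) := by
    filter_upwards [(tendsto_atTop_add_const_left atTop K₁ tendsto_id).eventually h1] with y hy
    have := (le_abs_self _).trans hy
    simpa using this
  have h3 := (h2.and (eventually_ge_atTop Y)).comap (abs ∘ im : ℂ → ℝ)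
  filter_upwards [h3.filter_mono inf_le_left, mem_inf_of_right (mem_principal_self _)] with s hs hs'
  obtain ⟨hs1, hs2⟩ := hs
  simp only [Function.comp_apply] at hs1 hs2
  obtain ⟨ha, hb⟩ : α < s.re ∧ s.re < β := hs'
  have hn : 1 + ‖s‖ ≤ K₁ + |s.im| := by
    have hre : |s.re| ≤ |α| + |β| := by
      rw [abs_le]
      constructor <;> linarith [neg_abs_le α, le_abs_self β, abs_nonneg α, abs_nonneg β]
    linarith [Complex.norm_le_abs_re_add_abs_im s]
  rw [one_mul, Real.norm_of_nonneg (Real.exp_pos _).le]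
  refine (hf s ha.le hb.le hs2).trans (Real.exp_le_exp.2 ?_)
  rw [mul_assoc, ← Real.exp_add, ← mul_add]
  refine mul_le_mul_of_nonneg_left (le_trans ?_ hs1) hK
  gcongr

/-- Phragmén–Lindelöf: polynomial growth on the edges of a strip propagates to the strip. -/
lemma growthOn_strip {f : ℂ → ℂ} (hfd : Differentiable ℂ f) {α β Y K : ℝ} (hαβ : α < β) {B : ℕ}
    (hK : 0 ≤ K)
    (hf : ∀ s : ℂ, α ≤ s.re → s.re ≤ β → Y ≤ |s.im| → ‖f s‖ ≤ Real.exp (K * (1 + ‖s‖) ^ B))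
    (hα : GrowthOn logWeight {s | s.re = α} f) (hβ : GrowthOn logWeight {s | s.re = β} f) :
    GrowthOn logWeight {s | α ≤ s.re ∧ s.re ≤ β} f := by
  obtain ⟨C₁, hC₁, h₁⟩ := hα
  obtain ⟨C₂, hC₂, h₂⟩ := hβ
  obtain ⟨A, hA⟩ := exists_nat_ge (C₁ + C₂)
  set w : ℂ := ((β + 1 : ℝ) : ℂ) with hw
  have hsw : ∀ s : ℂ, s.re ≤ β → 1 ≤ ‖s - w‖ := fun s hs => by
    refine le_trans ?_ (abs_re_le_norm _)
    rw [sub_re, hw, ofReal_re, abs_of_neg (by linarith)]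
    linarith
  have hne : ∀ s : ℂ, s.re ≤ β → (s - w) ^ A ≠ 0 := fun s hs =>
    pow_ne_zero _ (norm_pos_iff.1 (by linarith [hsw s hs]))
  have hcmp : ∀ s : ℂ, s.re ≤ β → 2 + ‖s‖ ≤ (3 + ‖w‖) * ‖s - w‖ := fun s hs => by
    have h3 : ‖s‖ ≤ ‖s - w‖ + ‖w‖ := by simpa using norm_add_le (s - w) w
    nlinarith [hsw s hs, norm_nonneg w, mul_le_mul_of_nonneg_left (hsw s hs) (norm_nonneg w)]
  have hexp : ∀ (s : ℂ) (C : ℝ), C ≤ A → Real.exp (C * logWeight s) ≤ (2 + ‖s‖) ^ A :=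
    fun s C hC => by
      rw [← exp_logWeight s, ← Real.exp_nat_mul]
      exact Real.exp_le_exp.2 (mul_le_mul_of_nonneg_right hC (logWeight_nonneg s))
  have hline : ∀ s : ℂ, s.re ≤ β → ‖f s‖ ≤ (2 + ‖s‖) ^ A →
      ‖f s / (s - w) ^ A‖ ≤ (3 + ‖w‖) ^ A := fun s hs hfs => by
    rw [norm_div, norm_pow, div_le_iff₀ (pow_pos (by linarith [hsw s hs]) _), ← mul_pow]
    exact hfs.trans (pow_le_pow_left₀ (by positivity) (hcmp s hs) _)
  have hcl : closure (re ⁻¹' Set.Ioo α β) ⊆ {s : ℂ | s.re ≤ β} :=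
    closure_minimal (fun s hs => hs.2.le) (isClosed_le continuous_re continuous_const)
  have hd : DiffContOnCl ℂ (fun s => f s / (s - w) ^ A) (re ⁻¹' Set.Ioo α β) := by
    refine DifferentiableOn.diffContOnCl fun s hs => DifferentiableAt.differentiableWithinAt ?_
    exact hfd.differentiableAt.fun_div (by fun_prop) (hne s (hcl hs))
  have hc : 0 < Real.pi / (2 * (β - α)) := by have := Real.pi_pos; have := sub_pos.2 hαβ; positivity
  have hc' : Real.pi / (2 * (β - α)) < Real.pi / (β - α) := by
    have := sub_pos.2 hαβ
    exact div_lt_div_of_pos_left Real.pi_pos this (by linarith)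
  have hf' : ∀ s : ℂ, α ≤ s.re → s.re ≤ β → Y ≤ |s.im| →
      ‖f s / (s - w) ^ A‖ ≤ Real.exp (K * (1 + ‖s‖) ^ B) := fun s h1 h2 h3 => by
    refine le_trans ?_ (hf s h1 h2 h3)
    rw [norm_div, norm_pow]
    exact div_le_self (norm_nonneg _) (one_le_pow₀ (hsw s h2))
  have key : ∀ s : ℂ, α ≤ s.re → s.re ≤ β → ‖f s / (s - w) ^ A‖ ≤ (3 + ‖w‖) ^ A := fun s h1 h2 =>
    PhragmenLindelof.vertical_strip (f := fun s => f s / (s - w) ^ A) hd ⟨_, hc',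
        norm_le_exp_exp_of_strip hK hf' hc⟩
      (fun z hz => hline z (by linarith) ((h₁ z hz).trans (hexp z _ (by linarith))))
      (fun z hz => hline z (by linarith) ((h₂ z hz).trans (hexp z _ (by linarith)))) h1 h2
  have hg : GrowthOn logWeight {s | α ≤ s.re ∧ s.re ≤ β}
      fun s => (f s / (s - w) ^ A) * (s - w) ^ A :=
    (growthOn_logWeight_of_bdd ⟨_, fun s hs => key s hs.1 hs.2⟩).mul
      ((growthOn_logWeight_affine _ (K := ‖w‖) fun s => by
        rw [add_comm]; exact norm_sub_le s w).pow A)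
  exact hg.congr fun s hs => (div_mul_cancel₀ _ (hne s hs.2)).symm

lemma norm_mul_natCast_cpow_neg_le (d : ℂ) {ν : ℕ} (hν : 0 < ν) {x : ℝ} {s : ℂ} (h : x ≤ s.re) :
    ‖d * (ν : ℂ) ^ (-s)‖ ≤ ‖d * (ν : ℂ) ^ (-(x : ℂ))‖ := by
  rw [norm_mul, norm_mul, Complex.norm_natCast_cpow_of_pos hν, Complex.norm_natCast_cpow_of_pos hν]
  refine mul_le_mul_of_nonneg_left ?_ (norm_nonneg _)
  refine Real.rpow_le_rpow_of_exponent_le (by exact_mod_cast hν) ?_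
  simpa using h

namespace SSF

variable {σ0 σ1 : ℝ} (S : SSF σ0 σ1)

lemma exists_norm_F_le {b : ℝ} (hb : σ0 < b) : ∃ C, ∀ s : ℂ, b ≤ s.re → ‖S.F s‖ ≤ C := by
  refine ⟨∑' n : ℕ, ‖S.a (n + 1) * ((n + 1 : ℕ) : ℂ) ^ (-(b : ℂ))‖, fun s hs => ?_⟩
  rw [← (S.hDir s (by linarith)).tsum_eq]
  exact tsum_of_norm_bounded (S.hDirAbs (b : ℂ) (by simpa using hb)).hasSum
    fun n => norm_mul_natCast_cpow_neg_le _ n.succ_pos hs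

lemma differentiableAt_F {s : ℂ} (hs : σ0 < s.re) : DifferentiableAt ℂ S.F s := by
  obtain ⟨x, hx, hxs⟩ := exists_between hs
  have ho : IsOpen {z : ℂ | x < z.re} := isOpen_lt continuous_const continuous_re
  have hd : DifferentiableOn ℂ (fun s => ∑' n : ℕ, S.a (n + 1) * ((n + 1 : ℕ) : ℂ) ^ (-s))
      {z : ℂ | x < z.re} := by
    refine differentiableOn_tsum_of_summable_norm (S.hDirAbs (x : ℂ) (by simpa using hx))
      (fun n => Differentiable.differentiableOn ?_) ho
      fun n w hw => norm_mul_natCast_cpow_neg_le _ n.succ_pos (le_of_lt hw)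
    have : ((n + 1 : ℕ) : ℂ) ≠ 0 := by exact_mod_cast n.succ_ne_zero
    exact fun z => ((differentiableAt_id.neg).const_cpow (Or.inl this)).const_mul _
  refine ((hd s hxs).differentiableAt (ho.mem_nhds hxs)).congr_of_eventuallyEq ?_
  filter_upwards [ho.mem_nhds hxs] with z hz
  exact (S.hDir z (hx.trans hz)).tsum_eq.symm

lemma exists_norm_logDeriv_F_le {b : ℝ} (hb : σ0 < b) :
    ∃ C, 0 ≤ C ∧ ∀ s : ℂ, b ≤ s.re → ‖logDeriv S.F s‖ ≤ C := by
  refine ⟨∑' n : ℕ, ‖S.c (n + 2) * ((n + 2 : ℕ) : ℂ) ^ (-(b : ℂ))‖,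
    tsum_nonneg fun n => norm_nonneg _, fun s hs => ?_⟩
  rw [logDeriv_apply, ← norm_neg, ← (S.hEuler s (by linarith)).tsum_eq]
  exact tsum_of_norm_bounded (S.hEulerAbs (b : ℂ) (by simpa using hb)).hasSum
    fun n => norm_mul_natCast_cpow_neg_le _ (by omega) hs

lemma F_eq_zero_of_zero {b : ℝ} (hb : σ0 < b) {w : ℂ} (hw : b < w.re) (hFw : S.F w = 0) {s : ℂ}
    (hs : b < s.re) : S.F s = 0 := by
  obtain ⟨C, hC, hbd⟩ := S.exists_norm_logDeriv_F_le hb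
  have ho : IsOpen {z : ℂ | b < z.re} := isOpen_lt continuous_const continuous_re
  have hdo : DifferentiableOn ℂ S.F {z : ℂ | b < z.re} := fun z hz =>
    (S.differentiableAt_F (hb.trans hz)).differentiableWithinAt
  have hne : ∀ z : ℂ, b < z.re → S.F z ≠ 0 → ‖deriv S.F z‖ ≤ C * ‖S.F z‖ := fun z hz hF => by
    have h := hbd z hz.le
    rwa [logDeriv_apply, norm_div, div_le_iff₀ (norm_pos_iff.2 hF)] at h
  have hall : ∀ z : ℂ, b < z.re → ‖deriv S.F z‖ ≤ C * ‖S.F z‖ := fun z hz => by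
    rcases (hdo.analyticAt (ho.mem_nhds hz)).eventually_eq_zero_or_eventually_ne_zero with h | h
    · have h' : S.F =ᶠ[nhds z] fun _ => 0 := h
      rw [h'.deriv_eq, h'.eq_of_nhds]
      simp
    · have hcd : ContinuousAt (deriv S.F) z :=
        ((hdo.deriv ho).differentiableAt (ho.mem_nhds hz)).continuousAt
      have hcF : ContinuousAt S.F z := (S.differentiableAt_F (hb.trans hz)).continuousAt
      refine le_of_tendsto_of_tendsto (b := nhdsWithin z {z}ᶜ)
        (hcd.norm.tendsto.mono_left nhdsWithin_le_nhds)
        ((hcF.norm.const_mul C).tendsto.mono_left nhdsWithin_le_nhds) ?_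
      filter_upwards [h, nhdsWithin_le_nhds (ho.mem_nhds hz)] with u hu hu'
      exact hne u hu' hu
  have hline : ∀ t ∈ Set.Icc (0 : ℝ) 1, b < (w + t * (s - w)).re := fun t ht => by
    have e : (w + t * (s - w)).re = (1 - t) * w.re + t * s.re := by simp; ring
    rw [e]
    rcases eq_or_lt_of_le ht.1 with h | h
    · rw [← h]; linarith
    · nlinarith [ht.2, mul_pos h (sub_pos.2 hs), mul_nonneg (sub_nonneg.2 ht.2) (sub_pos.2 hw).le]
  have hd : ∀ t ∈ Set.Icc (0 : ℝ) 1, HasDerivAt (fun t : ℝ => S.F (w + t * (s - w)))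
      (deriv S.F (w + t * (s - w)) * (s - w)) t := fun t ht => by
    have h1 : HasDerivAt (fun t : ℝ => w + t * (s - w)) (s - w) t := by
      simpa using ((hasDerivAt_id t).ofReal_comp.mul_const (s - w)).const_add w
    exact (S.differentiableAt_F (hb.trans (hline t ht))).hasDerivAt.comp_of_eq t h1 rfl
  have h := eq_zero_of_abs_deriv_le_mul_abs_self_of_eq_zero_right (K := C * ‖s - w‖)
    (fun t ht => (hd t ht).continuousAt.continuousWithinAt)
    (fun t ht => (hd t (Set.Ico_subset_Icc_self ht)).hasDerivWithinAt) (by simpa using hFw)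
    (fun t ht => by
      rw [norm_mul, mul_right_comm]
      exact mul_le_mul_of_nonneg_right (hall _ (hline t (Set.Ico_subset_Icc_self ht)))
        (norm_nonneg _)) 1 (by simp)
  simpa using h

lemma continuous_logDeriv_F_line {b : ℝ} (hb : σ0 < b) :
    Continuous fun y : ℝ => logDeriv S.F ((b : ℂ) + y * I) := by
  have hre : ∀ y : ℝ, ((b : ℂ) + y * I).re = b := fun y => by simp
  have e : (fun y : ℝ => logDeriv S.F ((b : ℂ) + y * I)) = fun y : ℝ =>
      -∑' n : ℕ, S.c (n + 2) * ((n + 2 : ℕ) : ℂ) ^ (-((b : ℂ) + y * I)) := by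
    ext y
    rw [(S.hEuler _ (by rwa [hre])).tsum_eq, neg_neg, logDeriv_apply]
  rw [e]
  refine (continuous_tsum (fun n => ?_) (S.hEulerAbs (b : ℂ) (by simpa using hb))
    fun n y => norm_mul_natCast_cpow_neg_le _ (by omega) (hre y).ge).neg
  have : ((n + 2 : ℕ) : ℂ) ≠ 0 := by exact_mod_cast (by omega : n + 2 ≠ 0)
  exact continuous_const.mul (Continuous.const_cpow (by fun_prop) (Or.inl this))

lemma exists_primitive_logDeriv_F_line {b : ℝ} (hb : σ0 < b) : ∃ (h : ℝ → ℂ) (K : ℝ),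
    (∀ y : ℝ, HasDerivAt h (logDeriv S.F ((b : ℂ) + y * I)) y) ∧ ∀ y, ‖h y‖ ≤ K := by
  have hre : ∀ y : ℝ, ((b : ℂ) + y * I).re = b := fun y => by simp
  have hs := S.hEulerAbs (b : ℂ) (by simpa using hb)
  set g' : ℕ → ℝ → ℂ := fun n y => S.c (n + 2) * ((n + 2 : ℕ) : ℂ) ^ (-((b : ℂ) + y * I)) with hg'
  set g : ℕ → ℝ → ℂ := fun n y => I / Real.log (n + 2 : ℕ) * g' n y with hg
  have hl : ∀ n : ℕ, Real.log 2 ≤ Real.log (n + 2 : ℕ) := fun n =>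
    Real.log_le_log (by norm_num) (by push_cast; linarith [(Nat.cast_nonneg n : (0 : ℝ) ≤ n)])
  have h2 := Real.log_pos one_lt_two
  have hd : ∀ n y, HasDerivAt (g n) (g' n y) y := fun n y => by
    have hn : ((n + 2 : ℕ) : ℂ) ≠ 0 := by exact_mod_cast (by omega : n + 2 ≠ 0)
    have hlog : (Real.log (n + 2 : ℕ) : ℂ) ≠ 0 := by
      exact_mod_cast (h2.trans_le (hl n)).ne'
    have h1 := (((hasDerivAt_id ((b : ℂ) + y * I)).neg.const_cpow (Or.inl hn)).comp_of_eq y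
      (hasDerivAt_ofReal_mul_I (b : ℂ) y) rfl).const_mul (S.c (n + 2))
    refine HasDerivAt.congr_deriv (h1.const_mul (I / Real.log (n + 2 : ℕ))) ?_
    rw [← natCast_log]
    simp only [hg', Pi.neg_apply, id]
    field_simp
    rw [I_sq]
    ring
  have hbd : ∀ n y, ‖g' n y‖ ≤ ‖S.c (n + 2) * ((n + 2 : ℕ) : ℂ) ^ (-(b : ℂ))‖ := fun n y =>
    norm_mul_natCast_cpow_neg_le _ (by omega) (hre y).ge
  have hgb : ∀ n y, ‖g n y‖ ≤
      1 / Real.log 2 * ‖S.c (n + 2) * ((n + 2 : ℕ) : ℂ) ^ (-(b : ℂ))‖ := fun n y => by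
    simp only [hg]
    rw [norm_mul, norm_div, Complex.norm_I, Complex.norm_real,
      Real.norm_of_nonneg (h2.le.trans (hl n))]
    have := hl n
    gcongr
    exact hbd n y
  refine ⟨fun y => -∑' n, g n y,
    ∑' n : ℕ, 1 / Real.log 2 * ‖S.c (n + 2) * ((n + 2 : ℕ) : ℂ) ^ (-(b : ℂ))‖,
    fun y => ?_, fun y => ?_⟩
  · have h := (hasDerivAt_tsum hs hd hbd (y₀ := 0)
      (Summable.of_norm_bounded (hs.mul_left _) fun n => hgb n 0) y).neg
    refine HasDerivAt.congr_deriv h ?_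
    rw [(S.hEuler _ (by rwa [hre])).tsum_eq, neg_neg, logDeriv_apply]
  · rw [norm_neg]
    exact tsum_of_norm_bounded (hs.mul_left _).hasSum fun n => hgb n y

end SSF

/-- A continuous function of growth at most `√|y|` whose odd part has a primitive with the same
growth. -/
structure Moderate (R : ℝ → ℝ) : Prop where
  continuous : Continuous R
  bound : ∃ B, ∀ y, |R y| ≤ B * (1 + |y|) ^ (1 / 2 : ℝ)
  primitive : ∃ C, ∀ y, 0 ≤ y → |∫ t in (0)..y, (R t - R (-t))| ≤ C * (1 + y) ^ (1 / 2 : ℝ)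

namespace Moderate

variable {R R' : ℝ → ℝ}

lemma const (c : ℝ) : Moderate fun _ => c where
  continuous := continuous_const
  bound := ⟨|c|, fun y => le_mul_of_one_le_right (abs_nonneg c)
    (Real.one_le_rpow (by linarith [abs_nonneg y]) (by norm_num))⟩
  primitive := ⟨0, fun y _ => by simp⟩

lemma add (h : Moderate R) (h' : Moderate R') : Moderate fun y => R y + R' y where
  continuous := h.continuous.add h'.continuous
  bound := by
    obtain ⟨B, hB⟩ := h.bound
    obtain ⟨B', hB'⟩ := h'.bound
    exact ⟨B + B', fun y => by
      rw [add_mul]; exact (abs_add_le _ _).trans (add_le_add (hB y) (hB' y))⟩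
  primitive := by
    obtain ⟨C, hC⟩ := h.primitive
    obtain ⟨C', hC'⟩ := h'.primitive
    refine ⟨C + C', fun y hy => ?_⟩
    have hc := h.continuous
    have hc' := h'.continuous
    have e : ∫ t in (0)..y, (R t + R' t - (R (-t) + R' (-t))) =
        (∫ t in (0)..y, (R t - R (-t))) + ∫ t in (0)..y, (R' t - R' (-t)) := by
      rw [← intervalIntegral.integral_add (Continuous.intervalIntegrable (by fun_prop) _ _)
        (Continuous.intervalIntegrable (by fun_prop) _ _)]
      exact intervalIntegral.integral_congr fun t _ => by ring
    rw [e, add_mul]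
    exact (abs_add_le _ _).trans (add_le_add (hC y hy) (hC' y hy))

lemma const_mul (h : Moderate R) (c : ℝ) : Moderate fun y => c * R y where
  continuous := h.continuous.const_mul c
  bound := by
    obtain ⟨B, hB⟩ := h.bound
    exact ⟨|c| * B, fun y => by
      rw [abs_mul, mul_assoc]; exact mul_le_mul_of_nonneg_left (hB y) (abs_nonneg c)⟩
  primitive := by
    obtain ⟨C, hC⟩ := h.primitive
    refine ⟨|c| * C, fun y hy => ?_⟩
    simp only [← mul_sub]
    rw [intervalIntegral.integral_const_mul, abs_mul, mul_assoc]
    exact mul_le_mul_of_nonneg_left (hC y hy) (abs_nonneg c)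

lemma sum {ι : Type*} {R : ι → ℝ → ℝ} (t : Finset ι) (h : ∀ i, Moderate (R i)) :
    Moderate fun y => ∑ i ∈ t, R i y := by
  classical
  induction t using Finset.induction_on with
  | empty => simpa using const 0
  | insert i t hi ih => simpa [Finset.sum_insert hi] using (h i).add ih

lemma of_primitive (hR : Continuous R) {B : ℝ} (hB : ∀ y, |R y| ≤ B) {H : ℝ → ℝ} {K : ℝ}
    (hH : ∀ y, HasDerivAt H (R y) y) (hK : ∀ y, |H y| ≤ K) : Moderate R where
  continuous := hR
  bound := ⟨B, fun y => (hB y).trans (le_mul_of_one_le_right ((abs_nonneg _).trans (hB 0))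
    (Real.one_le_rpow (by linarith [abs_nonneg y]) (by norm_num)))⟩
  primitive := by
    refine ⟨4 * K, fun y hy => ?_⟩
    have hK0 : 0 ≤ K := (abs_nonneg _).trans (hK 0)
    have e1 : ∀ a b : ℝ, ∫ t in a..b, R t = H b - H a := fun a b =>
      intervalIntegral.integral_eq_sub_of_hasDerivAt (fun t _ => hH t) (hR.intervalIntegrable _ _)
    rw [intervalIntegral.integral_sub (hR.intervalIntegrable _ _)
      (Continuous.intervalIntegrable (by fun_prop) _ _), intervalIntegral.integral_comp_neg, e1, e1]
    refine le_trans ?_ (le_mul_of_one_le_right (by positivity)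
      (Real.one_le_rpow (by linarith) (by norm_num)))
    simp only [neg_zero]
    have h1 := abs_le.1 (hK 0)
    have h2 := abs_le.1 (hK y)
    have h3 := abs_le.1 (hK (-y))
    rw [abs_le]
    constructor <;> linarith [h1.1, h1.2, h2.1, h2.2, h3.1, h3.2]

lemma re_logDeriv_Gamma {x l : ℝ} (hx : 1 ≤ x) (hl : 0 < l) (v : ℝ) :
    Moderate fun y => (logDeriv Gamma ((x : ℂ) + (l * y + v : ℝ) * I)).re := by
  have hc := continuous_re.comp (continuous_logDeriv_Gamma_line hx)
  obtain ⟨C, hC, hb⟩ := norm_logDeriv_Gamma_line_le hx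
  have hb' : ∀ y : ℝ, |(logDeriv Gamma ((x : ℂ) + y * I)).re| ≤ C * Real.sqrt (1 + |y|) := fun y =>
    (abs_re_le_norm _).trans (hb y)
  refine ⟨hc.comp (by fun_prop : Continuous fun y : ℝ => l * y + v),
    ⟨C * Real.sqrt (1 + l + |v|), fun y => ?_⟩,
    abs_integral_shift_sub_le hc (re_logDeriv_Gamma_line_neg hx) hC hb' hl v⟩
  refine (hb' _).trans ?_
  rw [← Real.sqrt_eq_rpow, mul_assoc, ← Real.sqrt_mul (by positivity)]
  gcongr
  have h1 : |l * y + v| ≤ l * |y| + |v| := by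
    refine (abs_add_le _ _).trans ?_
    rw [abs_mul, abs_of_pos hl]
  nlinarith [abs_nonneg v, mul_nonneg (abs_nonneg v) (abs_nonneg y), abs_nonneg y]

lemma re_one_div {b : ℝ} {w : ℂ} (hw : w.re < b) :
    Moderate fun y : ℝ => (1 / ((b : ℂ) + y * I - w)).re := by
  have hre : ∀ y : ℝ, ((b : ℂ) + y * I - w).re = b - w.re := fun y => by simp
  have hpos : 0 < b - w.re := sub_pos.2 hw
  have hne : ∀ y : ℝ, (b : ℂ) + y * I - w ≠ 0 := fun y h => by
    have := hre y
    rw [h] at this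
    simp at this
    linarith
  refine of_primitive (B := 1 / (b - w.re)) (H := fun y => (log ((b : ℂ) + y * I - w)).im)
    (K := Real.pi) ?_ (fun y => ?_) (fun y => ?_) fun y => ?_
  · exact continuous_re.comp (continuous_const.div (by fun_prop) hne)
  · refine (abs_re_le_norm _).trans ?_
    rw [norm_div, norm_one]
    refine one_div_le_one_div_of_le hpos ?_
    rw [← hre y]
    exact re_le_norm _
  · have hs : (b : ℂ) + y * I - w ∈ slitPlane := Or.inl (by rw [hre]; exact hpos)
    have h1 := ((hasDerivAt_ofReal_mul_I (b : ℂ) y).sub_const w).clog_real hs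
    have h2 := (imCLM.hasFDerivAt (x := log ((b : ℂ) + y * I - w))).comp_hasDerivAt y h1
    refine HasDerivAt.congr_deriv h2 ?_
    rw [imCLM_apply, div_eq_mul_one_div, I_mul_im]
  · rw [log_im]
    exact abs_arg_le_pi _

end Moderate

namespace SSF

variable {σ0 σ1 : ℝ} (S : SSF σ0 σ1)

/-- The abscissa `b` lies to the right of the poles of all factors of `ξ_F`. -/
structure Far (b : ℝ) : Prop where
  gt : σ0 < b
  pole_lt : ∀ i, (S.pole i).re < b
  sub_pole_lt : ∀ i, σ1 - (S.pole i).re < b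
  one_le : ∀ j, 1 ≤ S.lam j * b + (S.mu j).re

lemma exists_far : ∃ b, S.Far b := by
  have h1 : ∀ᶠ b in atTop, σ0 < b := eventually_gt_atTop σ0
  have h2 : ∀ᶠ b in atTop, ∀ i, (S.pole i).re < b := eventually_all.2 fun i => eventually_gt_atTop _
  have h3 : ∀ᶠ b in atTop, ∀ i, σ1 - (S.pole i).re < b :=
    eventually_all.2 fun i => eventually_gt_atTop _
  have h4 : ∀ᶠ b in atTop, ∀ j, 1 ≤ S.lam j * b + (S.mu j).re := eventually_all.2 fun j =>
    (tendsto_atTop_add_const_right atTop (S.mu j).re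
      (tendsto_id.const_mul_atTop (S.hlam j))).eventually_ge_atTop 1
  obtain ⟨b, hb1, hb2, hb3, hb4⟩ := (h1.and (h2.and (h3.and h4))).exists
  exact ⟨b, hb1, hb2, hb3, hb4⟩

variable {S}

lemma Far.mono {b b' : ℝ} (h : S.Far b) (hb : b ≤ b') : S.Far b' where
  gt := h.gt.trans_le hb
  pole_lt i := (h.pole_lt i).trans_le hb
  sub_pole_lt i := (h.sub_pole_lt i).trans_le hb
  one_le j := (h.one_le j).trans (by have := mul_le_mul_of_nonneg_left hb (S.hlam j).le; linarith)

lemma Far.sub_lt {b : ℝ} (h : S.Far b) : σ1 - b < b := by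
  linarith [h.gt, S.hσ, S.hσ1pos]

lemma re_lam_mul_add (j : Fin S.r) (s : ℂ) :
    ((S.lam j : ℂ) * s + S.mu j).re = S.lam j * s.re + (S.mu j).re := by simp

lemma Far.one_le_re {b : ℝ} (h : S.Far b) {s : ℂ} (hs : b ≤ s.re) (j : Fin S.r) :
    1 ≤ ((S.lam j : ℂ) * s + S.mu j).re := by
  rw [re_lam_mul_add]
  exact (h.mono hs).one_le j

lemma Far.sub_pole_ne_zero {b : ℝ} (h : S.Far b) {s : ℂ} (hs : b ≤ s.re) (i : Fin S.N) :
    s - S.pole i ≠ 0 := fun e => by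
  have := h.pole_lt i
  rw [sub_eq_zero.1 e] at hs
  linarith

lemma Far.sub_sub_ne_zero {b : ℝ} (h : S.Far b) {s : ℂ} (hs : b ≤ s.re) (i : Fin S.N) :
    (σ1 : ℂ) - s - (starRingEnd ℂ) (S.pole i) ≠ 0 := fun e => by
  have h1 := h.sub_pole_lt i
  have h2 := congrArg re e
  simp at h2
  linarith

variable (S) in
/-- The last factor of the completed function. -/
def reflFactor (s : ℂ) : ℂ :=
  ∏ i : Fin S.N, (if 2 * S.M + S.dlt ≤ (i : ℕ) then
    ((σ1 : ℂ) - s - (starRingEnd ℂ) (S.pole i)) ^ S.m i else 1)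

lemma Far.xi_eq {b : ℝ} (h : S.Far b) {s : ℂ} (hs : b ≤ s.re) :
    S.xi s = S.F s * (S.Q : ℂ) ^ s * (∏ j, Gamma ((S.lam j : ℂ) * s + S.mu j)) *
      (∏ i, (s - S.pole i) ^ S.m i) * S.reflFactor s :=
  S.hxiEq s (fun i => sub_ne_zero.1 (h.sub_pole_ne_zero hs i)) fun j k e => by
    have := h.one_le_re hs j
    rw [e] at this
    simp at this
    linarith [(Nat.cast_nonneg k : (0 : ℝ) ≤ k)]

lemma Far.F_ne_zero {b : ℝ} (h : S.Far b) (h0 : S.xi 0 ≠ 0) {s : ℂ} (hs : b ≤ s.re) :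
    S.F s ≠ 0 := fun hF => by
  obtain ⟨x, hx, hxb⟩ := exists_between h.gt
  have h1 : ∀ z : ℂ, b ≤ z.re → S.xi z = 0 := fun z hz => by
    rw [h.xi_eq hz, S.F_eq_zero_of_zero hx (hxb.trans_le hs) hF (hxb.trans_le hz)]
    simp
  have hA : AnalyticOnNhd ℂ S.xi Set.univ := fun z _ => S.hxiDiff.analyticAt z
  have ho : IsOpen {z : ℂ | b < z.re} := isOpen_lt continuous_const continuous_re
  have h2 : S.xi =ᶠ[nhds ((b + 1 : ℝ) : ℂ)] 0 := by
    filter_upwards [ho.mem_nhds (by simp : b < (((b + 1 : ℝ) : ℂ)).re)] with z hz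
    exact h1 z (le_of_lt hz)
  exact h0 (hA.eqOn_zero_of_preconnected_of_eventuallyEq_zero isPreconnected_univ
    (Set.mem_univ _) h2 (Set.mem_univ 0))

lemma Far.reflFactor_ne_zero {b : ℝ} (h : S.Far b) {s : ℂ} (hs : b ≤ s.re) :
    S.reflFactor s ≠ 0 := Finset.prod_ne_zero_iff.2 fun i _ => by
  split_ifs
  · exact pow_ne_zero _ (h.sub_sub_ne_zero hs i)
  · exact one_ne_zero

lemma Far.Gamma_ne_zero {b : ℝ} (h : S.Far b) {s : ℂ} (hs : b ≤ s.re) (j : Fin S.r) :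
    Gamma ((S.lam j : ℂ) * s + S.mu j) ≠ 0 :=
  Gamma_ne_zero_of_re_pos (by linarith [h.one_le_re hs j])

lemma cpow_Q_ne_zero (s : ℂ) : (S.Q : ℂ) ^ s ≠ 0 := by
  have : (S.Q : ℂ) ≠ 0 := by exact_mod_cast S.hQ.ne'
  simp [cpow_eq_zero_iff, this]

lemma Far.xi_ne_zero {b : ℝ} (h : S.Far b) (h0 : S.xi 0 ≠ 0) {s : ℂ} (hs : b ≤ s.re) :
    S.xi s ≠ 0 := by
  rw [h.xi_eq hs]
  exact mul_ne_zero (mul_ne_zero (mul_ne_zero (mul_ne_zero (h.F_ne_zero h0 hs) (cpow_Q_ne_zero s))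
    (Finset.prod_ne_zero_iff.2 fun j _ => h.Gamma_ne_zero hs j))
    (Finset.prod_ne_zero_iff.2 fun i _ => pow_ne_zero _ (h.sub_pole_ne_zero hs i)))
    (h.reflFactor_ne_zero hs)

variable (S) in
lemma norm_xi_reflect (s : ℂ) : ‖S.xi s‖ = ‖S.xi ((σ1 : ℂ) - (starRingEnd ℂ) s)‖ := by
  rw [S.hFE s, norm_mul, S.hω, one_mul, RCLike.norm_conj]

lemma Far.re_of_xi_eq_zero {b : ℝ} (h : S.Far b) (h0 : S.xi 0 ≠ 0) {s : ℂ} (hs : S.xi s = 0) :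
    σ1 - b < s.re ∧ s.re < b := by
  constructor
  · by_contra! hc
    refine h.xi_ne_zero h0 (s := (σ1 : ℂ) - (starRingEnd ℂ) s) (by simp; linarith) ?_
    rw [← norm_eq_zero, ← norm_xi_reflect, hs, norm_zero]
  · by_contra! hc
    exact h.xi_ne_zero h0 hc hs

lemma growthOn_sub_pole (U : Set ℂ) : GrowthOn logWeight U fun s => ∏ i, (s - S.pole i) ^ S.m i :=
  GrowthOn.prod _ fun i => (growthOn_logWeight_affine U (K := ‖S.pole i‖) fun s => by
    rw [add_comm]; exact norm_sub_le _ _).pow _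

lemma growthOn_reflFactor (U : Set ℂ) : GrowthOn logWeight U S.reflFactor := by
  refine GrowthOn.prod (f := fun (i : Fin S.N) s => if 2 * S.M + S.dlt ≤ (i : ℕ) then
    ((σ1 : ℂ) - s - (starRingEnd ℂ) (S.pole i)) ^ S.m i else 1) _ fun i => ?_
  split_ifs
  · refine (growthOn_logWeight_affine U (K := ‖(σ1 : ℂ)‖ + ‖S.pole i‖) fun s => ?_).pow _
    refine (norm_sub_le _ _).trans ?_
    rw [RCLike.norm_conj]
    linarith [norm_sub_le (σ1 : ℂ) s]
  · exact GrowthOn.one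

lemma norm_cpow_Q (s : ℂ) : ‖(S.Q : ℂ) ^ s‖ = Real.exp (Real.log S.Q * s.re) := by
  rw [Complex.norm_cpow_eq_rpow_re_of_pos S.hQ, Real.rpow_def_of_pos S.hQ]

lemma growthOn_cpow_Q_strip (α β : ℝ) {U : Set ℂ} (hU : ∀ s ∈ U, α ≤ s.re ∧ s.re ≤ β) :
    GrowthOn logWeight U fun s => (S.Q : ℂ) ^ s := by
  refine growthOn_logWeight_of_bdd ⟨Real.exp (|Real.log S.Q| * (|α| + |β|)), fun s hs => ?_⟩
  rw [norm_cpow_Q]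
  refine Real.exp_le_exp.2 ((le_abs_self _).trans ?_)
  rw [abs_mul]
  refine mul_le_mul_of_nonneg_left ?_ (abs_nonneg _)
  rw [abs_le]
  obtain ⟨h1, h2⟩ := hU s hs
  constructor <;> linarith [neg_abs_le α, le_abs_self β, abs_nonneg α, abs_nonneg β]

lemma Far.growthOn_line {b : ℝ} (h : S.Far b) : GrowthOn logWeight {s | s.re = b} S.xi := by
  have hF : GrowthOn logWeight {s | s.re = b} S.F := by
    obtain ⟨C, hC⟩ := S.exists_norm_F_le h.gt
    exact growthOn_logWeight_of_bdd ⟨C, fun s hs => hC s (le_of_eq hs.symm)⟩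
  have hΓ : GrowthOn logWeight {s | s.re = b} fun s => ∏ j, Gamma ((S.lam j : ℂ) * s + S.mu j) :=
    GrowthOn.prod _ fun j => growthOn_logWeight_of_bdd
      ⟨Real.Gamma (S.lam j * b + (S.mu j).re), fun s hs => by
        have hs' : s.re = b := hs
        have := norm_Gamma_le_Gamma_re (z := (S.lam j : ℂ) * s + S.mu j)
          (by linarith [h.one_le_re hs'.ge j])
        rwa [re_lam_mul_add, hs'] at this⟩
  exact ((((hF.mul (growthOn_cpow_Q_strip b b fun s hs => ⟨le_of_eq hs.symm, le_of_eq hs⟩)).mul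
    hΓ).mul (growthOn_sub_pole _)).mul (growthOn_reflFactor _)).congr fun s hs =>
      h.xi_eq (le_of_eq hs.symm)

lemma Far.growthOn_right {b : ℝ} (h : S.Far b) : GrowthOn powWeight {s | b ≤ s.re} S.xi := by
  have hlog : ∀ {f : ℂ → ℂ}, GrowthOn logWeight {s | b ≤ s.re} f →
      GrowthOn powWeight {s | b ≤ s.re} f := fun hf =>
    hf.mono_weight zero_le_one fun s => by rw [one_mul]; exact logWeight_le_powWeight s
  have hF : GrowthOn powWeight {s | b ≤ s.re} S.F := by
    obtain ⟨C, hC⟩ := S.exists_norm_F_le h.gt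
    exact hlog (growthOn_logWeight_of_bdd ⟨C, fun s hs => hC s hs⟩)
  have hQ : GrowthOn powWeight {s | b ≤ s.re} fun s => (S.Q : ℂ) ^ s := by
    refine ⟨|Real.log S.Q|, abs_nonneg _, fun s _ => ?_⟩
    rw [norm_cpow_Q]
    refine Real.exp_le_exp.2 ((le_abs_self _).trans ?_)
    rw [abs_mul]
    refine mul_le_mul_of_nonneg_left ?_ (abs_nonneg _)
    exact (abs_re_le_norm s).trans ((by linarith : ‖s‖ ≤ 1 + ‖s‖).trans
        (one_add_norm_le_powWeight s))
  have hΓ : GrowthOn powWeight {s | b ≤ s.re} fun s => ∏ j, Gamma ((S.lam j : ℂ) * s + S.mu j) := by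
    refine GrowthOn.prod _ fun j =>
      ⟨32 * (1 + S.lam j + ‖S.mu j‖) ^ (33 / 32 : ℝ), ?_, fun s hs => ?_⟩
    · have := S.hlam j
      positivity
    have hl := S.hlam j
    have h1 := h.one_le_re hs j
    refine (norm_Gamma_le_Gamma_re (by linarith)).trans ((Real_Gamma_le_exp h1).trans ?_)
    refine Real.exp_le_exp.2 ?_
    rw [powWeight, mul_assoc, ← Real.mul_rpow (by positivity) (by positivity)]
    gcongr
    rw [re_lam_mul_add]
    nlinarith [mul_le_mul_of_nonneg_left (re_le_norm s) hl.le, re_le_norm (S.mu j),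
      mul_nonneg (norm_nonneg (S.mu j)) (norm_nonneg s), norm_nonneg s]
  exact ((((hF.mul hQ).mul hΓ).mul (hlog (growthOn_sub_pole _))).mul
    (hlog (growthOn_reflFactor _))).congr fun s hs => h.xi_eq hs

variable (S) in
lemma growthOn_reflect {W : ℂ → ℝ} {K : ℝ} (hK : 0 ≤ K)
    (hW : ∀ s, W ((σ1 : ℂ) - (starRingEnd ℂ) s) ≤ K * W s) {U V : Set ℂ}
    (hUV : ∀ s ∈ V, (σ1 : ℂ) - (starRingEnd ℂ) s ∈ U) (h : GrowthOn W U S.xi) :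
    GrowthOn W V S.xi := by
  obtain ⟨C, hC, h⟩ := h
  refine ⟨C * K, by positivity, fun s hs => ?_⟩
  rw [norm_xi_reflect]
  refine (h _ (hUV s hs)).trans (Real.exp_le_exp.2 ?_)
  rw [mul_assoc]
  exact mul_le_mul_of_nonneg_left (hW s) hC

lemma norm_reflect_le (hσ : 0 < σ1) (s : ℂ) : ‖(σ1 : ℂ) - (starRingEnd ℂ) s‖ ≤ σ1 + ‖s‖ := by
  refine (norm_sub_le _ _).trans (le_of_eq ?_)
  rw [RCLike.norm_conj, Complex.norm_real, Real.norm_of_nonneg hσ.le]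

lemma logWeight_reflect_le (hσ : 0 < σ1) (s : ℂ) : logWeight ((σ1 : ℂ) - (starRingEnd ℂ) s) ≤
    (Real.log (1 + σ1) / Real.log 2 + 1) * logWeight s := by
  have h1 := hσ
  have h2 := Real.log_pos one_lt_two
  have h3 : 0 ≤ Real.log (1 + σ1) := Real.log_nonneg (by linarith)
  calc logWeight ((σ1 : ℂ) - (starRingEnd ℂ) s) ≤ Real.log ((1 + σ1) * (2 + ‖s‖)) := by
        refine Real.log_le_log (by positivity) ?_
        nlinarith [norm_reflect_le hσ s, norm_nonneg s, mul_nonneg h1.le (norm_nonneg s)]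
    _ = Real.log (1 + σ1) / Real.log 2 * Real.log 2 + logWeight s := by
        rw [Real.log_mul (by positivity) (by positivity), div_mul_cancel₀ _ h2.ne', logWeight]
    _ ≤ Real.log (1 + σ1) / Real.log 2 * logWeight s + logWeight s := by
        gcongr; exact log_two_le_logWeight s
    _ = _ := by ring

lemma powWeight_reflect_le (hσ : 0 < σ1) (s : ℂ) : powWeight ((σ1 : ℂ) - (starRingEnd ℂ) s) ≤
    (1 + σ1) ^ (33 / 32 : ℝ) * powWeight s := by
  have h1 := hσ
  unfold powWeight
  rw [← Real.mul_rpow (by positivity) (by positivity)]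
  gcongr
  nlinarith [norm_reflect_le hσ s, norm_nonneg s, mul_nonneg h1.le (norm_nonneg s)]

lemma xi_eq_G {s : ℂ} (hp : ∀ i, s ≠ S.pole i) (hg : ∀ j, ((S.lam j : ℂ) * s + S.mu j).im ≠ 0) :
    S.xi s = S.G s * ((S.Q : ℂ) ^ s * (∏ j, Gamma ((S.lam j : ℂ) * s + S.mu j)) *
      S.reflFactor s) := by
  rw [S.hxiEq s hp fun j k e => hg j (by rw [e]; simp), S.hGF s hp, reflFactor]
  ring

lemma Far.growthOn_strip {b : ℝ} (h : S.Far b) :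
    GrowthOn logWeight {s | σ1 - b ≤ s.re ∧ s.re ≤ b} S.xi := by
  have hY : ∀ᶠ Y : ℝ in atTop, 1 ≤ Y ∧ (∀ j, 1 + |(S.mu j).im| ≤ S.lam j * Y) ∧
      ∀ i, |(S.pole i).im| < Y := by
    refine (eventually_ge_atTop 1).and ((eventually_all.2 fun j => ?_).and
      (eventually_all.2 fun i => eventually_gt_atTop _))
    exact (tendsto_id.const_mul_atTop (S.hlam j)).eventually_ge_atTop _
  obtain ⟨Y, hY1, hYμ, hYp⟩ := hY.exists
  set U : Set ℂ := {s | (σ1 - b ≤ s.re ∧ s.re ≤ b) ∧ Y ≤ |s.im|} with hU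
  have him : ∀ s ∈ U, ∀ j, 1 ≤ |((S.lam j : ℂ) * s + S.mu j).im| := fun s hs j => by
    have e : ((S.lam j : ℂ) * s + S.mu j).im = S.lam j * s.im + (S.mu j).im := by simp
    rw [e]
    have h1 : S.lam j * |s.im| = |S.lam j * s.im| := by rw [abs_mul, abs_of_pos (S.hlam j)]
    have h2 := mul_le_mul_of_nonneg_left hs.2 (S.hlam j).le
    have h3 : |S.lam j * s.im| ≤ |S.lam j * s.im + (S.mu j).im| + |(S.mu j).im| := by
      simpa using abs_sub (S.lam j * s.im + (S.mu j).im) (S.mu j).im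
    linarith [hYμ j]
  have hΓ : GrowthOn logWeight U fun s => ∏ j, Gamma ((S.lam j : ℂ) * s + S.mu j) := by
    refine GrowthOn.prod _ fun j => growthOn_logWeight_of_bdd ?_
    obtain ⟨C, hC⟩ := exists_norm_Gamma_le (S.lam j * (σ1 - b) + (S.mu j).re)
      (S.lam j * b + (S.mu j).re)
    have hl := (S.hlam j).le
    refine ⟨C, fun s hs => hC _ ?_ ?_ (him s hs j)⟩ <;> rw [re_lam_mul_add]
    · linarith [mul_le_mul_of_nonneg_left hs.1.1 hl]
    · linarith [mul_le_mul_of_nonneg_left hs.1.2 hl]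
  obtain ⟨C, hC, hP⟩ := ((growthOn_cpow_Q_strip (S := S) (σ1 - b) b fun s (hs : s ∈ U) => hs.1).mul
    hΓ).mul (growthOn_reflFactor U)
  obtain ⟨c, B, hG⟩ := S.hGord
  set n := ⌈|B|⌉₊ + 1 with hn
  refine _root_.growthOn_strip S.hxiDiff h.sub_lt (Y := Y) (B := n) (K := |c| + 1 + C)
      (by positivity)
    (fun s h1 h2 h3 => ?_) ?_ h.growthOn_line
  · have hsU : s ∈ U := ⟨⟨h1, h2⟩, h3⟩
    have hs1 : 1 ≤ ‖s‖ := (hY1.trans h3).trans (abs_im_le_norm s)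
    have hge : 1 ≤ (1 + ‖s‖) ^ n := one_le_pow₀ (by linarith)
    have hge' : 1 + ‖s‖ ≤ (1 + ‖s‖) ^ n := le_self_pow₀ (by linarith) (by omega)
    have hpow : ‖s‖ ^ B ≤ (1 + ‖s‖) ^ n := by
      rw [← Real.rpow_natCast]
      refine (Real.rpow_le_rpow_of_exponent_le hs1 (?_ : B ≤ (n : ℝ))).trans (by gcongr; linarith)
      rw [hn]
      push_cast
      linarith [le_abs_self B, Nat.le_ceil |B|]
    have hlogw : logWeight s ≤ (1 + ‖s‖) ^ n := by
      refine le_trans ?_ hge'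
      have := Real.log_le_sub_one_of_pos (by positivity : 0 < 2 + ‖s‖)
      unfold logWeight
      linarith
    have hc : c ≤ Real.exp (|c| * (1 + ‖s‖) ^ n) := by
      have e1 := Real.add_one_le_exp (|c| * (1 + ‖s‖) ^ n)
      nlinarith [le_abs_self c, abs_nonneg c]
    rw [xi_eq_G (fun i e => ?_) fun j e => ?_]
    · rw [norm_mul, add_mul, add_mul, Real.exp_add, Real.exp_add, one_mul]
      refine mul_le_mul ((hG s).trans (mul_le_mul hc (Real.exp_le_exp.2 hpow) (Real.exp_pos _).le
        (Real.exp_pos _).le)) ((hP s hsU).trans (Real.exp_le_exp.2 ?_)) (norm_nonneg _)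
        (by positivity)
      exact mul_le_mul_of_nonneg_left hlogw hC
    · have := hYp i
      rw [← e] at this
      linarith
    · have := him s hsU j
      rw [e] at this
      simp at this
      linarith
  · have h2 : 0 ≤ Real.log (1 + σ1) := Real.log_nonneg (by linarith [S.hσ1pos])
    refine S.growthOn_reflect (by positivity) (logWeight_reflect_le S.hσ1pos) (fun s hs => ?_)
      h.growthOn_line
    have hs' : s.re = σ1 - b := hs
    simp [hs']

lemma Far.exists_norm_xi_le {b : ℝ} (h : S.Far b) : ∃ C, 0 ≤ C ∧ ∀ s : ℂ,
    ‖S.xi s‖ ≤ Real.exp (C * (1 + ‖s‖) ^ (33 / 32 : ℝ)) := by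
  have hσ := S.hσ1pos
  have hr := h.growthOn_right
  have hl : GrowthOn powWeight {s | s.re ≤ σ1 - b} S.xi :=
    S.growthOn_reflect (by positivity) (powWeight_reflect_le S.hσ1pos) (fun s hs => by
      have hs' : s.re ≤ σ1 - b := hs
      simp
      linarith) hr
  have hm : GrowthOn powWeight {s | σ1 - b ≤ s.re ∧ s.re ≤ b} S.xi :=
    h.growthOn_strip.mono_weight zero_le_one fun s => by
      rw [one_mul]; exact logWeight_le_powWeight s
  have hW : ∀ s, 0 ≤ powWeight s := fun s => by unfold powWeight; positivity
  obtain ⟨C, hC, hb⟩ := (hr.union (hl.union hm hW) hW).mono_set (V := Set.univ) fun s _ => by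
    rcases le_total b s.re with h1 | h1
    · exact Or.inl h1
    · rcases le_total s.re (σ1 - b) with h2 | h2
      · exact Or.inr (Or.inl h2)
      · exact Or.inr (Or.inr ⟨h2, h1⟩)
  exact ⟨C, hC, fun s => hb s (Set.mem_univ s)⟩

end SSF

namespace SSF

variable {σ0 σ1 : ℝ} {S : SSF σ0 σ1}

lemma Far.differentiableAt_Gamma {b : ℝ} (h : S.Far b) {s : ℂ} (hs : b ≤ s.re) (j : Fin S.r) :
    DifferentiableAt ℂ Gamma ((S.lam j : ℂ) * s + S.mu j) :=
  Complex.differentiableAt_Gamma _ fun k e => by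
    have := h.one_le_re hs j
    rw [e] at this
    simp at this
    linarith [(Nat.cast_nonneg k : (0 : ℝ) ≤ k)]

lemma Far.logDeriv_xi {b : ℝ} (h : S.Far b) (h0 : S.xi 0 ≠ 0) {s : ℂ} (hs : b < s.re) :
    logDeriv S.xi s = logDeriv S.F s + log S.Q +
      ∑ j, S.lam j * logDeriv Gamma ((S.lam j : ℂ) * s + S.mu j) +
      ∑ i, S.m i * (1 / (s - S.pole i)) +
      ∑ i : Fin S.N, (if 2 * S.M + S.dlt ≤ (i : ℕ) then (S.m i : ℝ) else 0) *
        (1 / (s - ((σ1 : ℂ) - (starRingEnd ℂ) (S.pole i)))) := by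
  have ho : IsOpen {z : ℂ | b < z.re} := isOpen_lt continuous_const continuous_re
  have e : S.xi =ᶠ[nhds s] fun s => S.F s * (S.Q : ℂ) ^ s *
      (∏ j, Gamma ((S.lam j : ℂ) * s + S.mu j)) * (∏ i, (s - S.pole i) ^ S.m i) *
      S.reflFactor s := by
    filter_upwards [ho.mem_nhds hs] with z hz using h.xi_eq (le_of_lt hz)
  have hQ : (S.Q : ℂ) ≠ 0 := by exact_mod_cast S.hQ.ne'
  have hs' := hs.le
  have n1 := h.F_ne_zero h0 hs'
  have n2 := cpow_Q_ne_zero (S := S) s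
  have n3 : ∏ j, Gamma ((S.lam j : ℂ) * s + S.mu j) ≠ 0 :=
    Finset.prod_ne_zero_iff.2 fun j _ => h.Gamma_ne_zero hs' j
  have n4 : ∏ i, (s - S.pole i) ^ S.m i ≠ 0 :=
    Finset.prod_ne_zero_iff.2 fun i _ => pow_ne_zero _ (h.sub_pole_ne_zero hs' i)
  have n5 := h.reflFactor_ne_zero hs'
  have dQ : HasDerivAt (fun s : ℂ => (S.Q : ℂ) ^ s) ((S.Q : ℂ) ^ s * log S.Q) s := by
    simpa using (hasDerivAt_id' s).const_cpow (c := (S.Q : ℂ)) (Or.inl hQ)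
  have dl : ∀ j : Fin S.r, HasDerivAt (fun s : ℂ => (S.lam j : ℂ) * s + S.mu j) (S.lam j) s :=
    fun j => by simpa using ((hasDerivAt_id s).const_mul (S.lam j : ℂ)).add_const (S.mu j)
  have dΓ : ∀ j : Fin S.r, HasDerivAt (fun s : ℂ => Gamma ((S.lam j : ℂ) * s + S.mu j))
      (deriv Gamma ((S.lam j : ℂ) * s + S.mu j) * S.lam j) s := fun j =>
    (h.differentiableAt_Gamma hs' j).hasDerivAt.comp_of_eq s (dl j) rfl
  have d1 := S.differentiableAt_F (h.gt.trans hs)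
  have d2 : DifferentiableAt ℂ (fun s : ℂ => (S.Q : ℂ) ^ s) s := dQ.differentiableAt
  have d3 : DifferentiableAt ℂ (fun s => ∏ j, Gamma ((S.lam j : ℂ) * s + S.mu j)) s :=
    DifferentiableAt.fun_finsetProd fun j _ => (dΓ j).differentiableAt
  have d4 : DifferentiableAt ℂ (fun s => ∏ i, (s - S.pole i) ^ S.m i) s := by fun_prop
  have d5i : ∀ i : Fin S.N, DifferentiableAt ℂ (fun s => if 2 * S.M + S.dlt ≤ (i : ℕ) then
      ((σ1 : ℂ) - s - (starRingEnd ℂ) (S.pole i)) ^ S.m i else 1) s := fun i => by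
    split_ifs <;> fun_prop
  have d5 : DifferentiableAt ℂ S.reflFactor s :=
    DifferentiableAt.fun_finsetProd fun i _ => d5i i
  have e4 := logDeriv_mul (f := fun s => S.F s * (S.Q : ℂ) ^ s *
      (∏ j, Gamma ((S.lam j : ℂ) * s + S.mu j)) * (∏ i, (s - S.pole i) ^ S.m i)) s
    (mul_ne_zero (mul_ne_zero (mul_ne_zero n1 n2) n3) n4) n5
      (((d1.fun_mul d2).fun_mul d3).fun_mul d4) d5
  have e3 := logDeriv_mul (f := fun s => S.F s * (S.Q : ℂ) ^ s *
      (∏ j, Gamma ((S.lam j : ℂ) * s + S.mu j))) s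
    (mul_ne_zero (mul_ne_zero n1 n2) n3) n4 ((d1.fun_mul d2).fun_mul d3) d4
  have e2 := logDeriv_mul (f := fun s => S.F s * (S.Q : ℂ) ^ s) s
    (mul_ne_zero n1 n2) n3 (d1.fun_mul d2) d3
  have e1 := logDeriv_mul (f := S.F) (g := fun s => (S.Q : ℂ) ^ s) s n1 n2 d1 d2
  rw [(logDeriv_congr_nhds e).eq_of_nhds, e4, e3, e2, e1]
  congr 1
  · congr 1
    · congr 1
      · congr 1
        rw [logDeriv_apply, dQ.deriv]
        exact mul_div_cancel_left₀ _ n2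
      · rw [logDeriv_prod (f := fun (j : Fin S.r) s => Gamma ((S.lam j : ℂ) * s + S.mu j))
          (fun j _ => h.Gamma_ne_zero hs' j) fun j _ => (dΓ j).differentiableAt]
        refine Finset.sum_congr rfl fun j _ => ?_
        rw [logDeriv_apply, (dΓ j).deriv, logDeriv_apply]
        ring
    · rw [logDeriv_prod (f := fun (i : Fin S.N) s => (s - S.pole i) ^ S.m i)
        (fun i _ => pow_ne_zero _ (h.sub_pole_ne_zero hs' i)) fun i _ => by fun_prop]
      refine Finset.sum_congr rfl fun i _ => ?_
      rw [logDeriv_fun_pow (by fun_prop), logDeriv_apply,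
        ((hasDerivAt_id' s).sub_const (S.pole i)).deriv]
  · unfold reflFactor
    rw [logDeriv_prod (f := fun (i : Fin S.N) s => if 2 * S.M + S.dlt ≤ (i : ℕ) then
      ((σ1 : ℂ) - s - (starRingEnd ℂ) (S.pole i)) ^ S.m i else 1)
        (fun i _ => Finset.prod_ne_zero_iff.1 n5 i (Finset.mem_univ i)) fun i _ => d5i i]
    refine Finset.sum_congr rfl fun i _ => ?_
    split_ifs
    · rw [logDeriv_fun_pow (by fun_prop), logDeriv_apply,
        (((hasDerivAt_id' s).const_sub (σ1 : ℂ)).sub_const ((starRingEnd ℂ) (S.pole i))).deriv,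
        ← neg_div_neg_eq, neg_neg]
      push_cast
      congr 2
      ring
    · simp

lemma Far.moderate {b : ℝ} (h : S.Far b) (h0 : S.xi 0 ≠ 0) {b' : ℝ} (hb : b < b') :
    Moderate fun y => (logDeriv S.xi ((b' : ℂ) + y * I)).re := by
  have h' := h.mono hb.le
  have hre : ∀ y : ℝ, ((b' : ℂ) + y * I).re = b' := fun y => by simp
  have m1 : Moderate fun y => (logDeriv S.F ((b' : ℂ) + y * I)).re := by
    obtain ⟨H, K, hH, hK⟩ := S.exists_primitive_logDeriv_F_line h'.gt
    obtain ⟨C, -, hC⟩ := S.exists_norm_logDeriv_F_le h'.gt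
    exact Moderate.of_primitive (continuous_re.comp (S.continuous_logDeriv_F_line h'.gt))
      (fun y => (abs_re_le_norm _).trans (hC _ (hre y).ge))
      (fun y => (reCLM.hasFDerivAt (x := H y)).comp_hasDerivAt y (hH y))
      fun y => (abs_re_le_norm _).trans (hK y)
  have m3 := Moderate.sum Finset.univ fun j : Fin S.r =>
    (Moderate.re_logDeriv_Gamma (h'.one_le j) (S.hlam j) (S.mu j).im).const_mul (S.lam j)
  have m4 := Moderate.sum Finset.univ fun i : Fin S.N =>
    (Moderate.re_one_div (h'.pole_lt i)).const_mul (S.m i)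
  have m5 := Moderate.sum Finset.univ fun i : Fin S.N =>
    (Moderate.re_one_div (b := b') (w := (σ1 : ℂ) - (starRingEnd ℂ) (S.pole i))
      (by simpa using h'.sub_pole_lt i)).const_mul
      (if 2 * S.M + S.dlt ≤ (i : ℕ) then (S.m i : ℝ) else 0)
  convert (((m1.add (Moderate.const (log S.Q).re)).add m3).add m4).add m5 using 2 with y
  rw [h.logDeriv_xi h0 (by rw [hre]; exact hb)]
  simp only [add_re, re_sum, re_ofReal_mul]
  congr 2
  · congr 1
    refine Finset.sum_congr rfl fun j _ => ?_
    congr 3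
    apply Complex.ext <;> simp
  · refine Finset.sum_congr rfl fun i _ => ?_
    rw [← ofReal_natCast, re_ofReal_mul]

end SSF

lemma tsum_subtype_and {p q : ℂ → Prop} [DecidablePred q] (g : ℂ → ℂ) :
    ∑' ρ : {ρ : ℂ // p ρ ∧ q ρ}, g ρ = ∑' ρ : {ρ : ℂ // p ρ}, if q ρ then g ρ else 0 := by
  have e1 := tsum_subtype {ρ : ℂ | p ρ ∧ q ρ} g
  have e2 := tsum_subtype {ρ : ℂ | p ρ} fun ρ => if q ρ then g ρ else 0
  refine e1.trans (Eq.trans ?_ e2.symm)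
  congr 1
  ext ρ
  by_cases hp : p ρ <;> by_cases hq : q ρ <;> simp [Set.indicator, hp, hq]

lemma exists_norm_one_add_pow_sub_le (n : ℕ) {M : ℝ} (hM : 0 ≤ M) :
    ∃ K, 0 ≤ K ∧ ∀ w : ℂ, ‖w‖ ≤ M → ‖(1 + w) ^ n - 1 - n * w‖ ≤ K * ‖w‖ ^ 2 := by
  induction n with
  | zero => exact ⟨0, le_rfl, fun w _ => by simp⟩
  | succ n ih =>
    obtain ⟨K, hK, h⟩ := ih
    refine ⟨(1 + M) * K + n, by positivity, fun w hw => ?_⟩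
    have e : (1 + w) ^ (n + 1) - 1 - ((n + 1 : ℕ) : ℂ) * w =
        (1 + w) * ((1 + w) ^ n - 1 - n * w) + n * w ^ 2 := by
      push_cast
      ring
    rw [e]
    have h1 : ‖1 + w‖ ≤ 1 + M := (norm_add_le _ _).trans (by simpa using hw)
    calc ‖(1 + w) * ((1 + w) ^ n - 1 - n * w) + n * w ^ 2‖
        ≤ ‖1 + w‖ * ‖(1 + w) ^ n - 1 - n * w‖ + n * ‖w‖ ^ 2 := by
          refine (norm_add_le _ _).trans (le_of_eq ?_)
          rw [norm_mul, norm_mul, norm_pow, norm_natCast]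
      _ ≤ (1 + M) * (K * ‖w‖ ^ 2) + n * ‖w‖ ^ 2 := by
          gcongr
          exact h w hw
      _ = ((1 + M) * K + n) * ‖w‖ ^ 2 := by ring

lemma norm_inv_add_oddWeight_le {s : ℂ} {A δ : ℝ} (hδ : 0 < δ) (hA : |s.re| ≤ A)
    (hs : δ ≤ ‖s‖) :
    ‖s⁻¹‖ ≤ (1 / δ + 1) * (1 + |s.im|)⁻¹ ∧
      ‖s⁻¹ + I * oddWeight s.im‖ ≤ 2 * (1 + A) * (1 / δ + 1) * ((1 + |s.im|) ^ 2)⁻¹ := by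
  have hA0 : 0 ≤ A := (abs_nonneg _).trans hA
  have hs0 : 0 < ‖s‖ := hδ.trans_le hs
  have hne : s ≠ 0 := norm_pos_iff.1 hs0
  have hu : 0 < 1 + |s.im| := by positivity
  have h1 : ‖s⁻¹‖ ≤ (1 / δ + 1) * (1 + |s.im|)⁻¹ := by
    rw [norm_inv, ← div_eq_mul_inv, inv_eq_one_div, div_le_div_iff₀ hs0 hu]
    have a1 : 1 ≤ 1 / δ * ‖s‖ := by
      rw [one_div, ← div_eq_inv_mul, one_le_div hδ]
      exact hs
    have a2 := abs_im_le_norm s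
    nlinarith
  refine ⟨h1, ?_⟩
  have hd : (0 : ℝ) < 1 + s.im ^ 2 := by positivity
  have hd' : (1 + (s.im : ℂ) ^ 2) ≠ 0 := by exact_mod_cast hd.ne'
  have e : s⁻¹ + I * oddWeight s.im =
      s⁻¹ * ((1 + s.re * s.im * I) / ((1 + s.im ^ 2 : ℝ) : ℂ)) := by
    have hsI : (s.re : ℂ) + s.im * I = s := re_add_im s
    unfold oddWeight
    push_cast
    rw [show I * ((s.im : ℂ) / (1 + (s.im : ℂ) ^ 2)) =
      s⁻¹ * (s * I * s.im / (1 + (s.im : ℂ) ^ 2)) by field_simp]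
    rw [← mul_one_add, mul_eq_mul_left_iff]
    left
    rw [eq_div_iff hd', add_mul, div_mul_cancel₀ _ hd']
    linear_combination (s.im : ℂ) ^ 2 * I_sq - s.im * I * hsI
  have h2 : ‖(1 + s.re * s.im * I) / ((1 + s.im ^ 2 : ℝ) : ℂ)‖ ≤
      2 * (1 + A) * (1 + |s.im|)⁻¹ := by
    have b1 : ‖(1 + s.re * s.im * I : ℂ)‖ ≤ (1 + A) * (1 + |s.im|) := by
      have : ‖(s.re * s.im * I : ℂ)‖ = |s.re| * |s.im| := by simp
      refine (norm_add_le _ _).trans ?_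
      rw [this, norm_one]
      nlinarith [abs_nonneg s.im, mul_le_mul_of_nonneg_right hA (abs_nonneg s.im)]
    rw [norm_div, norm_real, Real.norm_of_nonneg hd.le, ← div_eq_mul_inv,
      div_le_div_iff₀ hd hu]
    calc ‖(1 + s.re * s.im * I : ℂ)‖ * (1 + |s.im|)
        ≤ (1 + A) * (1 + |s.im|) * (1 + |s.im|) := by gcongr
      _ ≤ 2 * (1 + A) * (1 + s.im ^ 2) := by
        have : (1 + |s.im|) * (1 + |s.im|) ≤ 2 * (1 + s.im ^ 2) := by
          nlinarith [sq_abs s.im, sq_nonneg (1 - |s.im|)]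
        calc (1 + A) * (1 + |s.im|) * (1 + |s.im|)
            = (1 + A) * ((1 + |s.im|) * (1 + |s.im|)) := by ring
          _ ≤ (1 + A) * (2 * (1 + s.im ^ 2)) := by gcongr
          _ = _ := by ring
  rw [e, norm_mul]
  calc ‖s⁻¹‖ * ‖(1 + s.re * s.im * I) / ((1 + s.im ^ 2 : ℝ) : ℂ)‖
      ≤ ((1 / δ + 1) * (1 + |s.im|)⁻¹) * (2 * (1 + A) * (1 + |s.im|)⁻¹) := by gcongr
    _ = _ := by
      rw [← inv_pow]
      ring

lemma exists_norm_li_term_sub_le (n : ℕ) (τ : ℝ) {A δ : ℝ} (_hA : 0 ≤ A) (hδ : 0 < δ) :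
    ∃ K, ∀ ρ : ℂ, |ρ.re| ≤ A → δ ≤ ‖ρ - τ‖ →
      ‖1 - (ρ / (ρ - τ)) ^ n - n * τ * I * oddWeight ρ.im‖ ≤ K * ((1 + |ρ.im|) ^ 2)⁻¹ := by
  obtain ⟨K, hK, h⟩ := exists_norm_one_add_pow_sub_le n
    (M := |τ| * (1 / δ)) (by positivity)
  refine ⟨K * (|τ| * (1 / δ + 1)) ^ 2 + n * |τ| * (2 * (1 + (A + |τ|)) * (1 / δ + 1)),
    fun ρ h1 h2 => ?_⟩
  have him : (ρ - τ).im = ρ.im := by simp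
  have hre : |(ρ - τ).re| ≤ A + |τ| := by
    simp only [sub_re, ofReal_re]
    exact (abs_sub _ _).trans (by gcongr)
  have hne : ρ - τ ≠ 0 := norm_pos_iff.1 (hδ.trans_le h2)
  obtain ⟨k1, k2⟩ := norm_inv_add_oddWeight_le hδ hre h2
  rw [him] at k1 k2
  have e0 : ρ / (ρ - τ) = 1 + τ * (ρ - τ)⁻¹ := by
    field_simp
    ring
  have hw : ‖(τ : ℂ) * (ρ - τ)⁻¹‖ ≤ |τ| * (1 / δ) := by
    rw [norm_mul, norm_real, Real.norm_eq_abs, norm_inv, inv_eq_one_div]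
    gcongr
  have hw2 : ‖(τ : ℂ) * (ρ - τ)⁻¹‖ ≤ |τ| * (1 / δ + 1) * (1 + |ρ.im|)⁻¹ := by
    rw [norm_mul, norm_real, Real.norm_eq_abs, mul_assoc]
    gcongr
  have e1 : 1 - (ρ / (ρ - τ)) ^ n - n * τ * I * oddWeight ρ.im =
      -((1 + τ * (ρ - τ)⁻¹) ^ n - 1 - n * (τ * (ρ - τ)⁻¹)) -
        n * τ * ((ρ - τ)⁻¹ + I * oddWeight ρ.im) := by
    rw [e0]
    ring
  rw [e1]
  calc _ ≤ ‖(1 + τ * (ρ - τ)⁻¹) ^ n - 1 - n * (τ * (ρ - τ)⁻¹)‖ +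
        n * |τ| * ‖(ρ - τ)⁻¹ + I * oddWeight ρ.im‖ := by
        refine (norm_sub_le _ _).trans (le_of_eq ?_)
        rw [norm_neg, norm_mul, norm_mul, norm_natCast, norm_real, Real.norm_eq_abs]
    _ ≤ K * (|τ| * (1 / δ + 1) * (1 + |ρ.im|)⁻¹) ^ 2 +
        n * |τ| * (2 * (1 + (A + |τ|)) * (1 / δ + 1) * ((1 + |ρ.im|) ^ 2)⁻¹) := by
        gcongr
        refine (h _ hw).trans ?_
        gcongr
    _ = _ := by
        rw [← inv_pow]
        ring

lemma re_one_div_eq_stripKernel (b y : ℝ) (ρ : ℂ) :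
    (1 / ((b : ℂ) + y * I - ρ)).re = stripKernel (b - ρ.re) (y - ρ.im) := by
  rw [one_div, inv_re, normSq_apply]
  simp [stripKernel, sq]

namespace SSF

variable {σ0 σ1 : ℝ} {S : SSF σ0 σ1}

lemma Far.abs_re_le {b : ℝ} (h : S.Far b) (h0 : S.xi 0 ≠ 0) {s : ℂ} (hs : S.xi s = 0) :
    |s.re| ≤ |b| + |σ1| := by
  obtain ⟨h1, h2⟩ := h.re_of_xi_eq_zero h0 hs
  rw [abs_le]
  constructor <;> linarith [le_abs_self b, neg_abs_le b, le_abs_self σ1, neg_abs_le σ1]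

lemma Far.summable_zeroOrder_mul {b : ℝ} (h : S.Far b) (h0 : S.xi 0 ≠ 0) :
    Summable fun ρ : {ρ : ℂ // S.xi ρ = 0} =>
      (zeroOrder S.xi ρ : ℝ) * (1 + |(ρ : ℂ).im|) ^ (-(17 / 16) : ℝ) := by
  obtain ⟨C, hC, hgr⟩ := h.exists_norm_xi_le
  have hs := (summable_zeroOrder_mul_rpow S.hxiDiff h0 hC (by norm_num) hgr
    (show (33 / 32 : ℝ) < 17 / 16 by norm_num)).mul_left
      ((1 + (|b| + |σ1|)) ^ (17 / 16 : ℝ))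
  refine hs.of_nonneg_of_le (fun ρ => by positivity) fun ρ => ?_
  have hre := h.abs_re_le h0 ρ.2
  have hn := norm_le_abs_re_add_abs_im (ρ : ℂ)
  have hk : 1 + ‖(ρ : ℂ)‖ ≤ (1 + (|b| + |σ1|)) * (1 + |(ρ : ℂ).im|) := by
    nlinarith [abs_nonneg (ρ : ℂ).im, abs_nonneg b, abs_nonneg σ1]
  rw [mul_left_comm]
  gcongr
  have hp : (0 : ℝ) < 1 + |(ρ : ℂ).im| := by positivity
  have hq : (0 : ℝ) < 1 + ‖(ρ : ℂ)‖ := by positivity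
  rw [Real.rpow_neg hp.le, Real.rpow_neg hq.le, ← div_eq_mul_inv, inv_eq_one_div,
    div_le_div_iff₀ (by positivity) (by positivity), one_mul,
    ← Real.mul_rpow (by positivity) hp.le]
  gcongr

lemma exists_tendsto_tsum_truncWeight (S : SSF σ0 σ1) (h0 : S.xi 0 ≠ 0) :
    ∃ L, Tendsto (fun T => ∑' ρ : {ρ : ℂ // S.xi ρ = 0},
      (zeroOrder S.xi ρ : ℝ) * truncWeight T (ρ : ℂ).im) atTop (nhds L) := by
  obtain ⟨b, h⟩ := S.exists_far
  obtain ⟨C, hC, hgr⟩ := h.exists_norm_xi_le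
  have : Countable {ρ : ℂ // S.xi ρ = 0} :=
    countable_zeros S.hxiDiff h0 hC (by norm_num) hgr
  have hm := h.moderate h0 (lt_add_one b)
  obtain ⟨B, hB⟩ := hm.bound
  obtain ⟨V, hV⟩ := hm.primitive
  refine _root_.exists_tendsto_tsum_truncWeight
    (c := fun ρ : {ρ : ℂ // S.xi ρ = 0} => b + 1 - (ρ : ℂ).re)
    (C := b + 1 - (σ1 - b)) (fun ρ => Nat.cast_nonneg _)
    (fun ρ => ?_) (fun ρ => ?_) (h.summable_zeroOrder_mul h0) hm.continuous (fun y => ?_) hB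
    (exists_tendsto_integral_mul_oddWeight hm.continuous hV)
  · linarith [(h.re_of_xi_eq_zero h0 ρ.2).2]
  · linarith [(h.re_of_xi_eq_zero h0 ρ.2).1]
  · have hz : ∀ y : ℝ, S.xi (((b + 1 : ℝ) : ℂ) + y * I) ≠ 0 := fun y =>
      h.xi_ne_zero h0 (by simp)
    have hsum := fun y => hasSum_logDeriv_sub S.hxiDiff h0 hC (by norm_num) (by norm_num) hgr (hz y)
    have hre := hasSum_re ((hsum y).sub (hsum 0))
    convert hre using 1
    · ext ρ
      rw [← mul_sub, ← ofReal_natCast, re_ofReal_mul, sub_re, add_re, add_re,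
        re_one_div_eq_stripKernel, re_one_div_eq_stripKernel]
      simp [stripKernel]
    · simp

lemma finite_zeros_abs_im_le (S : SSF σ0 σ1) (h0 : S.xi 0 ≠ 0) (T : ℝ) :
    {ρ : {ρ : ℂ // S.xi ρ = 0} | |(ρ : ℂ).im| ≤ T}.Finite := by
  obtain ⟨b, h⟩ := S.exists_far
  obtain ⟨C, hC, hgr⟩ := h.exists_norm_xi_le
  refine Set.Finite.of_finite_image
    ((finite_zeros S.hxiDiff h0 hC (by norm_num) hgr (|b| + |σ1| + T)).subset ?_)
    Subtype.val_injective.injOn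
  rintro _ ⟨ρ, hρ, rfl⟩
  exact ⟨ρ.2, (norm_le_abs_re_add_abs_im _).trans (add_le_add (h.abs_re_le h0 ρ.2) hρ)⟩

lemma exists_le_norm_sub_of_xi_eq_zero {w : ℂ} (hw : S.xi w ≠ 0) :
    ∃ δ, 0 < δ ∧ ∀ ρ, S.xi ρ = 0 → δ ≤ ‖ρ - w‖ := by
  obtain ⟨δ, hδ, h⟩ := Metric.eventually_nhds_iff.1
    (S.hxiDiff.continuous.continuousAt.eventually_ne hw)
  refine ⟨δ, hδ, fun ρ hρ => ?_⟩
  by_contra! hlt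
  exact h (by rwa [dist_eq_norm]) hρ

end SSF

/-- For `F ∈ S^♯♭(σ₀,σ₁)` and `τ ≥ σ₁` with `0, τ ∉ Z(F)`, the `n`-th
`τ`-Li coefficient is well defined: the symmetric limit
`λ_F(n,τ) = lim_{T→∞} ∑_{ρ∈Z(F), |Im ρ|≤T} ord(ρ)·(1 − (ρ/(ρ−τ))^n)` exists. -/
theorem tauLi_well_defined (σ0 σ1 : ℝ) (S : SSF σ0 σ1) (τ : ℝ) (hτ : σ1 ≤ τ)
    (h0 : S.xi 0 ≠ 0) (hτZ : S.xi (τ : ℂ) ≠ 0) (n : ℕ) (hn : 0 < n) :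
    ∃ L : ℂ, Filter.Tendsto (fun T : ℝ =>
        ∑' ρ : {ρ : ℂ // S.xi ρ = 0 ∧ |ρ.im| ≤ T},
          (zeroOrder S.xi ρ : ℂ) * (1 - ((ρ : ℂ) / ((ρ : ℂ) - τ)) ^ n))
      Filter.atTop (nhds L) := by
  obtain ⟨b, h⟩ := S.exists_far
  obtain ⟨δ, hδ, hδρ⟩ := S.exists_le_norm_sub_of_xi_eq_zero hτZ
  obtain ⟨K, hK⟩ := exists_norm_li_term_sub_le n τ (A := |b| + |σ1|) (by positivity) hδ
  obtain ⟨L, hL⟩ := S.exists_tendsto_tsum_truncWeight h0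
  set r : {ρ : ℂ // S.xi ρ = 0} → ℂ := fun ρ => (zeroOrder S.xi ρ : ℂ) *
    (1 - ((ρ : ℂ) / ((ρ : ℂ) - τ)) ^ n - n * τ * I * oddWeight (ρ : ℂ).im) with hr
  have hbound : ∀ ρ : {ρ : ℂ // S.xi ρ = 0}, ‖r ρ‖ ≤
      |K| * ((zeroOrder S.xi ρ : ℝ) * (1 + |(ρ : ℂ).im|) ^ (-(17 / 16) : ℝ)) := fun ρ => by
    have h1 : (1 : ℝ) ≤ 1 + |(ρ : ℂ).im| := by linarith [abs_nonneg (ρ : ℂ).im]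
    have h2 : ((1 + |(ρ : ℂ).im|) ^ 2)⁻¹ ≤ (1 + |(ρ : ℂ).im|) ^ (-(17 / 16) : ℝ) := by
      rw [← Real.rpow_natCast, ← Real.rpow_neg (by positivity)]
      exact Real.rpow_le_rpow_of_exponent_le h1 (by norm_num)
    rw [hr, norm_mul, norm_natCast, mul_left_comm]
    gcongr
    refine (hK ρ (h.abs_re_le h0 ρ.2) (hδρ ρ ρ.2)).trans ?_
    gcongr
    exact le_abs_self K
  have hrem : Tendsto (fun T : ℝ => ∑' ρ : {ρ : ℂ // S.xi ρ = 0},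
      if |(ρ : ℂ).im| ≤ T then r ρ else 0) atTop
      (nhds (∑' ρ, r ρ)) := by
    refine tendsto_tsum_of_dominated_convergence
      ((h.summable_zeroOrder_mul h0).mul_left |K|) (fun ρ => ?_) (.of_forall fun T ρ => ?_)
    · refine tendsto_const_nhds.congr' ?_
      filter_upwards [eventually_ge_atTop |(ρ : ℂ).im|] with T hT
      rw [if_pos hT]
    · split_ifs
      · exact hbound ρ
      · rw [norm_zero]
        positivity
  refine ⟨n * τ * I * L + ∑' ρ, r ρ, Tendsto.congr (fun T => ?_)
    ((((continuous_ofReal.tendsto L).comp hL).const_mul (n * τ * I : ℂ)).add hrem)⟩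
  have hfin := S.finite_zeros_abs_im_le h0 T
  rw [tsum_subtype_and (p := fun ρ => S.xi ρ = 0) (q := fun ρ => |ρ.im| ≤ T)
    fun ρ => (zeroOrder S.xi ρ : ℂ) * (1 - (ρ / (ρ - τ)) ^ n)]
  rw [Function.comp_apply, ofReal_tsum, ← tsum_mul_left, ← Summable.tsum_add]
  · refine tsum_congr fun ρ => ?_
    unfold truncWeight
    split_ifs
    · rw [hr]
      push_cast
      ring
    · simp
  · refine summable_of_hasFiniteSupport (hfin.subset fun ρ hρ => ?_)
    by_contra hlt
    exact hρ (by simp [truncWeight, show ¬ |(ρ : ℂ).im| ≤ T from hlt])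
  · refine summable_of_hasFiniteSupport (hfin.subset fun ρ hρ => ?_)
    by_contra hlt
    exact hρ (if_neg hlt)

end
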